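/- With notation as in the context, the Rees algebra R(𝔻) = ⊕_{i≥0} 𝔻^i t^i of the diagonal ideal 𝔻 is a Cohen–Macaulay ring. -/

import Mathlib

open MvPolynomial Finset

open RingTheory.Sequence in
/-- The depth of a local ring: the supremum of lengths of regular sequences contained in the
maximal ideal. -/
noncomputable def localRingDepth (R : Type*) [CommRing R] [IsLocalRing R] : ℕ∞ :=
  sSup {d : ℕ∞ | ∃ rs : List R, (rs.length : ℕ∞) = d ∧
    (∀ r ∈ rs, r ∈ IsLocalRing.maximalIdeal R) ∧ RingTheory.Sequence.IsRegular R rs}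

/-- A ring is Cohen–Macaulay if it is Noetherian and its localization at every prime ideal is a
Cohen–Macaulay local ring, i.e. depth equals Krull dimension. -/
def IsCohenMacaulayRing (R : Type*) [CommRing R] : Prop :=
  IsNoetherianRing R ∧
    ∀ (P : Ideal R) [P.IsPrime],
      (localRingDepth (Localization.AtPrime P) : WithBot ℕ∞) =
        ringKrullDim (Localization.AtPrime P)

/-- The index of the entry in row `i`, column `j` (1-based) of an `m × n` matrix of variables. -/
def ent (m n : ℕ) (hm : 0 < m) (hn : 0 < n) (i j : ℕ) : Fin m × Fin n :=
  (⟨(i - 1) % m, Nat.mod_lt _ hm⟩, ⟨(j - 1) % n, Nat.mod_lt _ hn⟩)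

/-- The ideal generated by the maximal minors of the submatrix on the first `s` rows and first
`t` columns of a matrix of variables, where `v i j` denotes the variable sitting in row `i` and
column `j` (1-based). -/
noncomputable def maxMinors {σ : Type*} (k : Type*) [Field k] (s t : ℕ)
    (v : ℕ → ℕ → σ) : Ideal (MvPolynomial σ k) :=
  Ideal.span {d | ∃ c : ℕ → ℕ, StrictMonoOn c (Set.Icc 1 s) ∧ 1 ≤ c 1 ∧ c s ≤ t ∧
    d = (Matrix.of fun i j : Fin s =>
          (X (v ((i : ℕ) + 1) (c ((j : ℕ) + 1))) : MvPolynomial σ k)).det}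

/-- Variables of the polynomial ring `k[X,Y]`: two `m × n` matrices of indeterminates. -/
abbrev Vxy (m n : ℕ) := (Fin m × Fin n) ⊕ (Fin m × Fin n)

/-- The ring `S = k[X,Y]/(I_{s₁}(X_{s₁t₁}) + I_{s₂}(Y_{s₂t₂}))`. -/
abbrev detQuot (k : Type*) [Field k] (m n s₁ s₂ t₁ t₂ : ℕ) (hm : 0 < m) (hn : 0 < n) :=
  MvPolynomial (Vxy m n) k ⧸
    (maxMinors k s₁ t₁ (fun i j => (Sum.inl (ent m n hm hn i j) : Vxy m n)) ⊔
     maxMinors k s₂ t₂ (fun i j => (Sum.inr (ent m n hm hn i j) : Vxy m n)))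

/-- The diagonal ideal `𝔻 ⊆ S`, generated by the images of the elements `x_{ij} - y_{ij}`. -/
noncomputable def diagIdeal (k : Type*) [Field k] (m n s₁ s₂ t₁ t₂ : ℕ)
    (hm : 0 < m) (hn : 0 < n) : Ideal (detQuot k m n s₁ s₂ t₁ t₂ hm hn) :=
  Ideal.span {d | ∃ i j : ℕ, 1 ≤ i ∧ i ≤ m ∧ 1 ≤ j ∧ j ≤ n ∧
    d = Ideal.Quotient.mk _
      (X (Sum.inl (ent m n hm hn i j)) - X (Sum.inr (ent m n hm hn i j)))}

open CategoryTheory in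
/-- `M`, viewed as an `R`-module along `χ`, has projective dimension less than `n`. -/
def ProjDimLT {R S : Type u} [CommRing R] [CommRing S] (χ : R →+* S)
    (M : Type u) [AddCommGroup M] [Module S M] (n : ℕ) : Prop :=
  let := Module.compHom M χ
  HasProjectiveDimensionLT (ModuleCat.of R M) n

namespace ProjDimLT

variable {R : Type u} [CommRing R]

section

variable {S : Type u} [CommRing S] {χ : R →+* S} {M : Type u} [AddCommGroup M] [Module S M]

theorem mono {a b : ℕ} (h : ProjDimLT χ M a) (hab : a ≤ b) : ProjDimLT χ M b := by
  let := Module.compHom M χ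
  unfold ProjDimLT at h
  exact CategoryTheory.hasProjectiveDimensionLT_of_ge (ModuleCat.of R M) a b hab

theorem of_subsingleton [Subsingleton M] (n : ℕ) : ProjDimLT χ M n := by
  refine mono (a := 0) ?_ (Nat.zero_le _)
  let := Module.compHom M χ
  exact (ModuleCat.isZero_of_subsingleton (ModuleCat.of R M)).hasProjectiveDimensionLT_zero

theorem of_basis {ι : Type*} (b : letI := Module.compHom M χ; Module.Basis ι R M) :
    ProjDimLT χ M 1 := by
  let := Module.compHom M χ
  have : Module.Free R M := Module.Free.of_basis b
  have : CategoryTheory.Projective (ModuleCat.of R M) :=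
    (IsProjective.iff_projective M).1 inferInstance
  unfold ProjDimLT
  infer_instance

end

section Exact

variable {S₁ S₂ S₃ : Type u} [CommRing S₁] [CommRing S₂] [CommRing S₃]
  {χ₁ : R →+* S₁} {χ₂ : R →+* S₂} {χ₃ : R →+* S₃}
  {M₁ M₂ M₃ : Type u} [AddCommGroup M₁] [AddCommGroup M₂] [AddCommGroup M₃]
  [Module S₁ M₁] [Module S₂ M₂] [Module S₃ M₃]
  (f : M₁ →+ M₂) (g : M₂ →+ M₃)

theorem shortExact_cases (hf : ∀ r m, f (χ₁ r • m) = χ₂ r • f m)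
    (hg : ∀ r m, g (χ₂ r • m) = χ₃ r • g m) (hfi : Function.Injective f)
    (hgs : Function.Surjective g) (hfg : ∀ m, g m = 0 ↔ ∃ a, f a = m) (n : ℕ) :
    (ProjDimLT χ₁ M₁ n → ProjDimLT χ₃ M₃ n → ProjDimLT χ₂ M₂ n) ∧
    (ProjDimLT χ₁ M₁ n → ProjDimLT χ₂ M₂ (n + 1) → ProjDimLT χ₃ M₃ (n + 1)) ∧
    (ProjDimLT χ₂ M₂ n → ProjDimLT χ₃ M₃ (n + 1) → ProjDimLT χ₁ M₁ n) := by
  let := Module.compHom M₁ χ₁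
  let := Module.compHom M₂ χ₂
  let := Module.compHom M₃ χ₃
  let F : M₁ →ₗ[R] M₂ := { f with map_smul' := hf }
  let G : M₂ →ₗ[R] M₃ := { g with map_smul' := hg }
  have hFG : Function.Exact F G := fun m => (hfg m).trans (by rfl)
  let C : CategoryTheory.ShortComplex (ModuleCat R) :=
    CategoryTheory.ShortComplex.mk (ModuleCat.ofHom F) (ModuleCat.ofHom G)
      (by ext x; exact hFG.apply_apply_eq_zero x)
  have hC : C.ShortExact :=
    { exact := (CategoryTheory.ShortComplex.ShortExact.moduleCat_exact_iff_function_exact C).2 hFG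
      mono_f := (ModuleCat.mono_iff_injective _).2 hfi
      epi_g := (ModuleCat.epi_iff_surjective _).2 hgs }
  exact ⟨fun h₁ h₃ => hC.hasProjectiveDimensionLT_X₂ n h₁ h₃,
    fun h₁ h₂ => hC.hasProjectiveDimensionLT_X₃ n h₁ h₂,
    fun h₂ h₃ => hC.hasProjectiveDimensionLT_X₁ n h₂ h₃⟩

end Exact

end ProjDimLT

open IsLocalRing RingTheory.Sequence in
theorem isDomain_and_exists_isRegular_of_span_eq (h : ℕ) : ∀ (A : Type u) [CommRing A]
    [IsLocalRing A] [IsNoetherianRing A] (a : Fin h → A),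
    Ideal.span (Set.range a) = maximalIdeal A → (h : WithBot ℕ∞) ≤ ringKrullDim A →
    IsDomain A ∧ ∃ rs : List A, rs.length = h ∧ (∀ r ∈ rs, r ∈ maximalIdeal A) ∧
      IsRegular A rs := by
  induction h with
  | zero =>
    intro A _ _ _ a ha hd
    refine ⟨?_, [], rfl, by simp, IsRegular.nil A A⟩
    have h0 : maximalIdeal A = ⊥ := by
      rw [← ha, Set.range_eq_empty, Ideal.span_empty]
    exact ((isField_iff_maximalIdeal_eq).2 h0).isDomain
  | succ h ih =>
    intro A _ _ _ a ha hd
    have hht : ((h + 1 : ℕ) : ℕ∞) ≤ (maximalIdeal A).height := by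
      have := maximalIdeal_height_eq_ringKrullDim (R := A)
      rw [← this] at hd
      exact_mod_cast hd
    have hmin : ∀ q ∈ minimalPrimes A, ¬ maximalIdeal A ≤ q := by
      intro q hq hle
      have hq' : q.IsPrime := hq.1.1
      have h0 : q.height = 0 := Ideal.height_eq_zero_iff.2 hq
      have := hht.trans (Ideal.height_mono hle)
      rw [h0] at this
      simp at this
    have hsq : ¬ maximalIdeal A ≤ maximalIdeal A * maximalIdeal A := by
      intro hle
      have h0 : maximalIdeal A = ⊥ :=
        Submodule.eq_bot_of_le_smul_of_le_jacobson_bot (maximalIdeal A) (maximalIdeal A)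
          (IsNoetherian.noetherian _) hle (maximalIdeal_le_jacobson _)
      obtain ⟨q, hq, hq'⟩ := Ideal.exists_minimalPrimes_le (I := (⊥ : Ideal A))
        (J := maximalIdeal A) bot_le
      exact hmin q hq (h0.trans_le bot_le)
    obtain ⟨x, hx, hxs, hxq⟩ : ∃ x ∈ maximalIdeal A, x ∉ maximalIdeal A * maximalIdeal A ∧
        ∀ q ∈ minimalPrimes A, x ∉ q := by
      by_contra! hcon
      have hfin := minimalPrimes.finite_of_isNoetherianRing A
      have := (Ideal.subset_union_prime' (s := hfin.toFinset) (f := fun q : Ideal A => q)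
        (a := maximalIdeal A * maximalIdeal A) (b := maximalIdeal A * maximalIdeal A)
        (fun q hq => ((hfin.mem_toFinset).1 hq).1.1) (I := maximalIdeal A)).1 (by
          intro x hx
          by_cases hxs : x ∈ maximalIdeal A * maximalIdeal A
          · exact Or.inl (Or.inl hxs)
          · obtain ⟨q, hq, hxq⟩ := hcon x hx hxs
            exact Or.inr (Set.mem_biUnion (by simpa using hq) hxq))
      rcases this with h | h | ⟨q, hq, h⟩
      · exact hsq h
      · exact hsq h
      · exact hmin q (by simpa using hq) h
    obtain ⟨r, hr⟩ : ∃ r : Fin (h + 1) → A, ∑ i, r i * a i = x := by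
      rw [← ha] at hx
      simpa using (Ideal.mem_span_range_iff_exists_fun).1 hx
    have haM : ∀ i, a i ∈ maximalIdeal A := fun i => ha ▸ Ideal.subset_span ⟨i, rfl⟩
    obtain ⟨i, hi⟩ : ∃ i, IsUnit (r i) := by
      by_contra! hcon
      refine hxs ?_
      rw [← hr]
      exact Ideal.sum_mem _ fun i _ => Ideal.mul_mem_mul ((mem_maximalIdeal _).2 (hcon i)) (haM i)
    have hai : a i ∈ Ideal.span {x} ⊔ Ideal.span (Set.range (a ∘ i.succAbove)) := by
      obtain ⟨u, hu⟩ := hi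
      have : a i = (↑u⁻¹ : A) * (x - ∑ j, r (i.succAbove j) * a (i.succAbove j)) := by
        rw [← hr, Fin.sum_univ_succAbove _ i, add_sub_cancel_right, ← hu, Units.inv_mul_cancel_left]
      rw [this]
      refine Ideal.mul_mem_left _ _ (Ideal.sub_mem _ ?_ (Ideal.sum_mem _ fun j _ => ?_))
      · exact Ideal.mem_sup_left (Ideal.mem_span_singleton_self x)
      · exact Ideal.mem_sup_right (Ideal.mul_mem_left _ _ (Ideal.subset_span ⟨j, rfl⟩))
    have hsup : Ideal.span {x} ⊔ Ideal.span (Set.range (a ∘ i.succAbove)) = maximalIdeal A := by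
      refine le_antisymm (sup_le ?_ ?_) ?_
      · simpa [Ideal.span_singleton_le_iff_mem] using hx
      · rw [Ideal.span_le]; rintro _ ⟨j, rfl⟩; exact haM _
      · rw [← ha, Ideal.span_le]
        rintro _ ⟨j, rfl⟩
        rcases eq_or_ne j i with rfl | hj
        · exact hai
        · obtain ⟨j', rfl⟩ := Fin.exists_succAbove_eq hj
          exact Ideal.mem_sup_right (Ideal.subset_span ⟨j', rfl⟩)
    have hne : Ideal.span {x} ≠ ⊤ := fun h =>
      (maximalIdeal.isMaximal A).ne_top (top_le_iff.1 (h ▸ (by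
        simpa [Ideal.span_singleton_le_iff_mem] using hx)))
    have : Nontrivial (A ⧸ Ideal.span {x}) := Ideal.Quotient.nontrivial_iff.2 hne
    have : IsLocalRing (A ⧸ Ideal.span {x}) :=
      IsLocalRing.of_surjective' (Ideal.Quotient.mk _) Ideal.Quotient.mk_surjective
    have hmax : (maximalIdeal A).map (Ideal.Quotient.mk (Ideal.span {x})) =
        maximalIdeal (A ⧸ Ideal.span {x}) :=
      IsLocalRing.map_maximalIdeal_of_surjective _ Ideal.Quotient.mk_surjective
    have hdim : (h : WithBot ℕ∞) ≤ ringKrullDim (A ⧸ Ideal.span {x}) := by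
      have h1 := ringKrullDim_le_ringKrullDim_quotient_add_card ({x} : Finset A) (by
        rw [IsLocalRing.ringJacobson_eq_maximalIdeal]; simpa using hx)
      rw [coe_singleton, card_singleton] at h1
      have h2 := hd.trans h1
      push_cast at h2
      exact (ENat.WithBot.add_le_add_one_right_iff).1 h2
    obtain ⟨hdom, rs, hrl, hrm, hrr⟩ := ih (A ⧸ Ideal.span {x})
      (Ideal.Quotient.mk _ ∘ a ∘ i.succAbove) (by
        rw [← hmax, ← hsup, Ideal.map_sup, Ideal.map_span, Ideal.map_span, Set.range_comp]
        simp) hdim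
    have hprime : (Ideal.span {x}).IsPrime := (Ideal.Quotient.isDomain_iff_prime _).1 hdom
    obtain ⟨q, hq, hqx⟩ := Ideal.exists_minimalPrimes_le (I := (⊥ : Ideal A))
        (J := Ideal.span {x}) bot_le
    have hqp : q.IsPrime := hq.1.1
    have hq0 : q = ⊥ := by
      refine Submodule.eq_bot_of_le_smul_of_le_jacobson_bot (maximalIdeal A) q
          (IsNoetherian.noetherian _) (fun y hy => ?_) (maximalIdeal_le_jacobson _)
      obtain ⟨z, rfl⟩ := Ideal.mem_span_singleton'.1 (hqx hy)
      rw [mul_comm]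
      exact Ideal.mul_mem_mul hx ((hqp.mem_or_mem hy).resolve_right (hxq q hq))
    have hA : IsDomain A := IsDomain.of_bot_isPrime A (hbp := hq0 ▸ hqp)
    refine ⟨hA, ?_⟩
    obtain ⟨rs', rfl⟩ : ∃ rs' : List A, rs'.map (Ideal.Quotient.mk (Ideal.span {x})) = rs :=
      List.map_surjective_iff.2 Ideal.Quotient.mk_surjective rs
    refine ⟨x :: rs', by simpa using hrl, ?_, ?_⟩
    · intro y hy
      rcases List.mem_cons.1 hy with rfl | hy
      · exact hx
      · have := hrm _ (List.mem_map_of_mem hy)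
        exact (mem_maximalIdeal _).2 fun hu => (mem_maximalIdeal _).1 this (hu.map _)
    · have hx0 : x ≠ 0 := fun h => hxs (h ▸ Ideal.zero_mem _)
      refine (isRegular_cons_iff A x rs').2 ⟨(IsRegular.of_ne_zero hx0).left, ?_⟩
      have e : QuotSMulTop x A ≃ₗ[A] (A ⧸ Ideal.span {x}) :=
        Submodule.quotEquivOfEq _ _ (by
          rw [← Submodule.ideal_span_singleton_smul, Ideal.smul_eq_mul, Ideal.mul_top])
      rw [e.isRegular_congr]
      refine (AddEquiv.isRegular_congr (e := AddEquiv.refl (A ⧸ Ideal.span {x})) ?_).2 hrr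
      exact List.forall₂_map_right_iff.mpr <| List.forall₂_same.mpr fun r _ y =>
        (algebraMap_smul (A ⧸ Ideal.span {x}) r y).symm

open IsLocalRing RingTheory.Sequence CategoryTheory Abelian in
theorem subsingleton_ext_of_hasProjectiveDimensionLT {A : Type u} [CommRing A] [IsLocalRing A]
    [IsNoetherianRing A] (N : ModuleCat.{u} A) [Module.Finite A N]
    (hN : Module.support A N ⊆ PrimeSpectrum.zeroLocus (maximalIdeal A))
    (rs : List A) (mem : ∀ r ∈ rs, r ∈ maximalIdeal A) (reg : IsRegular A rs) (c : ℕ) :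
    ∀ (M : ModuleCat.{u} A) [Module.Finite A M], HasProjectiveDimensionLT M (c + 1) →
      ∀ i, i + c < rs.length → Subsingleton (Ext N M i) := by
  have key : ∀ (M : ModuleCat.{u} A) [Module.Finite A M], Projective M →
      ∀ i, i < rs.length → Subsingleton (Ext N M i) := by
    intro M _ hM
    rcases subsingleton_or_nontrivial M with hM0 | hM0
    · intro i _
      have : HasInjectiveDimensionLT M 0 :=
        (ModuleCat.isZero_of_subsingleton M).hasInjectiveDimensionLT_zero
      exact HasInjectiveDimensionLT.subsingleton M 0 i (Nat.zero_le _) N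
    have hM' : Module.Projective A M := (IsProjective.iff_projective M).2 hM
    have hne : ∀ I : Ideal A, I ≤ maximalIdeal A → I • (⊤ : Submodule A M) < ⊤ := by
      intro I hI
      refine lt_top_iff_ne_top.2 fun h => ?_
      have := Submodule.eq_bot_of_le_smul_of_le_jacobson_bot I (⊤ : Submodule A M)
        (Module.Finite.fg_top) h.ge (hI.trans (maximalIdeal_le_jacobson _))
      exact bot_ne_top this.symm
    have hreg : IsRegular M rs := by
      refine ⟨?_, ?_⟩
      · have := reg.toIsWeaklyRegular.isWeaklyRegular_lTensor (M₂ := M)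
        exact ((TensorProduct.rid A M).isWeaklyRegular_congr rs).1 this
      · exact (hne _ (Ideal.span_le.2 mem)).ne'
    exact ModuleCat.subsingleton_ext_of_exists_isRegular (maximalIdeal A) N hN M
      (hne _ le_rfl) rs mem hreg
  induction c with
  | zero =>
    intro M _ hM i hi
    exact key M (projective_iff_hasProjectiveDimensionLT_one.2 hM) i hi
  | succ c ih =>
    intro M _ hM i hi
    obtain ⟨n, f, hf⟩ := Module.Finite.exists_fin' A M
    let C : ShortComplex (ModuleCat.{u} A) := ShortComplex.mk
      (ModuleCat.ofHom f.ker.subtype) (ModuleCat.ofHom f) (by ext x; exact x.2)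
    have hC : C.ShortExact :=
      { exact := by
          refine (ShortComplex.ShortExact.moduleCat_exact_iff_function_exact C).2 ?_
          exact LinearMap.exact_subtype_ker_map f
        mono_f := (ModuleCat.mono_iff_injective _).2 Subtype.val_injective
        epi_g := (ModuleCat.epi_iff_surjective _).2 hf }
    have hP : Projective C.X₂ := (IsProjective.iff_projective (Fin n → A)).1 inferInstance
    have hX₁ : HasProjectiveDimensionLT C.X₁ (c + 1) :=
      hC.hasProjectiveDimensionLT_X₁ (c + 1)
        (hasProjectiveDimensionLT_of_ge _ 1 _ (by omega)) hM
    have : Module.Finite A C.X₁ := inferInstanceAs (Module.Finite A f.ker)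
    have : Module.Finite A C.X₂ := inferInstanceAs (Module.Finite A (Fin n → A))
    have h₁ := ih C.X₁ hX₁ (i + 1) (by omega)
    have h₂ := key C.X₂ hP i (by omega)
    refine subsingleton_of_forall_eq 0 fun x => ?_
    obtain ⟨y, hy⟩ := Ext.covariant_sequence_exact₃ N hC (x : Ext N C.X₃ i) rfl
      (Subsingleton.elim _ _)
    rw [← hy, Subsingleton.elim y 0]
    simp

theorem add_height_le_height_comap {R R' : Type*} [CommRing R] [CommRing R'] (f : R →+* R')
    (hf : Function.Surjective f) (n : ℕ) : ∀ (P : Ideal R') [P.IsPrime], (n : ℕ∞) ≤ P.height →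
    n + (RingHom.ker f).height ≤ (P.comap f).height := by
  induction n with
  | zero =>
    intro P _ _
    rw [Nat.cast_zero, zero_add, RingHom.ker_eq_comap_bot]
    exact Ideal.height_mono (Ideal.comap_mono bot_le)
  | succ n ih =>
    intro P _ hn
    obtain ⟨Q, hQ, hQP, hQn⟩ : ∃ Q : Ideal R', Q.IsPrime ∧ Q < P ∧ (n : ℕ∞) ≤ Q.height := by
      by_contra! hcon
      have : P.height ≤ n := Ideal.height_le_iff.2 fun Q hQ hQP => hcon Q hQ hQP
      have := hn.trans this
      exact absurd (by exact_mod_cast this : n + 1 ≤ n) (by omega)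
    have hlt : Q.comap f < P.comap f :=
      lt_of_le_of_ne (Ideal.comap_mono hQP.le) fun h =>
        hQP.ne (Ideal.comap_injective_of_surjective f hf h)
    calc ((n + 1 : ℕ) : ℕ∞) + (RingHom.ker f).height
        = (n + (RingHom.ker f).height) + 1 := by push_cast; ring
      _ ≤ (Q.comap f).height + 1 := by gcongr; exact ih Q hQn
      _ ≤ _ := Ideal.height_add_one_le_of_lt_of_isPrime hlt

theorem localRingDepth_le_ringKrullDim (A : Type*) [CommRing A] [IsLocalRing A]
    [IsNoetherianRing A] : (localRingDepth A : WithBot ℕ∞) ≤ ringKrullDim A := by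
  rw [← IsLocalRing.maximalIdeal_height_eq_ringKrullDim, WithBot.coe_le_coe]
  refine sSup_le ?_
  rintro _ ⟨rs, rfl, -, reg⟩
  have h := ringKrullDim_add_length_eq_ringKrullDim_of_isRegular rs reg
  have : Nontrivial (A ⧸ Ideal.ofList rs) := Ideal.Quotient.nontrivial_iff.2 (by
    have := reg.top_ne_smul
    simpa [eq_comm] using this)
  have h0 : (0 : WithBot ℕ∞) ≤ ringKrullDim (A ⧸ Ideal.ofList rs) :=
    ringKrullDim_nonneg_of_nontrivial
  rw [← WithBot.coe_le_coe, IsLocalRing.maximalIdeal_height_eq_ringKrullDim, ← h]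
  exact le_add_of_nonneg_left h0

open IsLocalRing RingTheory.Sequence CategoryTheory Abelian in
/-- A surjective image of a regular ring whose projective dimension is at most the height of the
kernel is Cohen–Macaulay. -/
theorem isCohenMacaulayRing_of_projDimLT {R R' : Type u} [CommRing R] [CommRing R']
    [IsRegularRing R] (f : R →+* R') (hf : Function.Surjective f) (c : ℕ)
    (hpd : ProjDimLT f R' (c + 1)) (hc : (c : ℕ∞) ≤ (RingHom.ker f).height) :
    IsCohenMacaulayRing R' := by
  have hnoeth : IsNoetherianRing R' := isNoetherianRing_of_surjective R R' f hf
  refine ⟨hnoeth, fun P hP => le_antisymm (localRingDepth_le_ringKrullDim _) ?_⟩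
  let p := P.comap f
  let : Algebra R R' := f.toAlgebra
  obtain ⟨h, hh⟩ : ∃ h : ℕ, p.height = h :=
    ENat.ne_top_iff_exists.1 (Ideal.height_ne_top_of_isPrime) |>.imp fun _ h => h.symm
  obtain ⟨d, hd⟩ : ∃ d : ℕ, P.height = d :=
    ENat.ne_top_iff_exists.1 (Ideal.height_ne_top_of_isPrime) |>.imp fun _ h => h.symm
  have hdc : d + c ≤ h := by
    have := add_height_le_height_comap f hf d P hd.ge
    have := (add_le_add le_rfl hc).trans this
    change _ ≤ p.height at this
    rw [hh] at this
    exact_mod_cast this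
  let A := Localization.AtPrime p
  let B := Localization.AtPrime P
  have hregA : IsRegularLocalRing A := IsRegularRing.isRegularLocalRing_localization p
  have hdimA : ringKrullDim A = h := by
    rw [IsLocalization.AtPrime.ringKrullDim_eq_height p A, hh]; rfl
  obtain ⟨-, rs, hrl, hrm, hrr⟩ : IsDomain A ∧ ∃ rs : List A, rs.length = h ∧
      (∀ r ∈ rs, r ∈ maximalIdeal A) ∧ IsRegular A rs := by
    have h1 := hregA.spanFinrank_maximalIdeal
    rw [hdimA] at h1
    have h2 : (maximalIdeal A).spanFinrank = h := by exact_mod_cast h1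
    have hfg : (maximalIdeal A).FG := IsNoetherian.noetherian _
    have h3 := Submodule.FG.generators_ncard hfg
    have h4 := Submodule.FG.finite_generators hfg
    have := h4.fintype
    have h5 : Fintype.card (maximalIdeal A).generators = h := by
      rw [← Nat.card_eq_fintype_card, Nat.card_coe_set_eq, h3, h2]
    let e := Fintype.equivFinOfCardEq h5
    refine isDomain_and_exists_isRegular_of_span_eq h A (fun i => (e.symm i : A)) ?_ hdimA.ge
    have : Set.range (fun i => (e.symm i : A)) = (maximalIdeal A).generators := by
      rw [show (fun i => (e.symm i : A)) = Subtype.val ∘ e.symm from rfl,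
        EquivLike.range_comp, Subtype.range_coe]
    rw [this]
    exact Submodule.span_generators _
  let M := ModuleCat.of R R'
  have hM : HasProjectiveDimensionLE M c := hpd
  have hMp := ModuleCat.localizedModule_hasProjectiveDimensionLE c p.primeCompl M
  let e₀ : A →+* B := Localization.localRingHom p P f rfl
  let : Algebra A B := e₀.toAlgebra
  have : IsScalarTower R A B := IsScalarTower.of_algebraMap_eq fun x => by
    change _ = e₀ _
    rw [Localization.localRingHom_to_map]
    rfl
  have hlm : IsLocalizedModule p.primeCompl (IsScalarTower.toAlgHom R R' B).toLinearMap := by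
    rw [isLocalizedModule_iff_isLocalization]
    have : Algebra.algebraMapSubmonoid R' p.primeCompl = P.primeCompl := by
      ext y
      constructor
      · rintro ⟨x, hx, rfl⟩
        exact hx
      · intro hy
        obtain ⟨x, rfl⟩ := hf y
        exact ⟨x, hy, rfl⟩
    rw [this]
    infer_instance
  let L := M.localizedModule p.primeCompl
  have hloc := ModuleCat.localizedModule_isLocalizedModule M p.primeCompl
  let e := IsLocalizedModule.linearEquiv p.primeCompl
    (M.localizedModuleMkLinearMap p.primeCompl) (IsScalarTower.toAlgHom R R' B).toLinearMap
  let e' : L ≃ₗ[A] B := e.extendScalarsOfIsLocalization p.primeCompl A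
  have hfinR : Module.Finite R R' := Module.Finite.of_surjective (Algebra.linearMap R R') hf
  have hfin : Module.Finite A L :=
    Module.Finite.of_isLocalizedModule p.primeCompl (M.localizedModuleMkLinearMap p.primeCompl)
  have hL : Nontrivial L := e'.toEquiv.nontrivial
  have hlt : maximalIdeal A • (⊤ : Submodule A L) < ⊤ := by
    refine lt_top_iff_ne_top.2 fun h => ?_
    exact bot_ne_top (Submodule.eq_bot_of_le_smul_of_le_jacobson_bot _ (⊤ : Submodule A L)
      Module.Finite.fg_top h.ge (maximalIdeal_le_jacobson _)).symm
  let N := ModuleCat.of A (ResidueField A)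
  have hsupp : Module.support A N = PrimeSpectrum.zeroLocus (maximalIdeal A) := by
    have := Module.support_of_algebra (R := A) (A := ResidueField A)
    rwa [show algebraMap A (ResidueField A) = residue A from rfl, ker_residue] at this
  obtain ⟨ss, hsl, hsm, hsr⟩ := ModuleCat.exists_isRegular_of_exists_subsingleton_ext
    (maximalIdeal A) (h - c) L hlt N hsupp fun i hi =>
      subsingleton_ext_of_hasProjectiveDimensionLT N hsupp.le rs hrm hrr c L hMp i (by omega)
  have hdimB : ringKrullDim B = d := by
    rw [IsLocalization.AtPrime.ringKrullDim_eq_height P B, hd]; rfl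
  change ringKrullDim B ≤ _
  rw [hdimB]
  have hdepth : ((h - c : ℕ) : ℕ∞) ≤ localRingDepth B := by
    refine le_sSup ⟨ss.map e₀, by simp [hsl], ?_, ?_⟩
    · intro r hr
      obtain ⟨s, hs, rfl⟩ := List.mem_map.1 hr
      have : IsLocalHom e₀ := Localization.isLocalHom_localRingHom p P f rfl
      exact (mem_maximalIdeal _).2 fun hu => (mem_maximalIdeal _).1 (hsm s hs)
        (isUnit_of_map_unit e₀ s hu)
    · refine ((e'.toAddEquiv).isRegular_congr (bs := ss.map e₀) ?_).1 hsr
      exact List.forall₂_map_right_iff.mpr <| List.forall₂_same.mpr fun r _ x =>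
        (e'.map_smul r x).trans (Algebra.smul_def r (e' x))
  have : ((d : ℕ) : ℕ∞) ≤ localRingDepth B :=
    le_trans (by exact_mod_cast (by omega : d ≤ h - c)) hdepth
  exact_mod_cast this

/-- The polynomials whose `i`-th coefficient lies in `𝔞 ^ (i + 1 - D) ⊓ 𝔮`, a module over the
Rees algebra of `𝔞`. -/
def filtPoly {A : Type*} [CommRing A] (𝔞 : Ideal A) (D : ℕ) (𝔮 : Ideal A) :
    Submodule (reesAlgebra 𝔞) (Polynomial A) where
  carrier := {p | ∀ i, p.coeff i ∈ 𝔞 ^ (i + 1 - D) ∧ p.coeff i ∈ 𝔮}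
  add_mem' hp hq i := by
    rw [Polynomial.coeff_add]
    exact ⟨add_mem (hp i).1 (hq i).1, add_mem (hp i).2 (hq i).2⟩
  zero_mem' i := by simp
  smul_mem' x p hp i := by
    change ((x : Polynomial A) * p).coeff i ∈ _ ∧ ((x : Polynomial A) * p).coeff i ∈ _
    rw [Polynomial.coeff_mul]
    refine ⟨sum_mem fun ⟨a, b⟩ hab => ?_, sum_mem fun ⟨a, b⟩ hab =>
      Ideal.mul_mem_left _ _ (hp b).2⟩
    have h1 := Ideal.mul_mem_mul (mem_reesAlgebra_iff _ _ |>.1 x.2 a) (hp b).1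
    rw [← pow_add] at h1
    have := mem_antidiagonal.1 hab
    exact Ideal.pow_le_pow_right (by grind) h1

/-- The constant coefficient, as a ring homomorphism on the Rees algebra. -/
noncomputable def reesCoeffZero {A : Type*} [CommRing A] (𝔞 : Ideal A) : reesAlgebra 𝔞 →+* A :=
  (Polynomial.constantCoeff).comp (reesAlgebra 𝔞).val.toRingHom

/-- A presentation of a Rees algebra with the expected homological bounds for an ideal generated
by `t` elements. -/
structure ReesPresentation {R A : Type u} [CommRing R] [CommRing A] (𝔞 : Ideal A) (t : ℕ)
    (χ : R →+* reesAlgebra 𝔞) : Prop where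
  surjective : Function.Surjective χ
  projDim : ∀ D, ProjDimLT χ (filtPoly 𝔞 D ⊤) (if D ≤ t then t else t + 1)
  projDim_base : ProjDimLT ((reesCoeffZero 𝔞).comp χ) A (t + 1)
  le_height : ((t - 1 : ℕ) : ℕ∞) ≤ (RingHom.ker χ).height
  ne_bot : 1 ≤ t → 𝔞 ≠ ⊥

theorem reesPresentation_bot (A : Type u) [CommRing A] [IsDomain A] :
    ReesPresentation (⊥ : Ideal A) 0 (algebraMap A (reesAlgebra (⊥ : Ideal A))) where
  surjective x := by
    refine ⟨(x : Polynomial A).coeff 0, Subtype.ext ?_⟩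
    change Polynomial.C _ = (x : Polynomial A)
    ext i
    rcases Nat.eq_zero_or_pos i with rfl | hi
    · simp
    · have := mem_reesAlgebra_iff _ _ |>.1 x.2 i
      rw [Ideal.bot_pow hi.ne'] at this
      rw [Polynomial.coeff_C_of_ne_zero hi.ne']
      exact (Ideal.mem_bot.1 this).symm
  projDim D := by
    have hz : ∀ p ∈ filtPoly (⊥ : Ideal A) D ⊤, ∀ i, D ≤ i → p.coeff i = 0 := by
      intro p hp i hi
      have := (hp i).1
      rw [← Ideal.zero_eq_bot, zero_pow (by omega)] at this
      exact Ideal.mem_bot.1 this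
    rcases Nat.eq_zero_or_pos D with rfl | hD
    · have : Subsingleton (filtPoly (⊥ : Ideal A) 0 ⊤) :=
        subsingleton_of_forall_eq 0 fun p => Subtype.ext <| by
          ext i
          simpa using hz p p.2 i (Nat.zero_le i)
      exact ProjDimLT.of_subsingleton _
    · rw [if_neg (by omega)]
      let := Module.compHom (filtPoly (⊥ : Ideal A) D ⊤)
        (algebraMap A (reesAlgebra (⊥ : Ideal A)))
      refine ProjDimLT.of_basis (ι := Fin D) (Module.Basis.ofEquivFun
        { toFun := fun p i => (p : Polynomial A).coeff i
          map_add' := fun p q => by ext i; simp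
          map_smul' := fun r p => by
            ext i
            change ((Polynomial.C r) * (p : Polynomial A)).coeff i = _
            simp
          invFun := fun v => ⟨∑ i : Fin D, Polynomial.monomial (i : ℕ) (v i), fun i => by
            simp only [Polynomial.finsetSum_coeff, Polynomial.coeff_monomial]
            refine ⟨sum_mem fun j _ => ?_, trivial⟩
            split_ifs with h
            · subst h
              rw [show (j : ℕ) + 1 - D = 0 by omega]
              simp
            · simp⟩
          left_inv := fun p => Subtype.ext <| by
            ext i
            simp only [Polynomial.finsetSum_coeff, Polynomial.coeff_monomial]
            by_cases h : i < D
            · rw [sum_eq_single (⟨i, h⟩ : Fin D)] <;> grind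
            · rw [hz p p.2 i (by omega)]
              exact sum_eq_zero fun j _ => if_neg (by omega)
          right_inv := fun v => by
            ext i
            simp only [Polynomial.finsetSum_coeff, Polynomial.coeff_monomial]
            rw [sum_eq_single i] <;> grind })
  projDim_base := by
    have h : (reesCoeffZero (⊥ : Ideal A)).comp (algebraMap A _) = RingHom.id A := by
      ext a
      change (Polynomial.C a).coeff 0 = a
      simp
    rw [h]
    exact ProjDimLT.of_basis (ι := Unit) (Module.Basis.singleton Unit A)
  le_height := by simp
  ne_bot h := by omega

section Substitution

variable {A : Type u} [CommRing A] (z : A)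

/-- The substitution `w ↦ z λ` from `A[w][λ]` to `A[λ]`. -/
noncomputable def substMulX : Polynomial (Polynomial A) →+* Polynomial A :=
  Polynomial.eval₂RingHom
    (Polynomial.eval₂RingHom Polynomial.C (Polynomial.C z * Polynomial.X)) Polynomial.X

theorem substMulX_monomial (i j : ℕ) (a : A) :
    substMulX z (Polynomial.monomial j (Polynomial.monomial i a)) =
      Polynomial.monomial (i + j) (a * z ^ i) := by
  simp only [substMulX, Polynomial.coe_eval₂RingHom, Polynomial.eval₂_monomial]
  rw [mul_pow, ← Polynomial.C_pow, ← mul_assoc, ← Polynomial.C_mul, mul_assoc, ← pow_add,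
    Polynomial.C_mul_X_pow_eq_monomial]

theorem substMulX_coeff (p : Polynomial (Polynomial A)) (i : ℕ) :
    (substMulX z p).coeff i =
      ∑ x ∈ antidiagonal i, (p.coeff x.2).coeff x.1 * z ^ x.1 := by
  induction p using Polynomial.induction_on' with
  | add p q hp hq => simp [map_add, hp, hq, add_mul, sum_add_distrib]
  | monomial j q =>
    induction q using Polynomial.induction_on' with
    | add p q hp hq =>
      rw [map_add, map_add, Polynomial.coeff_add, hp, hq, ← sum_add_distrib]
      simp [Polynomial.coeff_add, add_mul]
    | monomial l a =>
      rw [substMulX_monomial, Polynomial.coeff_monomial]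
      simp only [Polynomial.coeff_monomial]
      split_ifs with h
      · rw [sum_eq_single (l, j)]
        · simp
        · rintro ⟨b, c⟩ - hne
          dsimp only
          split_ifs with h1
          · rw [Polynomial.coeff_monomial, if_neg (by rintro rfl; exact hne (by rw [h1])), zero_mul]
          · simp
        · intro hn
          exact absurd (mem_antidiagonal.2 h) hn
      · refine (sum_eq_zero ?_).symm
        rintro ⟨b, c⟩ hbc
        dsimp only
        split_ifs with h1
        · rw [Polynomial.coeff_monomial, if_neg, zero_mul]
          rintro rfl
          exact h (h1 ▸ mem_antidiagonal.1 hbc)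
        · simp

theorem exists_polynomial_eval_eq {𝔞 : Ideal A} (n : ℕ) : ∀ x ∈ (𝔞 ⊔ Ideal.span {z}) ^ n,
    ∃ p : Polynomial A, (∀ l, p.coeff l ∈ 𝔞 ^ (n - l)) ∧ (∀ l, n < l → p.coeff l = 0) ∧
      p.eval z = x := by
  induction n with
  | zero =>
    intro x _
    exact ⟨Polynomial.C x, by simp, fun l hl => Polynomial.coeff_C_of_ne_zero (by omega), by simp⟩
  | succ n ih =>
    intro x hx
    rw [pow_succ'] at hx
    induction hx using Submodule.mul_induction_on' with
    | mem_mul_mem m hm y hy =>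
      obtain ⟨p, hp, hp', rfl⟩ := ih y hy
      obtain ⟨a, ha, b, hb, rfl⟩ := Submodule.mem_sup.1 hm
      obtain ⟨c, rfl⟩ := Ideal.mem_span_singleton'.1 hb
      refine ⟨Polynomial.C a * p + Polynomial.C c * p * Polynomial.X, ?_, ?_, by simp; ring⟩
      · rintro (_ | l)
        · rw [Polynomial.coeff_add, Polynomial.coeff_mul_X_zero, add_zero,
            Polynomial.coeff_C_mul]
          have := Ideal.mul_mem_mul ha (hp 0)
          rwa [← pow_succ'] at this
        · rw [Polynomial.coeff_add, Polynomial.coeff_C_mul, Polynomial.coeff_mul_X,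
            Polynomial.coeff_C_mul]
          refine add_mem ?_ ?_
          · rcases le_or_gt (l + 1) n with hl | hl
            · have := Ideal.mul_mem_mul ha (hp (l + 1))
              rw [← pow_succ'] at this
              rwa [show n + 1 - (l + 1) = n - (l + 1) + 1 by omega]
            · rw [hp' _ hl, mul_zero]
              exact zero_mem _
          · rw [Nat.add_sub_add_right]
            exact Ideal.mul_mem_left _ _ (hp l)
      · rintro (_ | l) hl
        · omega
        · rw [Polynomial.coeff_add, Polynomial.coeff_C_mul, Polynomial.coeff_mul_X,
            Polynomial.coeff_C_mul, hp' l (by omega), hp' (l + 1) (by omega)]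
          simp
    | add x hx y hy hx' hy' =>
      obtain ⟨p, hp, hp', rfl⟩ := hx'
      obtain ⟨q, hq, hq', rfl⟩ := hy'
      exact ⟨p + q, fun l => by rw [Polynomial.coeff_add]; exact add_mem (hp l) (hq l),
        fun l hl => by rw [Polynomial.coeff_add, hp' l hl, hq' l hl, add_zero], by simp⟩

theorem exists_mul_eq_of_substMulX_eq_zero {p : Polynomial (Polynomial A)}
    (hp : substMulX z p = 0) :
    ∃ q, (Polynomial.C Polynomial.X - Polynomial.C (Polynomial.C z) * Polynomial.X) * q = p := by
  set u : Polynomial (Polynomial A) :=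
    Polynomial.C Polynomial.X - Polynomial.C (Polynomial.C z) * Polynomial.X
  let π := Ideal.Quotient.mk (Ideal.span {u})
  have h : (π.comp (Polynomial.mapRingHom Polynomial.C)).comp (substMulX z) = π := by
    refine Polynomial.ringHom_ext' (Polynomial.ringHom_ext' ?_ ?_) ?_
    · ext a
      simp [substMulX]
    · have : π u = 0 := Ideal.Quotient.eq_zero_iff_mem.2 (Ideal.mem_span_singleton_self u)
      have h2 : π (Polynomial.C Polynomial.X) =
          π (Polynomial.C (Polynomial.C z) * Polynomial.X) := by
        rw [← sub_eq_zero, ← map_sub]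
        exact this
      simp [substMulX, h2]
    · simp [substMulX]
  have h1 : π p = 0 := by
    rw [← h]
    simp [hp]
  obtain ⟨q, hq⟩ := Ideal.mem_span_singleton.1 (Ideal.Quotient.eq_zero_iff_mem.1 h1)
  exact ⟨q, hq.symm⟩

theorem substMulX_mem {𝔞 : Ideal A} {D : ℕ} {p : Polynomial (Polynomial A)}
    (hp : p ∈ filtPoly (𝔞.map Polynomial.C) D ⊤) :
    substMulX z p ∈ filtPoly (𝔞 ⊔ Ideal.span {z}) D ⊤ := by
  refine fun i => ⟨?_, trivial⟩
  rw [substMulX_coeff]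
  refine sum_mem fun ⟨l, j⟩ hlj => ?_
  have h1 := (hp j).1
  rw [← Ideal.map_pow, Ideal.mem_map_C_iff] at h1
  have h2 := Ideal.mul_mem_mul (Ideal.pow_right_mono (le_sup_left (b := Ideal.span {z})) _ (h1 l))
    (Ideal.pow_mem_pow (Ideal.mem_sup_right (Ideal.mem_span_singleton_self z) :
      z ∈ 𝔞 ⊔ Ideal.span {z}) l)
  rw [← pow_add] at h2
  have := mem_antidiagonal.1 hlj
  exact Ideal.pow_le_pow_right (by grind) h2

theorem substMulX_mem_reesAlgebra {𝔞 : Ideal A} (p : reesAlgebra (𝔞.map Polynomial.C)) :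
    substMulX z p ∈ reesAlgebra (𝔞 ⊔ Ideal.span {z}) := by
  have h : (p : Polynomial (Polynomial A)) ∈ filtPoly (𝔞.map Polynomial.C) 1 ⊤ :=
    fun i => ⟨mem_reesAlgebra_iff _ _ |>.1 p.2 i, trivial⟩
  exact fun i => (substMulX_mem z h i).1

/-- The substitution `w ↦ z λ` on Rees algebras. -/
noncomputable def reesSubst (𝔞 : Ideal A) :
    reesAlgebra (𝔞.map (Polynomial.C : A →+* Polynomial A)) →+*
      reesAlgebra (𝔞 ⊔ Ideal.span {z}) :=
  ((substMulX z).comp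
    (reesAlgebra (𝔞.map (Polynomial.C : A →+* Polynomial A))).val.toRingHom).codRestrict
      (reesAlgebra (𝔞 ⊔ Ideal.span {z})) (substMulX_mem_reesAlgebra z)

theorem exists_substMulX_eq {𝔞 : Ideal A} {D : ℕ} (hD : 1 ≤ D) {q : Polynomial A}
    (hq : q ∈ filtPoly (𝔞 ⊔ Ideal.span {z}) D ⊤) :
    ∃ p ∈ filtPoly (𝔞.map (Polynomial.C : A →+* Polynomial A)) D ⊤, substMulX z p = q := by
  have key : ∀ i x, x ∈ (𝔞 ⊔ Ideal.span {z}) ^ (i + 1 - D) →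
      ∃ p ∈ filtPoly (𝔞.map (Polynomial.C : A →+* Polynomial A)) D ⊤,
        substMulX z p = Polynomial.monomial i x := by
    intro i x hx
    obtain ⟨r, hr, hr', rfl⟩ := exists_polynomial_eval_eq z _ x hx
    refine ⟨∑ l ∈ range (i + 1), Polynomial.monomial (i - l) (Polynomial.monomial l (r.coeff l)),
      sum_mem fun l hl j => ⟨?_, trivial⟩, ?_⟩
    · rw [Polynomial.coeff_monomial]
      split_ifs with h
      · rw [← Ideal.map_pow, Ideal.mem_map_C_iff]
        intro b
        rw [Polynomial.coeff_monomial]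
        split_ifs with h'
        · exact Ideal.pow_le_pow_right (by grind) (hr l)
        · exact zero_mem _
      · exact zero_mem _
    · rw [map_sum, Polynomial.eval_eq_sum_range' (n := i + 1), map_sum]
      · refine sum_congr rfl fun l hl => ?_
        rw [substMulX_monomial, Nat.add_sub_of_le (Nat.lt_succ_iff.1 (mem_range.1 hl))]
      · refine Nat.lt_succ_of_le (Polynomial.natDegree_le_iff_coeff_eq_zero.2 fun l hl => ?_)
        exact hr' l (by omega)
  choose f hf hf' using key
  refine ⟨∑ i ∈ q.support, f i (q.coeff i) (hq i).1, sum_mem fun i _ => hf _ _ _, ?_⟩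
  rw [map_sum]
  simp only [hf']
  exact q.as_sum_support.symm

end Substitution

section Step

variable {R A : Type u} [CommRing R] [CommRing A] {𝔞 : Ideal A} {z : A} {t : ℕ}
  {χ : R →+* reesAlgebra (𝔞.map (Polynomial.C : A →+* Polynomial A))}

theorem mem_filtPoly_of_mul_mem (hz : ∀ k a, z * a ∈ 𝔞 ^ k → a ∈ 𝔞 ^ k) {D : ℕ}
    {q : Polynomial (Polynomial A)}
    (hq : (Polynomial.C Polynomial.X - Polynomial.C (Polynomial.C z) * Polynomial.X) * q ∈
      filtPoly (𝔞.map (Polynomial.C : A →+* Polynomial A)) (D + 1) ⊤) :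
    q ∈ filtPoly (𝔞.map (Polynomial.C : A →+* Polynomial A)) D ⊤ := by
  have hc : ∀ j k, (((Polynomial.C Polynomial.X -
      Polynomial.C (Polynomial.C z) * Polynomial.X) * q).coeff (j + 1)).coeff k ∈
        𝔞 ^ (j + 1 - D) := by
    intro j k
    have := (hq (j + 1)).1
    rw [← Ideal.map_pow, Ideal.mem_map_C_iff] at this
    have := this k
    rwa [show j + 1 + 1 - (D + 1) = j + 1 - D by omega] at this
  have key : ∀ k j, (q.coeff j).coeff k ∈ 𝔞 ^ (j + 1 - D) := by
    intro k
    induction k with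
    | zero =>
      intro j
      have h := hc j 0
      rw [sub_mul, mul_assoc, Polynomial.coeff_sub, Polynomial.coeff_C_mul,
        Polynomial.coeff_C_mul, Polynomial.coeff_X_mul, Polynomial.coeff_sub,
        Polynomial.coeff_C_mul, Polynomial.coeff_X_mul_zero, zero_sub, neg_mem_iff] at h
      exact hz _ _ h
    | succ k ih =>
      intro j
      have h := hc j (k + 1)
      rw [sub_mul, mul_assoc, Polynomial.coeff_sub, Polynomial.coeff_C_mul,
        Polynomial.coeff_C_mul, Polynomial.coeff_X_mul, Polynomial.coeff_sub,
        Polynomial.coeff_C_mul, Polynomial.coeff_X_mul] at h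
      have h2 := Ideal.pow_le_pow_right (by omega : j + 1 - D ≤ j + 1 + 1 - D) (ih (j + 1))
      exact hz _ _ ((Submodule.sub_mem_iff_right _ h2).1 h)
  intro j
  refine ⟨?_, trivial⟩
  rw [← Ideal.map_pow, Ideal.mem_map_C_iff]
  exact fun k => key k j

theorem mul_mem_filtPoly {D : ℕ} {q : Polynomial (Polynomial A)}
    (hq : q ∈ filtPoly (𝔞.map (Polynomial.C : A →+* Polynomial A)) D ⊤) :
    (Polynomial.C Polynomial.X - Polynomial.C (Polynomial.C z) * Polynomial.X) * q ∈
      filtPoly (𝔞.map (Polynomial.C : A →+* Polynomial A)) (D + 1) ⊤ := by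
  refine fun j => ⟨?_, trivial⟩
  rw [sub_mul, mul_assoc, Polynomial.coeff_sub, Polynomial.coeff_C_mul, Polynomial.coeff_C_mul]
  refine sub_mem (Ideal.mul_mem_left _ _ ?_) (Ideal.mul_mem_left _ _ ?_)
  · exact Ideal.pow_le_pow_right (by omega) (hq j).1
  · rcases j with _ | j
    · simp
    · rw [Polynomial.coeff_X_mul, show j + 1 + 1 - (D + 1) = j + 1 - D by omega]
      exact (hq j).1

theorem C_X_sub_ne_zero [Nontrivial A] :
    (Polynomial.C Polynomial.X - Polynomial.C (Polynomial.C z) * Polynomial.X :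
      Polynomial (Polynomial A)) ≠ 0 := by
  intro h
  have := congrArg (fun p => (p.coeff 0)) h
  simp at this

theorem substMulX_mul_eq_zero (q : Polynomial (Polynomial A)) :
    substMulX z ((Polynomial.C Polynomial.X - Polynomial.C (Polynomial.C z) * Polynomial.X) * q)
      = 0 := by
  simp [substMulX]

theorem ReesPresentation.projDim_succ [IsDomain A] (h : ReesPresentation (𝔞.map Polynomial.C) t χ)
    (hz : ∀ k a, z * a ∈ 𝔞 ^ k → a ∈ 𝔞 ^ k) (D n : ℕ)
    (h1 : (if D ≤ t then t else t + 1) ≤ n) (h2 : (if D + 1 ≤ t then t else t + 1) ≤ n + 1) :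
    ProjDimLT ((reesSubst z 𝔞).comp χ) (filtPoly (𝔞 ⊔ Ideal.span {z}) (D + 1) ⊤) (n + 1) := by
  let f : filtPoly (𝔞.map (Polynomial.C : A →+* Polynomial A)) D ⊤ →+
      filtPoly (𝔞.map (Polynomial.C : A →+* Polynomial A)) (D + 1) ⊤ :=
    AddMonoidHom.mk' (fun q => ⟨_, mul_mem_filtPoly (z := z) q.2⟩)
      (fun p q => Subtype.ext (mul_add _ _ _))
  let g : filtPoly (𝔞.map (Polynomial.C : A →+* Polynomial A)) (D + 1) ⊤ →+
      filtPoly (𝔞 ⊔ Ideal.span {z}) (D + 1) ⊤ :=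
    AddMonoidHom.mk' (fun q => ⟨_, substMulX_mem z q.2⟩)
      (fun p q => Subtype.ext (map_add _ _ _))
  refine (ProjDimLT.shortExact_cases (χ₁ := χ) (χ₂ := χ) (χ₃ := (reesSubst z 𝔞).comp χ) f g
    ?_ ?_ ?_ ?_ ?_ n).2.1 ((h.projDim D).mono h1) ((h.projDim (D + 1)).mono h2)
  · exact fun r m => Subtype.ext (mul_left_comm _ _ _)
  · exact fun r m => Subtype.ext (map_mul _ _ _)
  · exact fun p q hpq => Subtype.ext
      (mul_left_cancel₀ (C_X_sub_ne_zero (z := z)) (congrArg Subtype.val hpq))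
  · rintro ⟨q, hq⟩
    obtain ⟨p, hp, rfl⟩ := exists_substMulX_eq z (by omega) hq
    exact ⟨⟨p, hp⟩, rfl⟩
  · rintro ⟨p, hp⟩
    constructor
    · intro h0
      obtain ⟨q, rfl⟩ := exists_mul_eq_of_substMulX_eq_zero z (congrArg Subtype.val h0)
      exact ⟨⟨q, mem_filtPoly_of_mul_mem hz hp⟩, rfl⟩
    · rintro ⟨q, hq⟩
      rw [← hq]
      exact Subtype.ext (substMulX_mul_eq_zero _)

theorem ReesPresentation.projDim_base_succ [IsDomain A]
    (h : ReesPresentation (𝔞.map Polynomial.C) t χ) :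
    ProjDimLT ((reesCoeffZero (𝔞 ⊔ Ideal.span {z})).comp ((reesSubst z 𝔞).comp χ)) A
      (t + 1 + 1) := by
  refine (ProjDimLT.shortExact_cases
    (χ₁ := (reesCoeffZero (𝔞.map (Polynomial.C : A →+* Polynomial A))).comp χ)
    (χ₂ := (reesCoeffZero (𝔞.map (Polynomial.C : A →+* Polynomial A))).comp χ)
    (AddMonoidHom.mulLeft (Polynomial.X : Polynomial A))
    (Polynomial.constantCoeff (R := A)).toAddMonoidHom ?_ ?_ ?_ ?_ ?_ (t + 1)).2.1
    h.projDim_base (h.projDim_base.mono (by omega))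
  · exact fun r m => mul_left_comm _ _ _
  · intro r m
    change (_ * m).coeff 0 = (substMulX z (χ r : Polynomial (Polynomial A))).coeff 0 * _
    rw [Polynomial.mul_coeff_zero, substMulX_coeff]
    simp [reesCoeffZero]
  · exact mul_right_injective₀ Polynomial.X_ne_zero
  · exact fun a => ⟨Polynomial.C a, by simp⟩
  · intro m
    change m.coeff 0 = 0 ↔ ∃ a, Polynomial.X * a = m
    rw [← Polynomial.X_dvd_iff]
    exact ⟨fun ⟨a, ha⟩ => ⟨a, ha.symm⟩, fun ⟨a, ha⟩ => ⟨a, ha.symm⟩⟩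

theorem projDim_filtPoly_zero [IsDomain A] {𝔟 : Ideal A} {ψ : R →+* reesAlgebra 𝔟} {n : ℕ}
    (h1 : ProjDimLT ψ (filtPoly 𝔟 1 ⊤) n)
    (h2 : ProjDimLT ((reesCoeffZero 𝔟).comp ψ) A (n + 1)) :
    ProjDimLT ψ (filtPoly 𝔟 0 ⊤) n := by
  have hf : ∀ q ∈ filtPoly 𝔟 0 ⊤, Polynomial.X * q ∈ filtPoly 𝔟 1 ⊤ := by
    rintro q hq (_ | i)
    · simp
    · rw [Polynomial.coeff_X_mul]
      exact hq i
  refine (ProjDimLT.shortExact_cases (χ₁ := ψ) (χ₂ := ψ)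
    (AddMonoidHom.mk' (fun q => ⟨_, hf q q.2⟩) (fun p q => Subtype.ext (mul_add _ _ _)))
    (AddMonoidHom.mk' (fun q => (q : Polynomial A).coeff 0)
      (fun p q => Polynomial.coeff_add _ _ _)) ?_ ?_ ?_ ?_ ?_ n).2.2 h1 h2
  · exact fun r m => Subtype.ext (mul_left_comm _ _ _)
  · exact fun r m => Polynomial.mul_coeff_zero _ _
  · exact fun p q hpq => Subtype.ext
      (mul_left_cancel₀ Polynomial.X_ne_zero (congrArg Subtype.val hpq))
  · intro a
    refine ⟨⟨Polynomial.C a, fun i => ⟨?_, trivial⟩⟩, Polynomial.coeff_C_zero⟩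
    rw [Polynomial.coeff_C]
    split_ifs with h
    · simp [h]
    · exact zero_mem _
  · rintro ⟨p, hp⟩
    constructor
    · intro h0
      obtain ⟨q, rfl⟩ := Polynomial.X_dvd_iff.2 h0
      refine ⟨⟨q, fun i => ?_⟩, rfl⟩
      have := hp (i + 1)
      rwa [Polynomial.coeff_X_mul] at this
    · rintro ⟨q, hq⟩
      rw [← hq]
      exact Polynomial.coeff_X_mul_zero _

theorem ReesPresentation.step [IsDomain A] (h : ReesPresentation (𝔞.map Polynomial.C) t χ)
    (hz : ∀ k a, z * a ∈ 𝔞 ^ k → a ∈ 𝔞 ^ k) :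
    ReesPresentation (𝔞 ⊔ Ideal.span {z}) (t + 1) ((reesSubst z 𝔞).comp χ) where
  surjective x := by
    obtain ⟨p, hp, hpx⟩ := exists_substMulX_eq (D := 1) z le_rfl (q := (x : Polynomial A))
      (fun i => ⟨mem_reesAlgebra_iff _ _ |>.1 x.2 i, trivial⟩)
    obtain ⟨r, hr⟩ := h.surjective ⟨p, mem_reesAlgebra_iff _ _ |>.2 fun i => (hp i).1⟩
    refine ⟨r, Subtype.ext ?_⟩
    rw [RingHom.comp_apply, hr, ← hpx]
    rfl
  projDim D := by
    rcases D with _ | D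
    · rw [if_pos (Nat.zero_le _)]
      exact projDim_filtPoly_zero (h.projDim_succ hz 0 t (by simp) (by grind))
        h.projDim_base_succ
    · refine (h.projDim_succ hz D (if D ≤ t then t else t + 1) le_rfl (by grind)).mono ?_
      grind
  projDim_base := h.projDim_base_succ
  le_height := by
    rw [Nat.add_sub_cancel]
    rcases Nat.eq_zero_or_pos t with rfl | ht
    · simp
    obtain ⟨α, hα, hα0⟩ : ∃ α ∈ 𝔞, α ≠ 0 := by
      by_contra! hcon
      refine h.ne_bot ht ?_
      rw [Ideal.map_eq_bot_iff_of_injective Polynomial.C_injective]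
      exact le_bot_iff.1 fun x hx => hcon x hx
    have hlt : RingHom.ker χ < RingHom.ker ((reesSubst z 𝔞).comp χ) := by
      refine lt_of_le_of_ne (fun x hx => ?_) fun heq => ?_
      · rw [RingHom.mem_ker] at hx ⊢
        rw [RingHom.comp_apply, hx, map_zero]
      · let e : Polynomial (Polynomial A) := (Polynomial.C Polynomial.X -
          Polynomial.C (Polynomial.C z) * Polynomial.X) * Polynomial.C (Polynomial.C α)
        have he : e ∈ reesAlgebra (𝔞.map (Polynomial.C : A →+* Polynomial A)) := by
          rw [mem_reesAlgebra_iff]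
          intro i
          simp only [e, Polynomial.coeff_mul_C, Polynomial.coeff_sub, Polynomial.coeff_C_mul]
          match i with
          | 0 => simp
          | 1 =>
            rw [pow_one]
            exact Ideal.mul_mem_left _ _ (Ideal.mem_map_of_mem _ hα)
          | i + 2 =>
            rw [Polynomial.coeff_C_of_ne_zero (by omega), Polynomial.coeff_X_of_ne_one (by omega)]
            simp
        obtain ⟨r, hr⟩ := h.surjective ⟨e, he⟩
        have h1 : r ∈ RingHom.ker ((reesSubst z 𝔞).comp χ) := by
          rw [RingHom.mem_ker, RingHom.comp_apply, hr]
          exact Subtype.ext (substMulX_mul_eq_zero _)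
        rw [← heq, RingHom.mem_ker, hr] at h1
        have h2 : e = 0 := congrArg Subtype.val h1
        rcases mul_eq_zero.1 h2 with h3 | h3
        · exact C_X_sub_ne_zero h3
        · rw [Polynomial.C_eq_zero, Polynomial.C_eq_zero] at h3
          exact hα0 h3
    have := RingHom.ker_isPrime χ
    have := RingHom.ker_isPrime ((reesSubst z 𝔞).comp χ)
    refine le_trans ?_ (Ideal.height_add_one_le_of_lt_of_isPrime hlt)
    refine le_trans ?_ (add_le_add_left h.le_height 1)
    exact_mod_cast (by omega : t ≤ t - 1 + 1)
  ne_bot _ h0 := by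
    rw [sup_eq_bot_iff, Ideal.span_singleton_eq_bot] at h0
    have := hz 1 1 (by rw [h0.2, zero_mul]; exact zero_mem _)
    rw [h0.1, pow_one, Ideal.mem_bot] at this
    exact one_ne_zero this

end Step

theorem exists_reesPresentation (n : ℕ) : ∀ (A : Type u) [CommRing A] [IsDomain A]
    [IsRegularRing A] (z : Fin n → A),
    (∀ i k a, z i * a ∈ (Ideal.span (z '' Set.Iio i)) ^ k →
      a ∈ (Ideal.span (z '' Set.Iio i)) ^ k) →
    ∃ (R : Type u) (_ : CommRing R) (_ : IsRegularRing R)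
      (χ : R →+* reesAlgebra (Ideal.span (Set.range z))),
      ReesPresentation (Ideal.span (Set.range z)) n χ := by
  induction n with
  | zero =>
    intro A _ _ _ z _
    have h : Ideal.span (Set.range z) = ⊥ := by rw [Set.range_eq_empty, Ideal.span_empty]
    rw [h]
    exact ⟨A, _, ‹_›, _, reesPresentation_bot A⟩
  | succ n ih =>
    intro A _ _ _ z hz
    have hmap : ∀ s : Set (Fin n),
        Ideal.span ((fun i => (Polynomial.C (z (Fin.castSucc i)) : Polynomial A)) '' s) =
          (Ideal.span ((fun i => z (Fin.castSucc i)) '' s)).map Polynomial.C := by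
      intro s
      rw [Ideal.map_span, Set.image_image]
    have himg : ∀ i : Fin n, (fun i => z (Fin.castSucc i)) '' Set.Iio i =
        z '' Set.Iio (Fin.castSucc i) := by
      intro i
      rw [← Set.image_image z, Fin.image_castSucc_Iio]
    obtain ⟨R, _, hR, χ, hχ⟩ := ih (Polynomial A) (fun i => Polynomial.C (z (Fin.castSucc i))) (by
      intro i k a ha
      rw [hmap, ← Ideal.map_pow, Ideal.mem_map_C_iff] at ha ⊢
      intro l
      have := ha l
      rw [Polynomial.coeff_C_mul, himg] at this
      rw [himg]
      exact hz _ _ _ this)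
    have h1 := hmap Set.univ
    rw [Set.image_univ, Set.image_univ] at h1
    have h2 : Ideal.span (Set.range z) =
        Ideal.span (Set.range fun i => z (Fin.castSucc i)) ⊔ Ideal.span {z (Fin.last n)} := by
      rw [← Ideal.span_union]
      congr 1
      ext a
      simp [Fin.exists_fin_succ', eq_comm, or_comm]
    revert hχ χ
    rw [h1]
    intro χ hχ
    rw [h2]
    refine ⟨R, _, hR, _, hχ.step fun k a ha => ?_⟩
    have h3 : Set.range (fun i => z (Fin.castSucc i)) = z '' Set.Iio (Fin.last n) := by
      ext a
      simp [Fin.exists_fin_succ', Fin.castSucc_lt_last]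
    rw [h3] at ha ⊢
    exact hz _ _ _ ha

section Minors

variable {P : Type*} [CommRing P] {n : ℕ}

/-- The determinant of the first `s` rows of `r`, in the columns chosen by `c`. -/
noncomputable def colDet (r : ℕ → Fin n → P) {s : ℕ} (c : Fin s → Fin n) : P :=
  (Matrix.of fun i j : Fin s => r i (c j)).det

/-- The ideal of maximal minors of the first `s` rows of `r`, in the columns belonging to `B`. -/
noncomputable def colMinors (r : ℕ → Fin n → P) (s : ℕ) (B : Finset (Fin n)) : Ideal P :=
  Ideal.span {d | ∃ c : Fin s → Fin n, (∀ j, c j ∈ B) ∧ d = colDet r c}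

theorem map_colDet {Q F : Type*} [CommRing Q] [FunLike F P Q] [RingHomClass F P Q] (f : F)
    (r : ℕ → Fin n → P) {s : ℕ} (c : Fin s → Fin n) :
    f (colDet r c) = colDet (fun i j => f (r i j)) c :=
  RingHom.map_det (f : P →+* Q) _

theorem colDet_congr {r r' : ℕ → Fin n → P} {s : ℕ} {c : Fin s → Fin n}
    (h : ∀ i < s, ∀ j, r i (c j) = r' i (c j)) : colDet r c = colDet r' c := by
  unfold colDet
  congr 1
  ext i j
  exact h i i.2 j

theorem colDet_mem {r : ℕ → Fin n → P} {s : ℕ} {B : Finset (Fin n)} {c : Fin s → Fin n}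
    (hc : ∀ j, c j ∈ B) : colDet r c ∈ colMinors r s B :=
  Ideal.subset_span ⟨c, hc, rfl⟩

theorem colMinors_le {r : ℕ → Fin n → P} {s : ℕ} {B : Finset (Fin n)} {J : Ideal P} :
    colMinors r s B ≤ J ↔ ∀ c : Fin s → Fin n, (∀ j, c j ∈ B) → colDet r c ∈ J := by
  rw [colMinors, Ideal.span_le]
  exact ⟨fun h c hc => h ⟨c, hc, rfl⟩, fun h d ⟨c, hc, hd⟩ => hd ▸ h c hc⟩

theorem colMinors_mono {r : ℕ → Fin n → P} {s : ℕ} {B B' : Finset (Fin n)} (h : B ⊆ B') :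
    colMinors r s B ≤ colMinors r s B' :=
  colMinors_le.2 fun _ hc => colDet_mem fun j => h (hc j)

theorem colMinors_zero (r : ℕ → Fin n → P) (B : Finset (Fin n)) : colMinors r 0 B = ⊤ :=
  (Ideal.eq_top_iff_one _).2 (Ideal.subset_span ⟨Fin.elim0, fun j => j.elim0, by simp [colDet]⟩)

theorem colMinors_of_card_lt (r : ℕ → Fin n → P) {s : ℕ} {B : Finset (Fin n)} (h : #B < s) :
    colMinors r s B = ⊥ := by
  refine le_bot_iff.1 (colMinors_le.2 fun c hc => ?_)
  obtain ⟨x, -, y, -, hxy, hc'⟩ := exists_ne_map_eq_of_card_lt_of_maps_to (s := univ) (t := B)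
    (by simpa using h) (fun j _ => hc j)
  exact Matrix.det_zero_of_column_eq hxy fun i => by simp [hc']

theorem colDet_succ_last (r : ℕ → Fin n → P) {s : ℕ} (c : Fin (s + 1) → Fin n) :
    colDet r c =
      ∑ j : Fin (s + 1), (-1) ^ (s + (j : ℕ)) * r s (c j) * colDet r (c ∘ j.succAbove) := by
  rw [colDet, Matrix.det_succ_row _ (Fin.last s)]
  refine sum_congr rfl fun j _ => ?_
  simp only [Fin.val_last, Matrix.of_apply]
  congr 2
  ext i l
  simp

theorem colDet_mem_mul {r : ℕ → Fin n → P} {s : ℕ} {B : Finset (Fin n)} {c : Fin (s + 1) → Fin n}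
    (hc : ∀ j, c j ∈ B) {J : Ideal P} (hJ : ∀ j, r s (c j) ∈ J) :
    colDet r c ∈ J * colMinors r s B := by
  rw [colDet_succ_last]
  exact sum_mem fun j _ => Ideal.mul_mem_mul (Ideal.mul_mem_left _ _ (hJ j))
    (colDet_mem fun i => hc _)

theorem colMinors_succ_le (r : ℕ → Fin n → P) (s : ℕ) (B : Finset (Fin n)) :
    colMinors r (s + 1) B ≤ colMinors r s B :=
  colMinors_le.2 fun c hc => by
    have := colDet_mem_mul (r := r) (J := ⊤) hc fun _ => Submodule.mem_top
    rwa [Ideal.top_mul] at this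

/-- The part of the determinant of the first `s + 1` rows, in the columns `c` followed by `j`,
which does not involve the entry in row `s` and column `j`. -/
noncomputable def snocRem (r : ℕ → Fin n → P) {s : ℕ} (c : Fin s → Fin n) (j : Fin n) : P :=
  colDet (fun i l => if i = s ∧ l = j then 0 else r i l) (Fin.snoc c j : Fin (s + 1) → Fin n)

theorem map_snocRem {Q F : Type*} [CommRing Q] [FunLike F P Q] [RingHomClass F P Q] (f : F)
    (r : ℕ → Fin n → P) {s : ℕ} (c : Fin s → Fin n) (j : Fin n) :
    f (snocRem r c j) = snocRem (fun i l => f (r i l)) c j := by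
  rw [snocRem, map_colDet, snocRem]
  congr 1
  ext i l
  split_ifs <;> simp

theorem snocRem_congr {r r' : ℕ → Fin n → P} {s : ℕ} {c : Fin s → Fin n} {j : Fin n}
    (h : ∀ i ≤ s, ∀ l, i ≠ s ∨ l ≠ j → r i l = r' i l) : snocRem r c j = snocRem r' c j := by
  refine colDet_congr fun i hi l => ?_
  split_ifs with h1
  · rfl
  · exact h i (by omega) _ (by tauto)

theorem colDet_snoc (r : ℕ → Fin n → P) {s : ℕ} (c : Fin s → Fin n) {j : Fin n}
    (hc : ∀ i, c i ≠ j) :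
    colDet r (Fin.snoc c j : Fin (s + 1) → Fin n) = colDet r c * r s j + snocRem r c j := by
  have h (k : Fin (s + 1)) : colDet (fun i l => if i = s ∧ l = j then 0 else r i l)
      ((Fin.snoc c j : Fin (s + 1) → Fin n) ∘ k.succAbove) =
      colDet r ((Fin.snoc c j : Fin (s + 1) → Fin n) ∘ k.succAbove) :=
    colDet_congr fun i hi l => if_neg fun h => hi.ne h.1
  rw [snocRem, colDet_succ_last, colDet_succ_last, Fin.sum_univ_castSucc, Fin.sum_univ_castSucc,
    add_comm]
  simp only [h]
  simp [hc, mul_comm, ← two_mul]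

theorem colMinors_succ_eq (r : ℕ → Fin n → P) (s : ℕ) {B : Finset (Fin n)} {j : Fin n}
    (hj : j ∈ B) :
    colMinors r (s + 1) B = colMinors r (s + 1) (B.erase j) ⊔
      Ideal.span (Set.range fun c : {c : Fin s → Fin n // ∀ i, c i ∈ B.erase j} =>
        colDet r (Fin.snoc c.1 j : Fin (s + 1) → Fin n)) := by
  refine le_antisymm (colMinors_le.2 fun c hc => ?_)
    (sup_le (colMinors_mono (erase_subset _ _)) (Ideal.span_le.2 ?_))
  · by_cases h : ∃ i, c i = j
    · obtain ⟨i, hi⟩ := h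
      by_cases h2 : ∃ i', i' ≠ i ∧ c i' = j
      · obtain ⟨i', hne, hi'⟩ := h2
        have : colDet r c = 0 := Matrix.det_zero_of_column_eq hne fun l => by simp [hi, hi']
        rw [this]
        exact zero_mem _
      · push Not at h2
        let d := c ∘ Equiv.swap i (Fin.last s)
        have hd : d = Fin.snoc (Fin.init d) j := by
          rw [← Fin.snoc_init_self d]
          simp [d, hi]
        have hdet : colDet r d = ((Equiv.Perm.sign (Equiv.swap i (Fin.last s)) : ℤ) : P) *
            colDet r c := by
          rw [colDet, colDet, ← Matrix.det_permute']
          rfl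
        have hmem : colDet r d ∈ Ideal.span
            (Set.range fun c : {c : Fin s → Fin n // ∀ i, c i ∈ B.erase j} =>
              colDet r (Fin.snoc c.1 j : Fin (s + 1) → Fin n)) := by
          refine Ideal.subset_span ⟨⟨Fin.init d, fun l => ?_⟩, congrArg (colDet r) hd.symm⟩
          refine mem_erase.2 ⟨h2 _ fun h3 => ?_, hc _⟩
          rw [Equiv.swap_apply_eq_iff, Equiv.swap_apply_left] at h3
          exact (Fin.castSucc_lt_last l).ne h3
        refine Ideal.mem_sup_right ?_
        rw [hdet] at hmem
        rcases Int.units_eq_one_or (Equiv.Perm.sign (Equiv.swap i (Fin.last s))) with h | h <;>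
          simpa [h] using hmem
    · push Not at h
      exact Ideal.mem_sup_left (colDet_mem fun i => mem_erase.2 ⟨h i, hc i⟩)
  · rintro _ ⟨c, rfl⟩
    refine colDet_mem fun i => ?_
    refine Fin.lastCases ?_ (fun i => ?_) i
    · simpa using hj
    · simpa using mem_of_mem_erase (c.2 i)

theorem colDet_eq_zero_of_vecMul [IsDomain P] {r : ℕ → Fin n → P} {s : ℕ} {c : Fin s → Fin n}
    (x : Fin s → P) (i : Fin s) (hx : x i ≠ 0) (h : ∀ j, ∑ l, x l * r l (c j) = 0) :
    colDet r c = 0 :=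
  Matrix.exists_vecMul_eq_zero_iff.1 ⟨x, fun h0 => hx (congrFun h0 i), funext h⟩

theorem mul_colDet_snoc (r : ℕ → Fin n → P) {s : ℕ} (c : Fin s → Fin n) (j : Fin n)
    (x : ℕ → P) (h : ∀ i, ∑ l ∈ range (s + 1), x l * r l (c i) = 0) :
    x s * colDet r (Fin.snoc c j : Fin (s + 1) → Fin n) =
      (∑ l ∈ range (s + 1), x l * r l j) * colDet r c := by
  set G := Matrix.of fun i l : Fin (s + 1) => r i ((Fin.snoc c j : Fin (s + 1) → Fin n) l) with hG
  have h1 : Matrix.vecMul (fun i : Fin (s + 1) => x i) G =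
      Pi.single (Fin.last s) (∑ l ∈ range (s + 1), x l * r l j) := by
    ext l
    simp only [Matrix.vecMul, dotProduct, hG, Matrix.of_apply]
    rw [Fin.sum_univ_eq_sum_range fun i => x i * r i ((Fin.snoc c j : Fin (s + 1) → Fin n) l)]
    refine Fin.lastCases ?_ (fun i => ?_) l
    · simp
    · simp [h]
  have h2 : (Matrix.vecMul (fun i : Fin (s + 1) => x i) (G * G.adjugate)) (Fin.last s) =
      (∑ l ∈ range (s + 1), x l * r l j) * G.adjugate (Fin.last s) (Fin.last s) := by
    rw [← Matrix.vecMul_vecMul, h1, Matrix.single_vecMul]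
    simp
  rw [Matrix.mul_adjugate, Matrix.vecMul_smul, Matrix.vecMul_one,
    Matrix.adjugate_fin_succ_eq_det_submatrix] at h2
  have h3 : (G.submatrix (Fin.last s).succAbove (Fin.last s).succAbove).det = colDet r c := by
    unfold colDet
    congr 1
    ext i l
    simp [hG]
  rw [h3] at h2
  simpa [mul_comm, ← two_mul, colDet, hG] using h2

end Minors

theorem mem_span_of_dvd_map {C E ι : Type*} [CommRing C] [CommRing E] [IsDomain E] (π : C →+* E)
    (M γ : ι → C) (L : Polynomial E) (hL : L.natDegree = 1)
    (h1 : ∀ p, L.coeff 1 ∣ π p → p ∈ RingHom.ker π ⊔ Ideal.span (Set.range M))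
    (h2 : ∀ i, L ∣ (Polynomial.C (M i) * Polynomial.X + Polynomial.C (γ i)).map π)
    (F : Polynomial C) (hF : L ∣ F.map π) :
    F ∈ (RingHom.ker π).map Polynomial.C ⊔ Ideal.span (Set.range fun i =>
      Polynomial.C (M i) * Polynomial.X + Polynomial.C (γ i)) := by
  set J := (RingHom.ker π).map Polynomial.C ⊔ Ideal.span (Set.range fun i =>
      Polynomial.C (M i) * Polynomial.X + Polynomial.C (γ i)) with hJ
  have hdvd : ∀ H ∈ J, L ∣ H.map π := by
    have : J ≤ (Ideal.span {L}).comap (Polynomial.mapRingHom π) := by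
      refine sup_le (Ideal.map_le_iff_le_comap.2 fun q hq => ?_) (Ideal.span_le.2 ?_)
      · simp only [Ideal.mem_comap, Polynomial.coe_mapRingHom, Polynomial.map_C]
        rw [(RingHom.mem_ker).1 hq, map_zero]
        exact zero_mem _
      · rintro _ ⟨i, rfl⟩
        exact Ideal.mem_span_singleton.2 (h2 i)
    exact fun H hH => Ideal.mem_span_singleton.1 (this hH)
  have hC : ∀ q, π q = 0 → Polynomial.C q ∈ J := fun q hq =>
    Ideal.mem_sup_left (Ideal.mem_map_of_mem _ (RingHom.mem_ker.2 hq))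
  have htop : ∀ d, ∀ p ∈ RingHom.ker π ⊔ Ideal.span (Set.range M), ∃ H ∈ J,
      ∀ i, d + 1 ≤ i → H.coeff i = (Polynomial.C p * Polynomial.X ^ (d + 1)).coeff i := by
    intro d p hp
    obtain ⟨q, hq, a, ha, rfl⟩ := Submodule.mem_sup.1 hp
    have : ∃ H ∈ J, ∀ i, d + 1 ≤ i →
        H.coeff i = (Polynomial.C a * Polynomial.X ^ (d + 1)).coeff i := by
      clear hp
      induction ha using Submodule.span_induction with
      | mem x hx =>
        obtain ⟨l, rfl⟩ := hx
        refine ⟨(Polynomial.C (M l) * Polynomial.X + Polynomial.C (γ l)) * Polynomial.X ^ d,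
          Ideal.mul_mem_right _ _ (Ideal.mem_sup_right (Ideal.subset_span ⟨l, rfl⟩)),
          fun i hi => ?_⟩
        rw [add_mul, mul_assoc, ← pow_succ', Polynomial.coeff_add,
          Polynomial.coeff_C_mul (p := Polynomial.X ^ d),
          Polynomial.coeff_X_pow, if_neg (by omega), mul_zero, add_zero]
      | zero => exact ⟨0, zero_mem _, by simp⟩
      | add x y _ _ hx hy =>
        obtain ⟨H, hH, h⟩ := hx
        obtain ⟨H', hH', h'⟩ := hy
        exact ⟨H + H', add_mem hH hH', fun i hi => by simp [h i hi, h' i hi, add_mul]⟩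
      | smul c x _ hx =>
        obtain ⟨H, hH, h⟩ := hx
        refine ⟨Polynomial.C c * H, Ideal.mul_mem_left _ _ hH, fun i hi => ?_⟩
        rw [Polynomial.coeff_C_mul, h i hi, smul_eq_mul, map_mul, mul_assoc, Polynomial.coeff_C_mul,
          Polynomial.coeff_C_mul, Polynomial.coeff_C_mul]
    obtain ⟨H, hH, h⟩ := this
    refine ⟨Polynomial.C q * Polynomial.X ^ (d + 1) + H,
      add_mem (Ideal.mul_mem_right _ _ (hC q hq)) hH, fun i hi => ?_⟩
    rw [map_add, add_mul, Polynomial.coeff_add, Polynomial.coeff_add, h i hi]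
  have key : ∀ d, ∀ F : Polynomial C, (∀ i, d ≤ i → F.coeff i = 0) → L ∣ F.map π → F ∈ J := by
    intro d
    induction d with
    | zero =>
      intro F hd _
      rw [show F = 0 from Polynomial.ext fun i => by simpa using hd i (Nat.zero_le i)]
      exact zero_mem _
    | succ d ih =>
      intro F hd hF
      obtain ⟨G, hG⟩ := hF
      have hdeg : (L * G).natDegree ≤ d := by
        rw [← hG]
        refine Polynomial.natDegree_map_le.trans (Polynomial.natDegree_le_iff_coeff_eq_zero.2 ?_)
        exact fun i hi => hd i hi
      have hL0 : L ≠ 0 := by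
        rintro rfl
        simp at hL
      rcases d with _ | d
      · rw [Polynomial.eq_C_of_natDegree_le_zero
          (Polynomial.natDegree_le_iff_coeff_eq_zero.2 fun i hi => hd i hi)]
        refine hC _ ?_
        have hG0 : G = 0 := by
          by_contra hne
          rw [Polynomial.natDegree_mul hL0 hne, hL] at hdeg
          omega
        rw [← Polynomial.coeff_map, hG, hG0, mul_zero, Polynomial.coeff_zero]
      · have hGd : G.natDegree ≤ d := by
          rcases eq_or_ne G 0 with rfl | hne
          · simp
          · rw [Polynomial.natDegree_mul hL0 hne, hL] at hdeg
            omega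
        have hlead : L.coeff 1 ∣ π (F.coeff (d + 1)) := by
          rw [← Polynomial.coeff_map, hG, add_comm d 1,
            Polynomial.coeff_mul_add_eq_of_natDegree_le hL.le hGd]
          exact dvd_mul_right _ _
        obtain ⟨H, hH, h⟩ := htop d _ (h1 _ hlead)
        have hFH : F - H ∈ J := by
          refine ih _ (fun i hi => ?_) ?_
          · rw [Polynomial.coeff_sub, h i hi, Polynomial.coeff_C_mul, Polynomial.coeff_X_pow]
            split_ifs with hid
            · simp [hid]
            · simp [hd i (by omega)]
          · rw [Polynomial.map_sub]
            exact dvd_sub ⟨G, hG⟩ (hdvd H hH)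
        simpa using add_mem hFH hH
  exact key (F.natDegree + 1) F (fun i hi => Polynomial.coeff_eq_zero_of_natDegree_lt hi) hF

section SepVar

variable {k σ : Type*} [CommRing k] [DecidableEq σ]

/-- Rewrite a polynomial as a polynomial in one of its variables. -/
noncomputable def sepVar (x : σ) : MvPolynomial σ k →ₐ[k] Polynomial (MvPolynomial σ k) :=
  aeval fun y => if y = x then Polynomial.X else Polynomial.C (X y)

theorem sepVar_X_self (x : σ) : sepVar (k := k) x (X x) = Polynomial.X := by
  simp [sepVar]

theorem sepVar_X_of_ne {x y : σ} (h : y ≠ x) : sepVar (k := k) x (X y) = Polynomial.C (X y) := by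
  simp [sepVar, h]

theorem eval_sepVar (x : σ) (p : MvPolynomial σ k) : (sepVar x p).eval (X x) = p := by
  have : (Polynomial.evalRingHom (X x)).comp (sepVar (k := k) x).toRingHom =
      RingHom.id (MvPolynomial σ k) := by
    refine MvPolynomial.ringHom_ext (fun a => ?_) fun y => ?_
    · simp [Polynomial.algebraMap_apply, MvPolynomial.algebraMap_eq]
    · by_cases h : y = x
      · simp [h, sepVar_X_self]
      · simp [sepVar_X_of_ne h]
  exact RingHom.congr_fun this p

theorem dvd_sub_aeval (x : σ) (q p : MvPolynomial σ k) :
    X x - q ∣ p - aeval (fun y => if y = x then q else X y) p := by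
  rw [← Ideal.mem_span_singleton, ← Ideal.Quotient.mk_eq_mk_iff_sub_mem]
  have : (Ideal.Quotient.mkₐ k (Ideal.span {X x - q})) =
      (Ideal.Quotient.mkₐ k (Ideal.span {X x - q})).comp
        (aeval (fun y => if y = x then q else X y)) := by
    refine MvPolynomial.algHom_ext fun y => ?_
    by_cases h : y = x
    · subst h
      simp only [AlgHom.comp_apply, aeval_X, if_true]
      exact Ideal.Quotient.mk_eq_mk_iff_sub_mem _ _ |>.2 (Ideal.mem_span_singleton_self _)
    · simp [h]
  exact DFunLike.congr_fun this p

end SepVar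

section Pair

variable {k : Type*} [Field k] {m n : ℕ} [NeZero m]

variable (k m n) in
/-- The rows of a pair of generic matrices of the same size. -/
noncomputable def pairRow (b : Bool) (i : ℕ) (l : Fin n) :
    MvPolynomial (Bool × Fin m × Fin n) k :=
  X (b, Fin.ofNat m i, l)

variable (k m) in
/-- The sum of the ideals of maximal minors of the first `s b` rows in the columns `B b` of the two
generic matrices. -/
noncomputable def pairIdeal (s : Bool → ℕ) (B : Bool → Finset (Fin n)) :
    Ideal (MvPolynomial (Bool × Fin m × Fin n) k) :=
  ⨆ b, colMinors (pairRow k m n b) (s b) (B b)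

variable (k m n) in
/-- The rows of a pair of generic matrices, in a polynomial ring with additional variables. -/
noncomputable def extRow (b : Bool) (i : ℕ) (l : Fin n) :
    MvPolynomial ((Bool × Fin m × Fin n) ⊕ (Bool × Fin m)) k :=
  X (Sum.inl (b, Fin.ofNat m i, l))

variable (k m n) in
/-- The coefficients of a generic linear relation between the rows of a generic matrix. -/
noncomputable def relVar (b : Bool) (i : ℕ) :
    MvPolynomial ((Bool × Fin m × Fin n) ⊕ (Bool × Fin m)) k :=
  X (Sum.inr (b, Fin.ofNat m i))

/-- The parametrization which makes the first row a combination of the next ones, in the given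
columns. -/
noncomputable def param (s : Bool → ℕ) (B : Bool → Finset (Fin n)) :
    MvPolynomial (Bool × Fin m × Fin n) k →ₐ[k]
      MvPolynomial ((Bool × Fin m × Fin n) ⊕ (Bool × Fin m)) k :=
  aeval fun v => if v.2.1 = 0 ∧ v.2.2 ∈ B v.1 then
    ∑ i ∈ Ico 1 (s v.1), relVar k m n v.1 i * extRow k m n v.1 i v.2.2 else X (Sum.inl v)

theorem ofNat_inj {i j : ℕ} (hi : i < m) (hj : j < m) :
    Fin.ofNat m i = Fin.ofNat m j ↔ i = j := by
  rw [Fin.ext_iff, Fin.val_ofNat, Fin.val_ofNat, Nat.mod_eq_of_lt hi, Nat.mod_eq_of_lt hj]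

theorem ofNat_eq_zero {i : ℕ} (hi : i < m) : Fin.ofNat m i = 0 ↔ i = 0 := by
  rw [← ofNat_inj hi (NeZero.pos m)]
  rfl

theorem param_X (s : Bool → ℕ) (B : Bool → Finset (Fin n)) (v : Bool × Fin m × Fin n) :
    param (k := k) s B (X v) = if v.2.1 = 0 ∧ v.2.2 ∈ B v.1 then
      ∑ i ∈ Ico 1 (s v.1), relVar k m n v.1 i * extRow k m n v.1 i v.2.2 else X (Sum.inl v) := by
  simp [param]

theorem param_pairRow_of_pos {s : Bool → ℕ} {B : Bool → Finset (Fin n)} {b : Bool} {i : ℕ}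
    (h0 : 0 < i) (hi : i < m) (l : Fin n) :
    param s B (pairRow k m n b i l) = extRow k m n b i l := by
  rw [pairRow, param_X, if_neg, extRow]
  rw [ofNat_eq_zero hi]
  omega

theorem param_pairRow_zero {s : Bool → ℕ} {B : Bool → Finset (Fin n)} {b : Bool} {l : Fin n}
    (hl : l ∈ B b) : param s B (pairRow k m n b 0 l) =
      ∑ i ∈ Ico 1 (s b), relVar k m n b i * extRow k m n b i l := by
  rw [pairRow, param_X, if_pos ⟨rfl, hl⟩]

variable (k m n) in
/-- The coefficients of the linear relation between the rows imposed by `param`. -/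
noncomputable def relCoeff (s : Bool → ℕ) (b : Bool) (i : ℕ) :
    MvPolynomial ((Bool × Fin m × Fin n) ⊕ (Bool × Fin m)) k :=
  if i = 0 then 1 else if i < s b then -relVar k m n b i else 0

theorem relCoeff_ne_zero {s : Bool → ℕ} {b : Bool} {i : ℕ} (hi : i < s b) :
    relCoeff k m n s b i ≠ 0 := by
  unfold relCoeff
  split_ifs
  · exact one_ne_zero
  · exact neg_ne_zero.2 (X_ne_zero _)

theorem sum_relCoeff {s : Bool → ℕ} {B : Bool → Finset (Fin n)} {b : Bool} (h1 : 1 ≤ s b)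
    (hm : s b ≤ m) {r : ℕ → Fin n → MvPolynomial (Bool × Fin m × Fin n) k}
    (hr : ∀ i < s b, r i = pairRow k m n b i) {S : ℕ} (hS : s b ≤ S) {l : Fin n} (hl : l ∈ B b) :
    ∑ i ∈ range S, relCoeff k m n s b i * param s B (r i l) = 0 := by
  rw [← sum_subset (range_subset_range.2 hS) fun i _ hi => by
    rw [mem_range, not_lt] at hi
    rw [relCoeff, if_neg (by omega), if_neg (by omega), zero_mul]]
  rw [range_eq_Ico, sum_eq_sum_Ico_succ_bot (by omega), hr 0 (by omega), param_pairRow_zero hl,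
    relCoeff, if_pos rfl, one_mul, ← sum_add_distrib]
  refine sum_eq_zero fun i hi => ?_
  rw [mem_Ico] at hi
  rw [hr i hi.2, param_pairRow_of_pos (by omega) (by omega), relCoeff, if_neg (by omega),
    if_pos hi.2]
  ring

theorem param_colDet_eq_zero {s : Bool → ℕ} {B : Bool → Finset (Fin n)} {b : Bool} (h1 : 1 ≤ s b)
    (hm : s b ≤ m) {r : ℕ → Fin n → MvPolynomial (Bool × Fin m × Fin n) k}
    (hr : ∀ i < s b, r i = pairRow k m n b i) {S : ℕ} (hS : s b ≤ S) {c : Fin S → Fin n}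
    (hc : ∀ j, c j ∈ B b) : param s B (colDet r c) = 0 := by
  refine (map_colDet (param s B) r c).trans
    (colDet_eq_zero_of_vecMul (fun i => relCoeff k m n s b i) ⟨0, by omega⟩
      (relCoeff_ne_zero h1) fun j => ?_)
  exact (Fin.sum_univ_eq_sum_range (fun i => relCoeff k m n s b i * param s B (r i (c j))) S).trans
    (sum_relCoeff h1 hm hr hS (hc j))

theorem pairIdeal_le_ker_param {s : Bool → ℕ} (B : Bool → Finset (Fin n)) (h1 : ∀ b, 1 ≤ s b)
    (hm : ∀ b, s b ≤ m) : pairIdeal k m s B ≤ RingHom.ker (param (k := k) (m := m) s B) :=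
  iSup_le fun b => colMinors_le.2 fun _ hc =>
    RingHom.mem_ker.2 (param_colDet_eq_zero (h1 b) (hm b) (fun _ _ => rfl) le_rfl hc)

theorem colMinors_le_pairIdeal (s : Bool → ℕ) (B : Bool → Finset (Fin n)) (b : Bool) :
    colMinors (pairRow k m n b) (s b) (B b) ≤ pairIdeal k m s B :=
  le_iSup (fun b => colMinors (pairRow k m n b) (s b) (B b)) b

theorem pairIdeal_eq (s : Bool → ℕ) (B : Bool → Finset (Fin n)) (b : Bool) :
    pairIdeal k m s B = colMinors (pairRow k m n b) (s b) (B b) ⊔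
      colMinors (pairRow k m n (!b)) (s (!b)) (B (!b)) := by
  rw [pairIdeal, iSup_bool_eq]
  cases b
  · exact sup_comm _ _
  · rfl

end Pair

section Pair

variable {k : Type*} [Field k] {m n : ℕ} [NeZero m]

theorem sepVar_comp_param {s : Bool → ℕ} {B : Bool → Finset (Fin n)} {b : Bool} {r : ℕ}
    {j : Fin n} (hj : j ∉ B b)
    (p : MvPolynomial (Bool × Fin m × Fin n) k) :
    (sepVar (b, Fin.ofNat m r, j) p).map (param (k := k) (m := m) s B).toRingHom =
      sepVar (Sum.inl (b, Fin.ofNat m r, j)) (param s B p) := by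
  have : (Polynomial.mapRingHom (param (k := k) (m := m) s B).toRingHom).comp
      (sepVar (k := k) (b, Fin.ofNat m r, j)).toRingHom =
      (sepVar (Sum.inl (b, Fin.ofNat m r, j))).toRingHom.comp (param s B).toRingHom := by
    refine MvPolynomial.ringHom_ext (fun a => ?_) fun v => ?_
    · simp [← MvPolynomial.algebraMap_eq, Polynomial.algebraMap_apply]
    · by_cases hv : v = (b, Fin.ofNat m r, j)
      · subst hv
        simp [sepVar_X_self, param_X, hj]
      · simp only [RingHom.comp_apply, AlgHom.toRingHom_eq_coe, RingHom.coe_coe,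
          sepVar_X_of_ne hv, Polynomial.coe_mapRingHom, Polynomial.map_C, param_X]
        split_ifs with h
        · rw [map_sum, map_sum]
          refine sum_congr rfl fun i hi => ?_
          rw [map_mul, map_mul, relVar, extRow, sepVar_X_of_ne (by simp), sepVar_X_of_ne]
          intro heq
          obtain ⟨v1, v2, v3⟩ := v
          simp only [Sum.inl.injEq, Prod.mk.injEq] at heq
          obtain ⟨rfl, -, rfl⟩ := heq
          exact hj h.2
        · rw [sepVar_X_of_ne]
          simpa using hv
  exact RingHom.congr_fun this p

theorem sepVar_colDet_snoc {b : Bool} {r : ℕ} (hm : r + 1 ≤ m) {c : Fin r → Fin n} {j : Fin n}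
    (hc : ∀ i, c i ≠ j) :
    sepVar (k := k) (b, Fin.ofNat m r, j) 
      (colDet (pairRow k m n b) (Fin.snoc c j : Fin (r + 1) → Fin n)) =
      Polynomial.C (colDet (pairRow k m n b) c) * Polynomial.X +
        Polynomial.C (snocRem (pairRow k m n b) c j) := by
  have hne : ∀ i ≤ r, ∀ l, i ≠ r ∨ l ≠ j →
      sepVar (b, Fin.ofNat m r, j) (pairRow k m n b i l) =
        Polynomial.C (pairRow k m n b i l) := by
    intro i hi l h
    refine sepVar_X_of_ne ?_
    have := ofNat_inj (show i < m by omega)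
      (show r < m by omega)
    intro h3
    simp only [Prod.mk.injEq, true_and, this] at h3
    tauto
  rw [colDet_snoc _ _ hc, map_add, map_mul, map_colDet, map_colDet Polynomial.C,
    map_snocRem, map_snocRem Polynomial.C]
  have e1 : sepVar (k := k) (b, Fin.ofNat m r, j) (pairRow k m n b r j) = Polynomial.X :=
    sepVar_X_self _
  rw [e1, snocRem_congr hne, colDet_congr (r' := fun i l => Polynomial.C (pairRow k m n b i l))
    fun i hi l => hne i hi.le _ (Or.inl hi.ne)]


theorem ker_param_le_sup {s : Bool → ℕ} {B : Bool → Finset (Fin n)} {b : Bool} {r : ℕ}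
    (hs : s b = r + 1) (hm : ∀ b, s b ≤ m) {j : Fin n} (hj : j ∉ B b)
    (hker : ∀ s' : Bool → ℕ, (∀ b, 1 ≤ s' b) → (∀ b, s' b ≤ m) → 
      RingHom.ker (param (k := k) s' B) = pairIdeal k m s' B) (h1 : ∀ b, 1 ≤ s b) :
    RingHom.ker (param (k := k) (m := m) s (Function.update B b (insert j (B b)))) ≤
      pairIdeal k m s B ⊔ Ideal.span (Set.range fun c : {c : Fin r → Fin n // ∀ i, c i ∈ B b} =>
        colDet (pairRow k m n b) (Fin.snoc c.1 j : Fin (r + 1) → Fin n)) := by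
  set B' := Function.update B b (insert j (B b)) with hB'
  set q := ∑ i ∈ Ico 1 (s b), relVar k m n b i * extRow k m n b i j
  have hdvd : ∀ p, param (k := k) (m := m) s B' p = 0 → 
      X (Sum.inl (b, 0, j)) - q ∣ param s B p := by
    intro p hp
    have h2 : (aeval (fun y => if y = Sum.inl (b, 0, j) then q else X y)).comp
        (param (k := k) (m := m) s B) = param s B' := by
      refine MvPolynomial.algHom_ext fun v => ?_
      obtain ⟨b', i, l⟩ := v
      rw [AlgHom.comp_apply, param_X, param_X]
      dsimp only
      by_cases hv : i = 0 ∧ l ∈ B b'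
      · have hv' : l ∈ B' b' := by
          by_cases hb : b' = b
          · subst hb
            simp [hB', hv.2]
          · simp [hB', hb, hv.2]
        rw [if_pos hv, if_pos ⟨hv.1, hv'⟩, map_sum]
        refine sum_congr rfl fun i hi => ?_
        have hi0 : Fin.ofNat m i ≠ 0 := by
          rw [mem_Ico] at hi
          rw [ne_eq, ofNat_eq_zero (hi.2.trans_le (hm b'))]
          omega
        rw [map_mul, relVar, extRow, aeval_X, aeval_X, if_neg (by simp), if_neg]
        simp only [Sum.inl.injEq, Prod.mk.injEq, hi0, false_and, and_false, not_false_eq_true]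
      · rw [if_neg hv, aeval_X]
        by_cases hv2 : (b', i, l) = (b, 0, j)
        · simp only [Prod.mk.injEq] at hv2
          obtain ⟨rfl, rfl, rfl⟩ := hv2
          rw [if_pos rfl, if_pos ⟨rfl, by simp [hB']⟩]
        · rw [if_neg (by simpa using hv2), if_neg]
          rintro ⟨rfl, hl⟩
          refine hv ⟨rfl, ?_⟩
          by_cases hb : b' = b
          · subst hb
            simp only [hB', Function.update_self, mem_insert] at hl
            grind
          · simpa [hB', hb] using hl
    have h3 := dvd_sub_aeval (Sum.inl (b, 0, j)) q (param s B p)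
    rwa [← AlgHom.comp_apply, h2, hp, sub_zero] at h3
  have hrm : r < m := by have := hm b; omega
  obtain ⟨a, ha⟩ : ∃ a, sepVar (Sum.inl (b, Fin.ofNat m r, j)) (X (Sum.inl (b, 0, j)) - q) =
      Polynomial.C (relCoeff k m n s b r) * Polynomial.X + Polynomial.C a := by
    rcases Nat.eq_zero_or_pos r with rfl | hr
    · refine ⟨0, ?_⟩
      have hq : q = 0 := by simp [q, hs]
      rw [hq, sub_zero, show Fin.ofNat m 0 = 0 from rfl, sepVar_X_self]
      simp [relCoeff]
    · have hr0 : Fin.ofNat m r ≠ 0 := by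
        rw [ne_eq, ofNat_eq_zero hrm]
        omega
      refine ⟨X (Sum.inl (b, 0, j)) - ∑ i ∈ Ico 1 r, relVar k m n b i * extRow k m n b i j, ?_⟩
      simp only [q, hs]
      rw [sum_Ico_succ_top hr, map_sub, map_add, map_mul, map_sum]
      have h3 : ∀ i ∈ Ico 1 r, sepVar (Sum.inl (b, Fin.ofNat m r, j))
          (relVar k m n b i * extRow k m n b i j) =
            Polynomial.C (relVar k m n b i * extRow k m n b i j) := by
        intro i hi
        rw [mem_Ico] at hi
        have : Fin.ofNat m i ≠ Fin.ofNat m r := by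
          rw [ne_eq, ofNat_inj (by omega) hrm]
          omega
        rw [map_mul, relVar, extRow, sepVar_X_of_ne (by simp), sepVar_X_of_ne, map_mul]
        simp only [ne_eq, Sum.inl.injEq, Prod.mk.injEq, this, false_and, and_false,
          not_false_eq_true]
      rw [sum_congr rfl h3, sepVar_X_of_ne, relVar, sepVar_X_of_ne (by simp), extRow,
        sepVar_X_self, relCoeff, if_neg hr.ne', if_pos (by omega), map_sub, map_sum, relVar,
        map_neg]
      · ring
      · simp only [ne_eq, Sum.inl.injEq, Prod.mk.injEq, hr0.symm, false_and, and_false,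
          not_false_eq_true]
  have hker1 : RingHom.ker (param (k := k) (m := m) s B).toRingHom = pairIdeal k m s B :=
    hker s h1 hm
  intro p hp
  have hJ := mem_span_of_dvd_map (param (k := k) (m := m) s B).toRingHom
    (fun c : {c : Fin r → Fin n // ∀ i, c i ∈ B b} => colDet (pairRow k m n b) c.1)
    (fun c => snocRem (pairRow k m n b) c.1 j)
    (sepVar (Sum.inl (b, Fin.ofNat m r, j)) (X (Sum.inl (b, 0, j)) - q)) ?_ ?_ ?_
    (sepVar (b, Fin.ofNat m r, j) p) ?_
  · have hle : (RingHom.ker (param (k := k) (m := m) s B).toRingHom).map Polynomial.C ⊔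
        Ideal.span (Set.range fun c : {c : Fin r → Fin n // ∀ i, c i ∈ B b} =>
          Polynomial.C (colDet (pairRow k m n b) c.1) * Polynomial.X +
          Polynomial.C (snocRem (pairRow k m n b) c.1 j)) ≤
        (pairIdeal k m s B ⊔
          Ideal.span (Set.range fun c : {c : Fin r → Fin n // ∀ i, c i ∈ B b} =>
            colDet (pairRow k m n b) (Fin.snoc c.1 j : Fin (r + 1) → Fin n))).comap
        (Polynomial.evalRingHom (X (b, Fin.ofNat m r, j))) := by
      refine sup_le (Ideal.map_le_iff_le_comap.2 fun x hx => ?_) (Ideal.span_le.2 ?_)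
      · rw [hker1] at hx
        simpa using Ideal.mem_sup_left hx
      · rintro _ ⟨c, rfl⟩
        refine Ideal.mem_sup_right (Ideal.subset_span ⟨c, ?_⟩)
        dsimp only
        rw [colDet_snoc _ _ fun i => ne_of_mem_of_not_mem (c.2 i) hj]
        simp [pairRow]
    have := hle hJ
    rwa [Ideal.mem_comap, Polynomial.coe_evalRingHom, eval_sepVar] at this
  · rw [ha]
    exact Polynomial.natDegree_linear (relCoeff_ne_zero (by omega))
  · intro p hp
    have he : (Polynomial.C (relCoeff k m n s b r) * Polynomial.X + Polynomial.C a).coeff 1 =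
        relCoeff k m n s b r := by simp [Polynomial.coeff_C]
    rw [ha, he] at hp
    rcases Nat.eq_zero_or_pos r with rfl | hr
    · refine Ideal.mem_sup_right ?_
      have : (1 : MvPolynomial (Bool × Fin m × Fin n) k) ∈ Ideal.span (Set.range
          fun c : {c : Fin 0 → Fin n // ∀ i, c i ∈ B b} => colDet (pairRow k m n b) c.1) :=
        Ideal.subset_span ⟨⟨Fin.elim0, fun i => i.elim0⟩, by simp [colDet]⟩
      rw [(Ideal.eq_top_iff_one _).2 this]
      trivial
    · have h3 : (aeval (fun y => if y = Sum.inr (b, Fin.ofNat m r) then 0 else X y)).comp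
          (param (k := k) (m := m) s B) = param (Function.update s b r) B := by
        refine MvPolynomial.algHom_ext fun v => ?_
        obtain ⟨b', i, l⟩ := v
        rw [AlgHom.comp_apply, param_X, param_X]
        dsimp only
        split_ifs with hv
        · rw [map_sum]
          by_cases hb : b' = b
          · subst hb
            rw [Function.update_self, hs, sum_Ico_succ_top hr, map_mul (aeval _), relVar, aeval_X,
              if_pos rfl, zero_mul, add_zero]
            refine sum_congr rfl fun i hi => ?_
            rw [mem_Ico] at hi
            have : Fin.ofNat m i ≠ Fin.ofNat m r := by
              rw [ne_eq, ofNat_inj (by omega) hrm]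
              omega
            rw [map_mul, relVar, extRow, aeval_X, aeval_X, if_neg, if_neg (by simp)]
            simpa using this
          · rw [Function.update_of_ne hb]
            refine sum_congr rfl fun i hi => ?_
            rw [map_mul, relVar, extRow, aeval_X, aeval_X, if_neg (by simp [hb]),
              if_neg (by simp)]
        · rw [aeval_X, if_neg (by simp)]
      have h4 : p ∈ RingHom.ker (param (k := k) (m := m) (Function.update s b r) B) := by
        rw [RingHom.mem_ker, ← h3, AlgHom.comp_apply]
        obtain ⟨q, hq⟩ := hp
        rw [show param (k := k) (m := m) s B p = _ from hq, map_mul, relCoeff, if_neg hr.ne',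
          if_pos (by omega), relVar, map_neg, aeval_X, if_pos rfl]
        simp
      rw [hker _ (fun b' => ?_) (fun b' => ?_), pairIdeal_eq _ _ b] at h4
      · rw [hker1]
        refine SetLike.le_def.1 (sup_le ?_ ?_) h4
        · rw [Function.update_self, colMinors_le]
          exact fun c hc => Ideal.mem_sup_right (Ideal.subset_span ⟨⟨c, hc⟩, rfl⟩)
        · rw [Function.update_of_ne (by simp)]
          exact (colMinors_le_pairIdeal s B (!b)).trans le_sup_left
      all_goals
        by_cases hb : b' = b
        · subst hb
          rw [Function.update_self]
          omega
        · rw [Function.update_of_ne hb]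
          first | exact h1 b' | exact hm b'
  · intro c
    have hc : ∀ i, c.1 i ≠ j := fun i => ne_of_mem_of_not_mem (c.2 i) hj
    rw [← sepVar_colDet_snoc (by have := hm b; omega) hc, sepVar_comp_param hj]
    refine map_dvd _ (hdvd _ ?_)
    refine param_colDet_eq_zero (b := b) (h1 b) (hm b) (fun _ _ => rfl) hs.le fun i => ?_
    refine Fin.lastCases ?_ (fun i => ?_) i
    · simp [hB']
    · simpa [hB'] using Or.inr (c.2 i)
  · rw [sepVar_comp_param hj]
    exact map_dvd _ (hdvd _ hp)

theorem ker_param {s : Bool → ℕ} (h1 : ∀ b, 1 ≤ s b) (hm : ∀ b, s b ≤ m)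
    (B : Bool → Finset (Fin n)) :
    RingHom.ker (param (k := k) (m := m) s B) = pairIdeal k m s B := by
  suffices ∀ N, ∀ B : Bool → Finset (Fin n), #(B true) + #(B false) = N → ∀ s : Bool → ℕ,
      (∀ b, 1 ≤ s b) → (∀ b, s b ≤ m) →
      RingHom.ker (param (k := k) (m := m) s B) = pairIdeal k m s B from this _ B rfl s h1 hm
  intro N
  induction N with
  | zero =>
    intro B hB s h1 hm
    refine le_antisymm (fun p hp => ?_) (pairIdeal_le_ker_param B h1 hm)
    have h : (param (k := k) (m := m) s B) = rename Sum.inl := by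
      refine MvPolynomial.algHom_ext fun v => ?_
      rw [param_X, rename_X, if_neg]
      rintro ⟨-, h⟩
      rw [Nat.add_eq_zero_iff, card_eq_zero, card_eq_zero] at hB
      rcases hv : v.1 with _ | _ <;> simp [hv, hB] at h
    rw [h, RingHom.mem_ker] at hp
    rw [rename_injective _ Sum.inl_injective (hp.trans (map_zero _).symm)]
    exact zero_mem _
  | succ N ih =>
    intro B hB s h1 hm
    refine le_antisymm ?_ (pairIdeal_le_ker_param B h1 hm)
    obtain ⟨b, j, hj⟩ : ∃ b j, j ∈ B b := by
      by_contra! hcon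
      simp [eq_empty_of_forall_notMem (hcon true), eq_empty_of_forall_notMem (hcon false)] at hB
    obtain ⟨r, hr⟩ := Nat.exists_eq_add_of_le' (h1 b)
    have hcard : #(Function.update B b ((B b).erase j) true) +
        #(Function.update B b ((B b).erase j) false) = N := by
      have h2 := card_erase_add_one hj
      rcases b <;> simp <;> omega
    have h3 := ker_param_le_sup (B := Function.update B b ((B b).erase j)) hr hm (j := j)
      (by simp) (ih _ hcard) h1
    rw [Function.update_self, insert_erase hj, Function.update_idem, Function.update_eq_self] at h3
    refine h3.trans ?_
    rw [pairIdeal_eq _ _ b, pairIdeal_eq _ _ b, Function.update_self,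
      Function.update_of_ne (by simp), hr, colMinors_succ_eq _ _ hj]
    exact sup_le (sup_le (le_sup_of_le_left le_sup_left) le_sup_right)
      (le_sup_of_le_left le_sup_right)

theorem pairIdeal_isPrime {s : Bool → ℕ} (h1 : ∀ b, 1 ≤ s b) (hm : ∀ b, s b ≤ m)
    (B : Bool → Finset (Fin n)) : (pairIdeal k m s B).IsPrime :=
  ker_param (k := k) h1 hm B ▸ RingHom.ker_isPrime _

theorem colDet_mem_pairIdeal {s : Bool → ℕ} (h1 : ∀ b, 1 ≤ s b) (hm : ∀ b, s b ≤ m)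
    {B : Bool → Finset (Fin n)} (b : Bool)
    {r : ℕ → Fin n → MvPolynomial (Bool × Fin m × Fin n) k}
    (hr : ∀ i < s b, r i = pairRow k m n b i) {S : ℕ} (hS : s b ≤ S) {c : Fin S → Fin n}
    (hc : ∀ j, c j ∈ B b) : colDet r c ∈ pairIdeal k m s B := by
  rw [← ker_param h1 hm, RingHom.mem_ker]
  exact param_colDet_eq_zero (h1 b) (hm b) hr hS hc

theorem colDet_mul_sub_mem {s : Bool → ℕ} (h1 : ∀ b, 1 ≤ s b) (hm : ∀ b, s b ≤ m)
    {B : Bool → Finset (Fin n)} {b : Bool} {r : ℕ} (hs : s b = r + 1) (j : Fin n)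
    {c c' : Fin r → Fin n} (hc : ∀ i, c i ∈ B b) (hc' : ∀ i, c' i ∈ B b) :
    colDet (pairRow k m n b) c' *
        colDet (pairRow k m n b) (Fin.snoc c j : Fin (r + 1) → Fin n) -
      colDet (pairRow k m n b) (Fin.snoc c' j : Fin (r + 1) → Fin n) *
        colDet (pairRow k m n b) c ∈ pairIdeal k m s B := by
  have key : ∀ c : Fin r → Fin n, (∀ i, c i ∈ B b) → relCoeff k m n s b r *
      param s B (colDet (pairRow k m n b) (Fin.snoc c j : Fin (r + 1) → Fin n)) =
      (∑ l ∈ range (r + 1), relCoeff k m n s b l * param s B (pairRow k m n b l j)) *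
        param s B (colDet (pairRow k m n b) c) := by
    intro c hc
    rw [map_colDet, map_colDet]
    exact mul_colDet_snoc _ c j _ fun i =>
      sum_relCoeff (h1 b) (hm b) (fun _ _ => rfl) hs.le (hc i)
  rw [← ker_param h1 hm, RingHom.mem_ker, map_sub, map_mul, map_mul]
  refine mul_left_cancel₀ (relCoeff_ne_zero (k := k) (m := m) (n := n) (s := s) (b := b) (i := r)
    (by omega)) ?_
  linear_combination param s B (colDet (pairRow k m n b) c') * key c hc -
    param s B (colDet (pairRow k m n b) c) * key c' hc'

end Pair

section Pair

variable {k : Type*} [Field k] {m n : ℕ} [NeZero m]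

theorem exists_eval_eq_one {s : Bool → ℕ} (h1 : ∀ b, 1 ≤ s b)
    (hm : ∀ b, s b ≤ m) {B : Bool → Finset (Fin n)} {b : Bool} {r : ℕ} (hs : s b = r + 1)
    {j : Fin n} (hj : j ∉ B b) {c : Fin r → Fin n} (hc : ∀ i, c i ∈ B b)
    (hinj : Function.Injective c) :
    ∃ θ : MvPolynomial (Bool × Fin m × Fin n) k →ₐ[k] k, pairIdeal k m s B ≤ RingHom.ker θ ∧
      θ (colDet (pairRow k m n b) c) = 1 ∧
      θ (colDet (pairRow k m n b) (Fin.snoc c j : Fin (r + 1) → Fin n)) = 1 := by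
  classical
  let θ : MvPolynomial (Bool × Fin m × Fin n) k →ₐ[k] k := aeval fun v =>
    if v.1 = b then if v.2.2 = j then if v.2.1 = Fin.ofNat m r then 1 else 0 else
      if ∃ t : Fin r, v.2.2 = c t ∧ (v.2.1 = Fin.ofNat m t ∨ v.2.1 = Fin.ofNat m r ∧ (t : ℕ) = 0)
      then 1 else 0 else 0
  have hrm : r < m := by have := hm b; omega
  have hθj : ∀ i ≤ r, θ (pairRow k m n b i j) = if i = r then 1 else 0 := by
    intro i hi
    simp only [θ, pairRow, aeval_X, if_true, ofNat_inj (show i < m by omega) hrm]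
  have hθ : ∀ i ≤ r, ∀ l, l ≠ j → θ (pairRow k m n b i l) =
      if ∃ t : Fin r, l = c t ∧ (i = t ∨ i = r ∧ (t : ℕ) = 0) then 1 else 0 := by
    intro i hi l hl
    have : ∀ t : Fin r, Fin.ofNat m i = Fin.ofNat m t ↔ i = t := fun t =>
      ofNat_inj (by omega) (by omega)
    simp only [θ, pairRow, aeval_X, if_true, if_neg hl, this,
      ofNat_inj (show i < m by omega) hrm]
  have hθM : θ (colDet (pairRow k m n b) c) = 1 := by
    rw [map_colDet, colDet, ← Matrix.det_one (n := Fin r)]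
    congr 1
    ext i l
    rw [Matrix.of_apply, Matrix.one_apply]
    rw [hθ _ i.2.le _ (ne_of_mem_of_not_mem (hc l) hj)]
    congr 1
    refine propext ⟨?_, ?_⟩
    · rintro ⟨t, ht, h⟩
      rw [hinj ht, Fin.ext_iff]
      omega
    · rintro rfl
      exact ⟨i, rfl, Or.inl rfl⟩
  refine ⟨θ, ?_, hθM, ?_⟩
  · rw [pairIdeal_eq _ _ b]
    refine sup_le (colMinors_le.2 fun c' hc' => ?_) (colMinors_le.2 fun c' hc' => ?_)
    · rw [RingHom.mem_ker, map_colDet]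
      rcases Nat.eq_zero_or_pos r with rfl | hr
      · refine Matrix.det_eq_zero_of_row_eq_zero ⟨0, by omega⟩ fun l => ?_
        rw [Matrix.of_apply]
        dsimp only
        rw [hθ _ le_rfl _ (ne_of_mem_of_not_mem (hc' l) hj), if_neg]
        rintro ⟨t, -⟩
        exact t.elim0
      · refine Matrix.det_zero_of_row_eq (i := ⟨0, by omega⟩) (j := ⟨r, by omega⟩)
          (by simp [Fin.ext_iff]; omega) ?_
        ext l
        rw [Matrix.of_apply, Matrix.of_apply]
        dsimp only
        rw [hθ _ (Nat.zero_le r) _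
          (ne_of_mem_of_not_mem (hc' l) hj), hθ _ le_rfl _ (ne_of_mem_of_not_mem (hc' l) hj)]
        congr 1
        refine propext (exists_congr fun t => and_congr_right fun _ => ?_)
        omega
    · rw [RingHom.mem_ker, map_colDet]
      refine Matrix.det_eq_zero_of_row_eq_zero ⟨0, h1 _⟩ fun l => ?_
      rw [Matrix.of_apply]
      simp [θ, pairRow]
  · rw [colDet_snoc _ _ fun i => ne_of_mem_of_not_mem (hc i) hj, map_add, map_mul, hθM,
      hθj r le_rfl, if_pos rfl, one_mul, map_snocRem]
    convert add_zero (1 : k)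
    refine Matrix.det_eq_zero_of_column_eq_zero (Fin.last r) fun i => ?_
    rw [Matrix.of_apply]
    dsimp only
    rw [Fin.snoc_last]
    split_ifs with h
    · rfl
    · rw [hθj _ (by omega), if_neg (by simpa using h)]

end Pair

section Transfer

variable {P : Type u} [CommRing P] {Q 𝔷 𝔪 𝔤 : Ideal P} {μ ν : P} {w : ℕ}

/-- The elements which are related to an element of `𝔏` by `μ * f ≡ ν * e` modulo `Q`. -/
def relIdeal (Q : Ideal P) (μ ν : P) (𝔏 : Ideal P) : Ideal P where
  carrier := {e | ∃ f ∈ 𝔏, μ * f - ν * e ∈ Q}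
  add_mem' := by
    rintro e e' ⟨f, hf, h⟩ ⟨f', hf', h'⟩
    refine ⟨f + f', add_mem hf hf', ?_⟩
    convert add_mem h h' using 1
    ring
  zero_mem' := ⟨0, zero_mem _, by simp⟩
  smul_mem' := by
    rintro p e ⟨f, hf, h⟩
    refine ⟨p * f, Ideal.mul_mem_left _ _ hf, ?_⟩
    convert Ideal.mul_mem_left _ p h using 1
    simp only [smul_eq_mul]
    ring

theorem le_relIdeal (𝔏 : Ideal P) : Q ≤ relIdeal Q μ ν 𝔏 := fun q hq =>
  ⟨0, zero_mem _, by simpa using Ideal.mul_mem_left _ _ hq⟩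

/-- The submodule of related pairs of elements of two modules over a Rees algebra. -/
def relPairs (Q 𝔷 𝔪 𝔤 : Ideal P) (μ ν : P) (D D' : ℕ) :
    Submodule (reesAlgebra 𝔷) (Polynomial P × Polynomial P) where
  carrier := {p | p.1 ∈ filtPoly 𝔷 D' 𝔪 ∧ p.2 ∈ filtPoly 𝔷 D 𝔤 ∧
    Polynomial.C μ * p.2 - Polynomial.C ν * p.1 ∈ Q.map Polynomial.C}
  add_mem' := by
    rintro p q ⟨h1, h2, h3⟩ ⟨h1', h2', h3'⟩
    refine ⟨add_mem h1 h1', add_mem h2 h2', ?_⟩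
    convert add_mem h3 h3' using 1
    simp only [Prod.fst_add, Prod.snd_add]
    ring
  zero_mem' := ⟨zero_mem _, zero_mem _, by simp⟩
  smul_mem' := by
    rintro x p ⟨h1, h2, h3⟩
    refine ⟨Submodule.smul_mem _ x h1, Submodule.smul_mem _ x h2, ?_⟩
    convert Ideal.mul_mem_left _ (x : Polynomial P) h3 using 1
    change Polynomial.C μ * ((x : Polynomial P) * p.2) -
      Polynomial.C ν * ((x : Polynomial P) * p.1) = _
    ring

theorem mem_map_C_of_C_mul_mem (hQ : Q.IsPrime) (hμ : μ ∉ Q) {p : Polynomial P}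
    (h : Polynomial.C μ * p ∈ Q.map Polynomial.C) (i : ℕ) : p.coeff i ∈ Q := by
  have := Ideal.mem_map_C_iff.1 h i
  rw [Polynomial.coeff_C_mul] at this
  exact (hQ.mem_or_mem this).resolve_left hμ

theorem exists_polynomial_coeff {A B : Type*} [CommRing A] [CommRing B] (p : Polynomial A)
    (R : A → B → ℕ → Prop) (h0 : ∀ i, R 0 0 i) (h : ∀ i, ∃ f, R (p.coeff i) f i) :
    ∃ q : Polynomial B, ∀ i, R (p.coeff i) (q.coeff i) i := by
  classical
  choose f hf using h
  refine ⟨∑ i ∈ p.support, Polynomial.monomial i (f i), fun i => ?_⟩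
  simp only [Polynomial.finsetSum_coeff, Polynomial.coeff_monomial, sum_ite_eq']
  split_ifs with hi
  · exact hf i
  · rw [Polynomial.notMem_support_iff.1 hi]
    exact h0 i

/-- The pairs with vanishing first component. -/
noncomputable def relPairsInr (μ ν : P) (D D' : ℕ) (hQg : Q ≤ 𝔤) :
    filtPoly 𝔷 D Q →+ relPairs Q 𝔷 𝔪 𝔤 μ ν D D' :=
  ((AddMonoidHom.inr (Polynomial P) (Polynomial P)).comp
    (filtPoly 𝔷 D Q).toAddSubgroup.subtype).codRestrict
    (relPairs Q 𝔷 𝔪 𝔤 μ ν D D').toAddSubgroup fun q =>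
      ⟨zero_mem (filtPoly 𝔷 D' 𝔪), fun i => ⟨(q.2 i).1, hQg (q.2 i).2⟩, by
        simpa using Ideal.mul_mem_left _ (Polynomial.C μ)
          (Ideal.mem_map_C_iff.2 fun i => (q.2 i).2)⟩

/-- The pairs with vanishing second component. -/
noncomputable def relPairsInl (μ ν : P) (D D' : ℕ) (hQm : Q ≤ 𝔪) :
    filtPoly 𝔷 D' Q →+ relPairs Q 𝔷 𝔪 𝔤 μ ν D D' :=
  ((AddMonoidHom.inl (Polynomial P) (Polynomial P)).comp
    (filtPoly 𝔷 D' Q).toAddSubgroup.subtype).codRestrict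
    (relPairs Q 𝔷 𝔪 𝔤 μ ν D D').toAddSubgroup fun q =>
      ⟨fun i => ⟨(q.2 i).1, hQm (q.2 i).2⟩, zero_mem (filtPoly 𝔷 D 𝔤), by
        simpa using Ideal.mul_mem_left _ (Polynomial.C ν)
          (Ideal.mem_map_C_iff.2 fun i => (q.2 i).2)⟩

theorem projDimLT_filtPoly_of_rel {R : Type u} [CommRing R] {χ : R →+* reesAlgebra 𝔷}
    (hQ : Q.IsPrime) (hμ : μ ∉ Q) (hν : ν ∉ Q) (hQm : Q ≤ 𝔪) (hQg : Q ≤ 𝔤)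
    (ha : ∀ n, ∀ e ∈ 𝔪, e ∈ 𝔷 ^ (n - w) → ∃ f ∈ 𝔤, f ∈ 𝔷 ^ n ∧ μ * f - ν * e ∈ Q)
    (hb : ∀ n, ∀ f ∈ 𝔤, f ∈ 𝔷 ^ n → ∃ e ∈ 𝔪, e ∈ 𝔷 ^ (n - w) ∧ μ * f - ν * e ∈ Q)
    {D c : ℕ} (h1 : ProjDimLT χ (filtPoly 𝔷 D Q) c)
    (h2 : ProjDimLT χ (filtPoly 𝔷 (D + w) Q) c)
    (h3 : ProjDimLT χ (filtPoly 𝔷 (D + w) 𝔪) (c + 1)) :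
    ProjDimLT χ (filtPoly 𝔷 D 𝔤) (c + 1) := by
  have hW : ProjDimLT χ (relPairs Q 𝔷 𝔪 𝔤 μ ν D (D + w)) (c + 1) := by
    refine (ProjDimLT.shortExact_cases (χ₁ := χ) (χ₂ := χ) (χ₃ := χ)
      (M₁ := filtPoly 𝔷 D Q) (M₂ := relPairs Q 𝔷 𝔪 𝔤 μ ν D (D + w))
      (M₃ := filtPoly 𝔷 (D + w) 𝔪)
      (relPairsInr μ ν D (D + w) hQg)
      (AddMonoidHom.mk' (fun q => ⟨q.1.1, q.2.1⟩) fun p q => rfl)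
      ?_ ?_ ?_ ?_ ?_ (c + 1)).1 (h1.mono (Nat.le_succ c)) h3
    · exact fun r m => Subtype.ext (Prod.ext (smul_zero (χ r)).symm rfl)
    · exact fun r m => rfl
    · exact fun p q h => Subtype.ext (congrArg (fun x => x.1.2) h)
    · intro e
      obtain ⟨q, hq⟩ := exists_polynomial_coeff e.1
        (fun e f i => f ∈ 𝔷 ^ (i + 1 - D) ∧ f ∈ 𝔤 ∧ μ * f - ν * e ∈ Q)
        (fun i => ⟨zero_mem _, zero_mem _, by simp⟩) fun i => by
          obtain ⟨f, h1, h2, h3⟩ := ha (i + 1 - D) _ (e.2 i).2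
            (by rw [Nat.sub_sub]; exact (e.2 i).1)
          exact ⟨f, h2, h1, h3⟩
      refine ⟨⟨(e.1, q), e.2, fun i => ⟨(hq i).1, (hq i).2.1⟩, Ideal.mem_map_C_iff.2 fun i => ?_⟩,
        rfl⟩
      rw [Polynomial.coeff_sub, Polynomial.coeff_C_mul, Polynomial.coeff_C_mul]
      exact (hq i).2.2
    · rintro ⟨⟨e, f⟩, h⟩
      constructor
      · intro h0
        have h0 : e = 0 := congrArg Subtype.val h0
        subst h0
        refine ⟨⟨f, fun i => ⟨(h.2.1 i).1, mem_map_C_of_C_mul_mem hQ hμ ?_ i⟩⟩, rfl⟩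
        simpa using h.2.2
      · rintro ⟨a, ha⟩
        refine Subtype.ext ?_
        exact (congrArg (fun x => x.1.1) ha).symm
  refine (ProjDimLT.shortExact_cases (χ₁ := χ) (χ₂ := χ) (χ₃ := χ)
    (M₁ := filtPoly 𝔷 (D + w) Q) (M₂ := relPairs Q 𝔷 𝔪 𝔤 μ ν D (D + w))
    (M₃ := filtPoly 𝔷 D 𝔤)
    (relPairsInl μ ν D (D + w) hQm)
    (AddMonoidHom.mk' (fun q => ⟨q.1.2, q.2.2.1⟩) fun p q => rfl)
    ?_ ?_ ?_ ?_ ?_ c).2.1 h2 hW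
  · exact fun r m => Subtype.ext (Prod.ext rfl (smul_zero (χ r)).symm)
  · exact fun r m => rfl
  · exact fun p q h => Subtype.ext (congrArg (fun x => x.1.1) h)
  · intro f
    obtain ⟨q, hq⟩ := exists_polynomial_coeff f.1
      (fun f e i => e ∈ 𝔷 ^ (i + 1 - (D + w)) ∧ e ∈ 𝔪 ∧ μ * f - ν * e ∈ Q)
      (fun i => ⟨zero_mem _, zero_mem _, by simp⟩) fun i => by
        obtain ⟨e, h1, h2, h3⟩ := hb (i + 1 - D) _ (f.2 i).2 (f.2 i).1
        exact ⟨e, by rwa [Nat.sub_sub] at h2, h1, h3⟩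
    refine ⟨⟨(q, f.1), fun i => ⟨(hq i).1, (hq i).2.1⟩, f.2, Ideal.mem_map_C_iff.2 fun i => ?_⟩,
      rfl⟩
    rw [Polynomial.coeff_sub, Polynomial.coeff_C_mul, Polynomial.coeff_C_mul]
    exact (hq i).2.2
  · rintro ⟨⟨e, f⟩, h⟩
    constructor
    · intro h0
      have h0 : f = 0 := congrArg Subtype.val h0
      subst h0
      refine ⟨⟨e, fun i => ⟨(h.1 i).1, mem_map_C_of_C_mul_mem hQ hν ?_ i⟩⟩, rfl⟩
      simpa using h.2.2
    · rintro ⟨a, ha⟩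
      refine Subtype.ext ?_
      exact (congrArg (fun x => x.1.2) ha).symm

theorem exists_rel_of_mem {ι : Type*} {M g γ : ι → P} {y : P} (hQ : Q.IsPrime) (hμ : μ ∉ Q)
    (hrel : ∀ c, μ * g c - ν * M c ∈ Q) {ψ : P →+* Polynomial P}
    (hM : ∀ c, ψ (M c) = Polynomial.C (M c)) (hgy : ∀ c, g c = M c * y + γ c)
    (hg : ∀ c, ψ (g c) = Polynomial.C (M c) * Polynomial.X + Polynomial.C (γ c))
    (hψQ : ∀ q ∈ Q, ψ q ∈ Q.map Polynomial.C)
    (hψz : ∀ i, ∀ f ∈ 𝔷 ^ i, ∀ k, (ψ f).coeff k ∈ 𝔷 ^ (i - w * k))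
    (heval : ∀ p, (ψ p).eval y = p) (hy : y ∈ 𝔷 ^ w)
    (ha : ∀ n, ∀ e ∈ Q ⊔ Ideal.span (Set.range M), e ∈ 𝔷 ^ (n - w) →
      ∃ f ∈ 𝔷 ^ n, μ * f - ν * e ∈ Q)
    (n : ℕ) (f : P) (hf : f ∈ Q ⊔ Ideal.span (Set.range g)) (hfn : f ∈ 𝔷 ^ n) :
    ∃ e ∈ Q ⊔ Ideal.span (Set.range M), e ∈ 𝔷 ^ (n - w) ∧ μ * f - ν * e ∈ Q := by
  have key : ∃ e ∈ Q ⊔ Ideal.span (Set.range M), μ * f - ν * e ∈ Q ∧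
      ψ e ∈ (Q ⊔ Ideal.span (Set.range M)).map Polynomial.C ∧ ∃ F : Polynomial P,
        Polynomial.C μ * F - Polynomial.C ν * ψ e ∈ Q.map Polynomial.C ∧
        ψ f - Polynomial.X * ψ e - F + Polynomial.C y * ψ e ∈ Q.map Polynomial.C := by
    obtain ⟨q, hq, x, hx, rfl⟩ := Submodule.mem_sup.1 hf
    clear hf hfn
    have hsub : ∀ e ∈ Q, Polynomial.C e ∈ Q.map Polynomial.C := fun e he =>
      Ideal.mem_map_of_mem _ he
    induction hx using Submodule.span_induction generalizing q with
    | mem x hx =>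
      obtain ⟨c, rfl⟩ := hx
      refine ⟨M c, Ideal.mem_sup_right (Ideal.subset_span ⟨c, rfl⟩), ?_, ?_,
        Polynomial.C (g c), ?_, ?_⟩
      · convert add_mem (hrel c) (Ideal.mul_mem_left Q μ hq) using 1
        ring
      · rw [hM]
        exact Ideal.mem_map_of_mem _ (Ideal.mem_sup_right (Ideal.subset_span ⟨c, rfl⟩))
      · rw [hM, ← map_mul, ← map_mul, ← map_sub]
        exact hsub _ (hrel c)
      · rw [map_add, hM, hg, hgy]
        convert hψQ q hq using 1
        simp only [map_add, map_mul]
        ring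
    | zero =>
      refine ⟨0, zero_mem _, ?_, by simp, 0, by simp, ?_⟩
      · simpa using Ideal.mul_mem_left Q μ hq
      · simpa using hψQ q hq
    | add x x' _ _ ih ih' =>
      obtain ⟨e, h1, h2, h3, F, h4, h5⟩ := ih q hq
      obtain ⟨e', h1', h2', h3', F', h4', h5'⟩ := ih' 0 (zero_mem _)
      refine ⟨e + e', add_mem h1 h1', ?_, ?_, F + F', ?_, ?_⟩
      · convert add_mem h2 h2' using 1
        ring
      · rw [map_add]
        exact add_mem h3 h3'
      · convert add_mem h4 h4' using 1
        rw [map_add]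
        ring
      · convert add_mem h5 h5' using 1
        simp only [map_add, map_zero]
        ring
    | smul a x _ ih =>
      obtain ⟨e, h1, h2, h3, F, h4, h5⟩ := ih 0 (zero_mem _)
      refine ⟨a * e, Ideal.mul_mem_left _ _ h1, ?_, ?_, ψ a * F, ?_, ?_⟩
      · convert add_mem (Ideal.mul_mem_left Q a h2) (Ideal.mul_mem_left Q μ hq) using 1
        rw [smul_eq_mul]
        ring
      · rw [map_mul]
        exact Ideal.mul_mem_left _ _ h3
      · convert Ideal.mul_mem_left _ (ψ a) h4 using 1
        rw [map_mul]
        ring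
      · convert add_mem (Ideal.mul_mem_left _ (ψ a) h5) (hψQ q hq) using 1
        simp only [map_add, map_zero, smul_eq_mul, map_mul]
        ring
  obtain ⟨e, he, hef, heψ, F, hF, hfF⟩ := key
  rcases Nat.lt_or_ge n w with hnw | hnw
  · exact ⟨e, he, by simp [Nat.sub_eq_zero_of_le hnw.le], hef⟩
  obtain ⟨N, rfl⟩ := Nat.exists_eq_add_of_le' hnw
  rw [Nat.add_sub_cancel] at *
  suffices e ∈ 𝔷 ^ N ⊔ Q by
    obtain ⟨u, hu, q, hq, rfl⟩ := Submodule.mem_sup.1 this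
    refine ⟨u, ?_, hu, ?_⟩
    · simpa using sub_mem he (Ideal.mem_sup_left hq)
    · convert add_mem hef (Ideal.mul_mem_left Q ν hq) using 1
      ring
  have hcoeff : ∀ l k, (ψ e).natDegree < k + l → (ψ e).coeff k ∈ 𝔷 ^ (N - w * k) ⊔ Q := by
    intro l
    induction l with
    | zero =>
      intro k hk
      rw [Polynomial.coeff_eq_zero_of_natDegree_lt (by omega)]
      exact zero_mem _
    | succ l ih =>
      intro k hk
      obtain ⟨u, hu, q, hq, huq⟩ := Submodule.mem_sup.1 (ih (k + 1) (by omega))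
      have hu' : u ∈ Q ⊔ Ideal.span (Set.range M) := by
        simpa [← huq] using sub_mem (Ideal.mem_map_C_iff.1 heψ (k + 1)) (Ideal.mem_sup_left hq)
      have hexp : N ≤ N - w * (k + 1) + w + w * k := by
        rw [mul_add, mul_one]
        omega
      obtain ⟨f', hf', hr⟩ := ha (N - w * (k + 1) + w) u hu' (by rwa [Nat.add_sub_cancel])
      have h1 : f' - F.coeff (k + 1) ∈ Q := by
        have h2 := Ideal.mem_map_C_iff.1 hF (k + 1)
        rw [Polynomial.coeff_sub, Polynomial.coeff_C_mul, Polynomial.coeff_C_mul, ← huq] at h2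
        have h3 := add_mem (sub_mem hr h2) (Ideal.mul_mem_left Q (-ν) hq)
        refine (hQ.mem_or_mem (x := μ) ?_).resolve_left hμ
        convert h3 using 1
        ring
      have h2 := hψz _ f hfn (k + 1)
      have h3 := Ideal.mul_mem_mul hy hu
      rw [← pow_add] at h3
      have h4 := Ideal.mem_map_C_iff.1 hfF (k + 1)
      rw [Polynomial.coeff_add, Polynomial.coeff_sub, Polynomial.coeff_sub, Polynomial.coeff_X_mul,
        Polynomial.coeff_C_mul] at h4
      have h5 : (ψ f).coeff (k + 1) + y * u - f' ∈ 𝔷 ^ (N - w * k) :=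
        sub_mem (add_mem (Ideal.pow_le_pow_right (by rw [mul_add]; omega) h2)
          (Ideal.pow_le_pow_right (by omega) h3)) (Ideal.pow_le_pow_right (by omega) hf')
      convert add_mem (Ideal.mem_sup_left h5) (Ideal.mem_sup_right (add_mem (sub_mem h1 h4)
        (Ideal.mul_mem_left Q y hq))) using 1
      rw [← huq]
      ring
  rw [← heval e, Polynomial.eval_eq_sum_range]
  refine sum_mem fun k _ => ?_
  have hyk : y ^ k ∈ 𝔷 ^ (w * k) := by
    rw [pow_mul]
    exact Ideal.pow_mem_pow hy k
  obtain ⟨u, hu, q, hq, h⟩ := Submodule.mem_sup.1 (hcoeff ((ψ e).natDegree + 1) k (by omega))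
  rw [← h, add_mul]
  refine add_mem (Ideal.mem_sup_left ?_) (Ideal.mem_sup_right (Ideal.mul_mem_right _ _ hq))
  have := Ideal.mul_mem_mul hu hyk
  rw [← pow_add] at this
  exact Ideal.pow_le_pow_right (by omega) this

theorem inf_pow_le_and_projDimLT_of_rel {ι : Type*} {M g γ : ι → P} {y : P} (hQ : Q.IsPrime)
    (hμ : μ ∉ Q) (hν : ν ∉ Q)
    (hrel : ∀ c, μ * g c - ν * M c ∈ Q) {ψ : P →+* Polynomial P}
    (hM : ∀ c, ψ (M c) = Polynomial.C (M c)) (hgy : ∀ c, g c = M c * y + γ c)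
    (hg : ∀ c, ψ (g c) = Polynomial.C (M c) * Polynomial.X + Polynomial.C (γ c))
    (hψQ : ∀ q ∈ Q, ψ q ∈ Q.map Polynomial.C)
    (hψz : ∀ i, ∀ f ∈ 𝔷 ^ i, ∀ k, (ψ f).coeff k ∈ 𝔷 ^ (i - w * k))
    (heval : ∀ p, (ψ p).eval y = p) (hy : y ∈ 𝔷 ^ w)
    {𝔏 : ℕ → Ideal P} (h𝔏 : ∀ n, 𝔏 n ≤ 𝔷 ^ n)
    (h𝔏' : ∀ n, 𝔏 n ≤ Q ⊔ Ideal.span (Set.range g)) (hQ𝔏 : ∀ n, Q ⊓ 𝔷 ^ n ≤ 𝔏 n)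
    (ha : ∀ n, (Q ⊔ Ideal.span (Set.range M)) ⊓ 𝔷 ^ (n - w) ≤ relIdeal Q μ ν (𝔏 n)) :
    (∀ n, (Q ⊔ Ideal.span (Set.range g)) ⊓ 𝔷 ^ n ≤ 𝔏 n) ∧
    ∀ {R : Type u} [CommRing R] {χ : R →+* reesAlgebra 𝔷} {D c : ℕ},
      ProjDimLT χ (filtPoly 𝔷 D Q) c → ProjDimLT χ (filtPoly 𝔷 (D + w) Q) c →
      ProjDimLT χ (filtPoly 𝔷 (D + w) (Q ⊔ Ideal.span (Set.range M))) (c + 1) →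
      ProjDimLT χ (filtPoly 𝔷 D (Q ⊔ Ideal.span (Set.range g))) (c + 1) := by
  have hb := exists_rel_of_mem hQ hμ hrel hM hgy hg hψQ hψz heval hy fun n e he hen =>
    have ⟨f, hf, h⟩ := ha n ⟨he, hen⟩
    ⟨f, h𝔏 n hf, h⟩
  refine ⟨fun n f hf => ?_, fun {R _ χ D c} h1 h2 h3 => ?_⟩
  · obtain ⟨e, he, hen, hef⟩ := hb n f hf.1 hf.2
    obtain ⟨f', hf', h⟩ := ha n ⟨he, hen⟩
    have : f - f' ∈ Q := by
      refine (hQ.mem_or_mem (x := μ) ?_).resolve_left hμ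
      convert sub_mem hef h using 1
      ring
    simpa using add_mem (hQ𝔏 n ⟨this, sub_mem hf.2 (h𝔏 n hf')⟩) hf'
  · refine projDimLT_filtPoly_of_rel hQ hμ hν le_sup_left le_sup_left (fun n e he hen => ?_) hb
      h1 h2 h3
    obtain ⟨f, hf, h⟩ := ha n ⟨he, hen⟩
    exact ⟨f, h𝔏' n hf, h𝔏 n hf, h⟩

end Transfer

section Diagonal

variable {k : Type u} [Field k] {m n : ℕ} [NeZero m]

variable (k m n) in
/-- The ideal of the diagonal in the product of two spaces of matrices. -/
noncomputable def diagonal : Ideal (MvPolynomial (Bool × Fin m × Fin n) k) :=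
  Ideal.span (Set.range fun a : Fin m × Fin n => X (true, a) - X (false, a))

theorem pairRow_sub_mem (b : Bool) (i : ℕ) (l : Fin n) :
    pairRow k m n b i l - pairRow k m n (!b) i l ∈ diagonal k m n := by
  have h : pairRow k m n true i l - pairRow k m n false i l ∈ diagonal k m n :=
    Ideal.subset_span ⟨_, rfl⟩
  cases b
  · simpa using neg_mem h
  · exact h

variable (k m n) in
/-- The matrix of variables labelled `b`, with the first `t` rows taken from the other matrix. -/
noncomputable def mixRow (b : Bool) (t i : ℕ) (l : Fin n) :
    MvPolynomial (Bool × Fin m × Fin n) k :=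
  if i < t then pairRow k m n (!b) i l else pairRow k m n b i l

theorem colDet_sub_mem {P : Type*} [CommRing P] {r r' : ℕ → Fin n → P} {J : Ideal P} {s : ℕ}
    {c : Fin s → Fin n} (h : ∀ i j, r i j - r' i j ∈ J) : colDet r c - colDet r' c ∈ J := by
  rw [← Ideal.Quotient.mk_eq_mk_iff_sub_mem, map_colDet, map_colDet]
  refine colDet_congr fun i _ j => ?_
  exact (Ideal.Quotient.mk_eq_mk_iff_sub_mem _ _).2 (h _ _)

theorem colDet_sub_mem_mul {P : Type*} [CommRing P] {r r' : ℕ → Fin n → P} {J : Ideal P} {s : ℕ}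
    {B : Finset (Fin n)} {c : Fin (s + 1) → Fin n} (hc : ∀ j, c j ∈ B)
    (h : ∀ i < s, ∀ j, r i (c j) = r' i (c j)) (hJ : ∀ j, r s (c j) - r' s (c j) ∈ J) :
    colDet r c - colDet r' c ∈ J * colMinors r s B := by
  rw [colDet_succ_last, colDet_succ_last, ← sum_sub_distrib]
  refine sum_mem fun j _ => ?_
  rw [← colDet_congr (r := r) (r' := r') (c := c ∘ j.succAbove) fun i hi l => h i hi _]
  have h1 := Ideal.mul_mem_mul (hJ j) (colDet_mem (r := r) (c := c ∘ j.succAbove) fun l => hc _)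
  convert Ideal.mul_mem_left _ ((-1) ^ (s + (j : ℕ))) h1 using 1
  ring

variable (k m) in
/-- The differences of a minor of one of the matrices and the corresponding mixed minor. -/
noncomputable def diffIdeal (s : Bool → ℕ) (A : Bool → Finset (Fin n)) :
    Ideal (MvPolynomial (Bool × Fin m × Fin n) k) :=
  Ideal.span {d | ∃ b, s (!b) ≤ s b ∧ ∃ c : Fin (s b) → Fin n, (∀ i b', c i ∈ A b') ∧
    d = colDet (pairRow k m n b) c - colDet (mixRow k m n b (s (!b))) c}

theorem diffIdeal_mono {s : Bool → ℕ} {A A' : Bool → Finset (Fin n)} (h : ∀ b, A b ⊆ A' b) :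
    diffIdeal k m s A ≤ diffIdeal k m s A' :=
  Ideal.span_mono fun _ ⟨b, hb, c, hc, hd⟩ => ⟨b, hb, c, fun i b' => h b' (hc i b'), hd⟩

theorem diffIdeal_le_diagonal (s : Bool → ℕ) (A : Bool → Finset (Fin n)) :
    diffIdeal k m s A ≤ diagonal k m n := by
  rw [diffIdeal, Ideal.span_le]
  rintro d ⟨b, -, c, -, rfl⟩
  refine colDet_sub_mem fun i j => ?_
  unfold mixRow
  split_ifs
  · exact pairRow_sub_mem b i j
  · simp

theorem colDet_mixRow_mem {s : Bool → ℕ} (h1 : ∀ b, 1 ≤ s b) (hm : ∀ b, s b ≤ m)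
    {A : Bool → Finset (Fin n)} (b : Bool) {S t : ℕ} (ht : s (!b) ≤ t) (hS : s (!b) ≤ S)
    {c : Fin S → Fin n} (hc : ∀ i, c i ∈ A (!b)) :
    colDet (mixRow k m n b t) c ∈ pairIdeal k m s A :=
  colDet_mem_pairIdeal h1 hm (!b) (fun _ hi => funext fun _ => if_pos (by omega)) hS hc

theorem diffIdeal_le_pairIdeal {s : Bool → ℕ} (h1 : ∀ b, 1 ≤ s b) (hm : ∀ b, s b ≤ m)
    (A : Bool → Finset (Fin n)) : diffIdeal k m s A ≤ pairIdeal k m s A := by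
  rw [diffIdeal, Ideal.span_le]
  rintro d ⟨b, hs, c, hc, rfl⟩
  exact sub_mem (colMinors_le_pairIdeal _ _ b (colDet_mem fun i => hc i b))
    (colDet_mixRow_mem h1 hm b le_rfl hs fun i => hc i _)

variable (k m) in
/-- The expected intersection of `pairIdeal` with the `i`-th power of the diagonal ideal. -/
noncomputable def expectedInf (s : Bool → ℕ) (A : Bool → Finset (Fin n)) (i : ℕ) :
    Ideal (MvPolynomial (Bool × Fin m × Fin n) k) :=
  diagonal k m n ^ i * pairIdeal k m s A ⊔ diagonal k m n ^ (i - 1) * diffIdeal k m s A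

theorem pairIdeal_mono {s : Bool → ℕ} {A A' : Bool → Finset (Fin n)} (h : ∀ b, A b ⊆ A' b) :
    pairIdeal k m s A ≤ pairIdeal k m s A' :=
  iSup_mono fun b => colMinors_mono (h b)

theorem expectedInf_mono {s : Bool → ℕ} {A A' : Bool → Finset (Fin n)} (h : ∀ b, A b ⊆ A' b)
    (i : ℕ) : expectedInf k m s A i ≤ expectedInf k m s A' i :=
  sup_le_sup (Ideal.mul_mono_right (pairIdeal_mono h)) (Ideal.mul_mono_right (diffIdeal_mono h))

theorem expectedInf_le_pow (s : Bool → ℕ) (A : Bool → Finset (Fin n)) (i : ℕ) :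
    expectedInf k m s A i ≤ diagonal k m n ^ i := by
  refine sup_le Ideal.mul_le_left ((Ideal.mul_mono_right (diffIdeal_le_diagonal s A)).trans ?_)
  rw [← pow_succ]
  exact Ideal.pow_le_pow_right (by omega)

theorem expectedInf_le_pairIdeal {s : Bool → ℕ} (h1 : ∀ b, 1 ≤ s b) (hm : ∀ b, s b ≤ m)
    (A : Bool → Finset (Fin n)) (i : ℕ) : expectedInf k m s A i ≤ pairIdeal k m s A :=
  sup_le Ideal.mul_le_right (Ideal.mul_le_right.trans (diffIdeal_le_pairIdeal h1 hm A))

theorem coeff_mem_pow {P : Type*} [CommRing P] {ψ : P →+* Polynomial P} {𝔷 : Ideal P} {w : ℕ}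
    {G : Set P} (hG : 𝔷 = Ideal.span G) (h : ∀ z ∈ G, ∀ l, (ψ z).coeff l ∈ 𝔷 ^ (1 - w * l))
    (i : ℕ) : ∀ f ∈ 𝔷 ^ i, ∀ l, (ψ f).coeff l ∈ 𝔷 ^ (i - w * l) := by
  have h𝔷 : ∀ f ∈ 𝔷, ∀ l, (ψ f).coeff l ∈ 𝔷 ^ (1 - w * l) := by
    intro f hf
    conv at hf => rw [hG]
    induction hf using Submodule.span_induction with
    | mem z hz => exact h z hz
    | zero => simp
    | add x y _ _ hx hy =>
      intro l
      rw [map_add, Polynomial.coeff_add]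
      exact add_mem (hx l) (hy l)
    | smul a x _ hx =>
      intro l
      rw [smul_eq_mul, map_mul, Polynomial.coeff_mul]
      refine sum_mem fun p hp => Ideal.mul_mem_left _ _ (Ideal.pow_le_pow_right ?_ (hx p.2))
      have := Nat.mul_le_mul_left w (show p.2 ≤ l by have := mem_antidiagonal.1 hp; omega)
      omega
  induction i with
  | zero => simp
  | succ i ih =>
    intro f hf
    rw [pow_succ] at hf
    refine Submodule.mul_induction_on hf (fun x hx y hy l => ?_) fun x y hx hy l => ?_
    · rw [map_mul, Polynomial.coeff_mul]
      refine sum_mem fun p hp => ?_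
      have h1 := Ideal.mul_mem_mul (ih x hx p.1) (h𝔷 y hy p.2)
      rw [← pow_add] at h1
      refine Ideal.pow_le_pow_right ?_ h1
      rw [← mem_antidiagonal.1 hp, mul_add]
      omega
    · rw [map_add, Polynomial.coeff_add]
      exact add_mem (hx l) (hy l)

end Diagonal

section Step

variable {k : Type u} [Field k] {m n : ℕ} [NeZero m] {s : Bool → ℕ} {A : Bool → Finset (Fin n)}
  {b : Bool} {r : ℕ} {j : Fin n}

theorem colMinors_eq_span_range {P : Type*} [CommRing P] (r : ℕ → Fin n → P) (s : ℕ)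
    (B : Finset (Fin n)) :
    colMinors r s B = Ideal.span (Set.range fun c : {c : Fin s → Fin n // ∀ i, c i ∈ B} =>
      colDet r c.1) := by
  refine congrArg Ideal.span (Set.ext fun d => ⟨?_, ?_⟩)
  · rintro ⟨c, hc, rfl⟩
    exact ⟨⟨c, hc⟩, rfl⟩
  · rintro ⟨c, rfl⟩
    exact ⟨c.1, c.2, rfl⟩

theorem pairIdeal_update_sup (hs : s b = r + 1) (hj : j ∈ A b) :
    pairIdeal k m s (Function.update A b ((A b).erase j)) ⊔
      Ideal.span (Set.range fun c : {c : Fin r → Fin n // ∀ i, c i ∈ (A b).erase j} =>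
        colDet (pairRow k m n b) (Fin.snoc c.1 j : Fin (r + 1) → Fin n)) = pairIdeal k m s A := by
  rw [pairIdeal_eq _ _ b, pairIdeal_eq _ _ b, Function.update_self,
    Function.update_of_ne (by simp), hs, colMinors_succ_eq _ _ hj, sup_right_comm]

theorem pairIdeal_update_sup_colMinors (hs : s b = r + 1) (B : Bool → Finset (Fin n)) :
    pairIdeal k m s B ⊔ colMinors (pairRow k m n b) r (B b) =
      pairIdeal k m (Function.update s b r) B := by
  rw [pairIdeal_eq _ _ b, pairIdeal_eq _ _ b, Function.update_self,
    Function.update_of_ne (by simp), hs, sup_right_comm,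
    sup_of_le_right (colMinors_succ_le (pairRow k m n b) r (B b))]

theorem colDet_notMem (h1 : ∀ b, 1 ≤ s b) (hm : ∀ b, s b ≤ m) (hs : s b = r + 1)
    {c : Fin r → Fin n} (hc : ∀ i, c i ∈ (A b).erase j) (hinj : Function.Injective c) :
    colDet (pairRow k m n b) c ∉ pairIdeal k m s (Function.update A b ((A b).erase j)) ∧
      colDet (pairRow k m n b) (Fin.snoc c j : Fin (r + 1) → Fin n) ∉
        pairIdeal k m s (Function.update A b ((A b).erase j)) := by
  obtain ⟨θ, h, h2, h3⟩ := exists_eval_eq_one (k := k) (m := m)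
    (B := Function.update A b ((A b).erase j)) h1 hm hs (j := j) (by simp) (c := c)
    (by simpa using hc) hinj
  exact ⟨fun hmem => one_ne_zero (h2.symm.trans (RingHom.mem_ker.1 (h hmem))),
    fun hmem => one_ne_zero (h3.symm.trans (RingHom.mem_ker.1 (h hmem)))⟩

theorem inf_pow_le_and_projDimLT_step (h1 : ∀ b, 1 ≤ s b) (hm : ∀ b, s b ≤ m) (hs : s b = r + 1)
    (hj : j ∈ A b) {c₀ : Fin r → Fin n} (hc₀ : ∀ i, c₀ i ∈ (A b).erase j)
    (hinj : Function.Injective c₀) {w : ℕ} {y β : MvPolynomial (Bool × Fin m × Fin n) k}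
    {ψ : MvPolynomial (Bool × Fin m × Fin n) k →ₐ[k]
      Polynomial (MvPolynomial (Bool × Fin m × Fin n) k)}
    (hψ : ∀ i ≤ r, ∀ l, i ≠ r ∨ l ≠ j →
      ψ (pairRow k m n b i l) = Polynomial.C (pairRow k m n b i l))
    (hψ' : ∀ i < s (!b), ∀ l ∈ A (!b),
      ψ (pairRow k m n (!b) i l) = Polynomial.C (pairRow k m n (!b) i l))
    (hβ : pairRow k m n b r j = y + β)
    (hψj : ψ (pairRow k m n b r j) = Polynomial.X + Polynomial.C β)
    (hψz : ∀ a : Fin m × Fin n, ∀ l,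
      (ψ (X (true, a) - X (false, a))).coeff l ∈ diagonal k m n ^ (1 - w * l))
    (heval : ∀ p, (ψ p).eval y = p) (hy : y ∈ diagonal k m n ^ w)
    (hLT : ∀ i, pairIdeal k m s (Function.update A b ((A b).erase j)) ⊓ diagonal k m n ^ i ≤
      expectedInf k m s (Function.update A b ((A b).erase j)) i)
    (ha : ∀ i, pairIdeal k m (Function.update s b r) (Function.update A b ((A b).erase j)) ⊓
      diagonal k m n ^ (i - w) ≤ relIdeal (pairIdeal k m s (Function.update A b ((A b).erase j)))
        (colDet (pairRow k m n b) c₀)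
        (colDet (pairRow k m n b) (Fin.snoc c₀ j : Fin (r + 1) → Fin n))
        (expectedInf k m s A i)) :
    (∀ i, pairIdeal k m s A ⊓ diagonal k m n ^ i ≤ expectedInf k m s A i) ∧
    ∀ {R : Type u} [CommRing R] {χ : R →+* reesAlgebra (diagonal k m n)} {D c : ℕ},
      ProjDimLT χ (filtPoly (diagonal k m n) D
        (pairIdeal k m s (Function.update A b ((A b).erase j)))) c →
      ProjDimLT χ (filtPoly (diagonal k m n) (D + w)
        (pairIdeal k m s (Function.update A b ((A b).erase j)))) c →
      ProjDimLT χ (filtPoly (diagonal k m n) (D + w)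
        (pairIdeal k m (Function.update s b r) (Function.update A b ((A b).erase j)))) (c + 1) →
      ProjDimLT χ (filtPoly (diagonal k m n) D (pairIdeal k m s A)) (c + 1) := by
  have hsub : ∀ b', Function.update A b ((A b).erase j) b' ⊆ A b' := by
    intro b'
    rcases eq_or_ne b' b with rfl | hb
    · simpa using erase_subset _ _
    · simp [Function.update_of_ne hb]
  have hQM : pairIdeal k m s (Function.update A b ((A b).erase j)) ⊔
      Ideal.span (Set.range fun c : {c : Fin r → Fin n // ∀ i, c i ∈ (A b).erase j} =>
        colDet (pairRow k m n b) c.1) =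
      pairIdeal k m (Function.update s b r) (Function.update A b ((A b).erase j)) := by
    rw [← pairIdeal_update_sup_colMinors hs, Function.update_self, colMinors_eq_span_range]
  have hψM : ∀ c : Fin r → Fin n, (∀ i, c i ∈ (A b).erase j) →
      ψ (colDet (pairRow k m n b) c) = Polynomial.C (colDet (pairRow k m n b) c) := by
    intro c hc
    rw [map_colDet, map_colDet]
    exact colDet_congr fun i hi l => hψ i hi.le _ (Or.inl hi.ne)
  have hne : ∀ c : {c : Fin r → Fin n // ∀ i, c i ∈ (A b).erase j}, ∀ i, c.1 i ≠ j :=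
    fun c i => ne_of_mem_erase (c.2 i)
  have key := inf_pow_le_and_projDimLT_of_rel (𝔷 := diagonal k m n) (w := w) (y := y)
    (ι := {c : Fin r → Fin n // ∀ i, c i ∈ (A b).erase j})
    (M := fun c => colDet (pairRow k m n b) c.1)
    (g := fun c => colDet (pairRow k m n b) (Fin.snoc c.1 j : Fin (r + 1) → Fin n))
    (γ := fun c => colDet (pairRow k m n b) c.1 * β + snocRem (pairRow k m n b) c.1 j)
    (μ := colDet (pairRow k m n b) c₀)
    (ν := colDet (pairRow k m n b) (Fin.snoc c₀ j : Fin (r + 1) → Fin n))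
    (𝔏 := expectedInf k m s A) (ψ := (ψ : _ →+* _))
    (pairIdeal_isPrime (k := k) (m := m) h1 hm (Function.update A b ((A b).erase j)))
    (colDet_notMem h1 hm hs hc₀ hinj).1 (colDet_notMem h1 hm hs hc₀ hinj).2
    (fun c => colDet_mul_sub_mem h1 hm hs j (by simpa using c.2) (by simpa using hc₀))
    (fun c => hψM c.1 c.2) (fun c => ?_) (fun c => ?_) (fun q hq => ?_)
    (coeff_mem_pow rfl (by rintro _ ⟨a, rfl⟩; exact hψz a)) heval hy
    (expectedInf_le_pow s A) ?_ ?_ ?_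
  · rw [hQM, pairIdeal_update_sup hs hj] at key
    exact key
  · rw [colDet_snoc _ _ (hne c), hβ]
    ring
  · have hrem : ψ (snocRem (pairRow k m n b) c.1 j) =
        Polynomial.C (snocRem (pairRow k m n b) c.1 j) := by
      rw [map_snocRem, map_snocRem]
      exact snocRem_congr hψ
    rw [RingHom.coe_coe, colDet_snoc _ _ (hne c), map_add, map_mul, hψj, hψM _ c.2, hrem]
    simp only [map_add, map_mul]
    ring
  · suffices pairIdeal k m s (Function.update A b ((A b).erase j)) ≤
        ((pairIdeal k m s (Function.update A b ((A b).erase j))).map Polynomial.C).comap ψ from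
      this hq
    rw [pairIdeal_eq _ _ b]
    have hC : ∀ (b' : Bool) (S : ℕ) (c : Fin S → Fin n),
        (∀ i < S, ∀ l, ψ (pairRow k m n b' i (c l)) = Polynomial.C (pairRow k m n b' i (c l))) →
        ψ (colDet (pairRow k m n b') c) = Polynomial.C (colDet (pairRow k m n b') c) := by
      intro b' S c h
      rw [map_colDet, map_colDet]
      exact colDet_congr h
    rw [Function.update_self, Function.update_of_ne (by simp)]
    refine sup_le (colMinors_le.2 fun c hc => ?_) (colMinors_le.2 fun c hc => ?_)
    · rw [Ideal.mem_comap, hC _ _ _ fun i hi l =>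
        hψ i (by omega) _ (Or.inr (ne_of_mem_erase (hc l)))]
      exact Ideal.mem_map_of_mem _ (Ideal.mem_sup_left (colDet_mem hc))
    · rw [Ideal.mem_comap, hC _ _ _ fun i hi l => hψ' i hi _ (hc l)]
      exact Ideal.mem_map_of_mem _ (Ideal.mem_sup_right (colDet_mem hc))
  · rw [pairIdeal_update_sup hs hj]
    exact expectedInf_le_pairIdeal h1 hm A
  · exact fun i => (hLT i).trans (expectedInf_mono hsub i)
  · rw [hQM]
    exact ha

end Step

section Step

variable {k : Type u} [Field k] {m n : ℕ} [NeZero m] {s : Bool → ℕ} {A : Bool → Finset (Fin n)}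
  {b : Bool} {r : ℕ} {j : Fin n}

theorem sub_mem_diffIdeal {S : ℕ} (hS : s b = S) (hs : s (!b) ≤ s b) {c : Fin S → Fin n}
    (hc : ∀ i b', c i ∈ A b') :
    colDet (pairRow k m n b) c - colDet (mixRow k m n b (s (!b))) c ∈ diffIdeal k m s A := by
  subst hS
  exact Ideal.subset_span ⟨b, hs, c, hc, rfl⟩

theorem diffIdeal_le {J : Ideal (MvPolynomial (Bool × Fin m × Fin n) k)}
    (h : ∀ b, s (!b) ≤ s b → ∀ S, s b = S → ∀ c : Fin S → Fin n, (∀ i b', c i ∈ A b') →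
      colDet (pairRow k m n b) c - colDet (mixRow k m n b (s (!b))) c ∈ J) :
    diffIdeal k m s A ≤ J := by
  rw [diffIdeal, Ideal.span_le]
  rintro d ⟨b, hb, c, hc, rfl⟩
  exact h b hb _ rfl c hc

theorem mul_colMinors_le {P : Type*} [CommRing P] {r : ℕ → Fin n → P} {s : ℕ} {B : Finset (Fin n)}
    {I J : Ideal P} (h : ∀ a ∈ I, ∀ c : Fin s → Fin n, (∀ i, c i ∈ B) → a * colDet r c ∈ J) :
    I * colMinors r s B ≤ J := by
  refine Ideal.mul_le.2 fun a ha x hx => ?_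
  suffices colMinors r s B ≤ Submodule.comap (LinearMap.mulLeft P a) J from this hx
  rw [colMinors, Ideal.span_le]
  rintro d ⟨c, hc, rfl⟩
  exact h a ha c hc

theorem exists_mem_diffIdeal_rel (h1 : ∀ b, 1 ≤ s b) (hm : ∀ b, s b ≤ m) (hs : s b = r + 1)
    (hs' : s (!b) ≤ s b) (hj : j ∈ A b) (hj' : j ∈ A (!b)) {c₀ : Fin r → Fin n}
    (hc₀ : ∀ i, c₀ i ∈ (A b).erase j) {c : Fin r → Fin n} (hc : ∀ i, c i ∈ (A b).erase j)
    (hc' : ∀ i, c i ∈ A (!b)) :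
    colDet (pairRow k m n b) c ∈
      relIdeal (pairIdeal k m s (Function.update A b ((A b).erase j)))
        (colDet (pairRow k m n b) c₀)
        (colDet (pairRow k m n b) (Fin.snoc c₀ j : Fin (r + 1) → Fin n))
        (diffIdeal k m s A) := by
  have hsnoc : ∀ b', ∀ i, (Fin.snoc c j : Fin (r + 1) → Fin n) i ∈ A b' := by
    intro b' i
    rcases eq_or_ne b' b with rfl | hb
    · refine Fin.lastCases ?_ (fun i => ?_) i
      · simpa using hj
      · simpa using mem_of_mem_erase (hc i)
    · rw [Bool.eq_not.2 hb]
      refine Fin.lastCases ?_ (fun i => ?_) i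
      · simpa using hj'
      · simpa using hc' i
  refine ⟨_, sub_mem_diffIdeal (b := b) hs hs' (c := (Fin.snoc c j : Fin (r + 1) → Fin n))
    fun i b' => hsnoc b' i, ?_⟩
  have h2 := colDet_mul_sub_mem (k := k) (m := m) h1 hm
    (B := Function.update A b ((A b).erase j)) hs j (c := c) (c' := c₀)
    (by simpa using hc) (by simpa using hc₀)
  have h3 := colDet_mixRow_mem (k := k) h1 hm (A := Function.update A b ((A b).erase j)) b
    (le_refl (s (!b))) (hs'.trans hs.le) (c := (Fin.snoc c j : Fin (r + 1) → Fin n)) fun i => by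
      rw [Function.update_of_ne (by simp)]
      exact hsnoc _ i
  convert sub_mem h2 (Ideal.mul_mem_left _ (colDet (pairRow k m n b) c₀) h3) using 1
  ring

theorem mul_mem_relIdeal {P : Type u} [CommRing P] {Q I 𝔏 𝔏' : Ideal P} {μ ν a e : P}
    (h : I * 𝔏 ≤ 𝔏') (ha : a ∈ I) (he : e ∈ relIdeal Q μ ν 𝔏) : a * e ∈ relIdeal Q μ ν 𝔏' := by
  obtain ⟨f, hf, hef⟩ := he
  refine ⟨a * f, h (Ideal.mul_mem_mul ha hf), ?_⟩
  convert Ideal.mul_mem_left Q a hef using 1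
  ring

theorem mem_relIdeal_pairIdeal (h1 : ∀ b, 1 ≤ s b) (hm : ∀ b, s b ≤ m) (hs : s b = r + 1)
    (hj : j ∈ A b) {c₀ : Fin r → Fin n}
    (hc₀ : ∀ i, c₀ i ∈ (A b).erase j) {c : Fin r → Fin n} (hc : ∀ i, c i ∈ (A b).erase j) :
    colDet (pairRow k m n b) c ∈
      relIdeal (pairIdeal k m s (Function.update A b ((A b).erase j)))
        (colDet (pairRow k m n b) c₀)
        (colDet (pairRow k m n b) (Fin.snoc c₀ j : Fin (r + 1) → Fin n))
        (pairIdeal k m s A) := by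
  refine ⟨colDet (pairRow k m n b) (Fin.snoc c j : Fin (r + 1) → Fin n), ?_,
    colDet_mul_sub_mem (k := k) (m := m) h1 hm (B := Function.update A b ((A b).erase j)) hs j
      (by simpa using hc) (by simpa using hc₀)⟩
  rw [← pairIdeal_update_sup hs hj]
  exact Ideal.mem_sup_right (Ideal.subset_span ⟨⟨c, hc⟩, rfl⟩)

/-- The expected intersections for smaller data are related to those for `s` and `A`. -/
theorem expectedInf_le_relIdeal (hs : s b = r + 1) {w i : ℕ}
    {Q 𝔏 : Ideal (MvPolynomial (Bool × Fin m × Fin n) k)}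
    {μ ν : MvPolynomial (Bool × Fin m × Fin n) k}
    (hQ : Q = pairIdeal k m s (Function.update A b ((A b).erase j)))
    (h : diagonal k m n ^ (i - w) * colMinors (pairRow k m n b) r ((A b).erase j) ≤
      relIdeal Q μ ν 𝔏)
    (h' : diagonal k m n ^ (i - w - 1) *
        diffIdeal k m (Function.update s b r) (Function.update A b ((A b).erase j)) ≤
      relIdeal Q μ ν 𝔏) :
    expectedInf k m (Function.update s b r) (Function.update A b ((A b).erase j)) (i - w) ≤
      relIdeal Q μ ν 𝔏 := by
  refine sup_le ?_ h'
  rw [← pairIdeal_update_sup_colMinors hs, ← hQ, Function.update_self, Ideal.mul_sup]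
  exact sup_le (Ideal.mul_le_right.trans (le_relIdeal _)) h

theorem diffIdeal_update_le (h1 : ∀ b, 1 ≤ s b) (hm : ∀ b, s b ≤ m) (hs : s b = r + 1)
    (hs' : s (!b) = r + 1) :
    diffIdeal k m (Function.update s b r) (Function.update A b ((A b).erase j)) ≤
      pairIdeal k m s (Function.update A b ((A b).erase j)) ⊔
        diagonal k m n * colMinors (pairRow k m n b) r ((A b).erase j) := by
  refine diffIdeal_le fun b' hb' S hS c hc => ?_
  rcases eq_or_ne b' b with rfl | hb
  · rw [Function.update_self, Function.update_of_ne (by simp)] at hb'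
    omega
  · obtain rfl := Bool.eq_not.2 hb
    rw [Bool.not_not, Function.update_self]
    rw [Function.update_of_ne (by simp), hs'] at hS
    subst hS
    have h2 := colDet_sub_mem_mul (J := diagonal k m n) (r := pairRow k m n b)
      (r' := mixRow k m n (!b) r) (B := (A b).erase j) (c := c)
      (fun i => by simpa using hc i b)
      (fun i hi l => by rw [mixRow, if_pos hi, Bool.not_not]) fun l => by
        rw [mixRow, if_neg (lt_irrefl _)]
        exact pairRow_sub_mem b _ _
    have h3 := colDet_mem_pairIdeal (k := k) h1 hm (B := Function.update A b ((A b).erase j)) b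
      (fun _ _ => rfl) hs.le fun i => hc i b
    have h4 := colDet_mem_pairIdeal (k := k) h1 hm (B := Function.update A b ((A b).erase j)) (!b)
      (fun _ _ => rfl) hs'.le fun i => hc i (!b)
    convert add_mem (Ideal.mem_sup_left (sub_mem h4 h3)) (Ideal.mem_sup_right h2) using 1
    ring

end Step

section Step

variable {k : Type u} [Field k] {m n : ℕ}

variable (k) in
/-- Rewrite a polynomial in terms of one of the variables and of the differences of variables. -/
noncomputable def sepDiag (b : Bool) (a : Fin m × Fin n) :
    MvPolynomial (Bool × Fin m × Fin n) k →ₐ[k]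
      Polynomial (MvPolynomial (Bool × Fin m × Fin n) k) :=
  aeval fun v =>
    if v.2 = a then Polynomial.X + Polynomial.C (X v - X (b, a)) else Polynomial.C (X v)

theorem eval_sepDiag (b : Bool) (a : Fin m × Fin n)
    (p : MvPolynomial (Bool × Fin m × Fin n) k) : (sepDiag k b a p).eval (X (b, a)) = p := by
  have : (Polynomial.evalRingHom (X (b, a))).comp (sepDiag k b a).toRingHom =
      RingHom.id (MvPolynomial (Bool × Fin m × Fin n) k) := by
    refine MvPolynomial.ringHom_ext (fun a => ?_) fun v => ?_
    · simp [Polynomial.algebraMap_apply, MvPolynomial.algebraMap_eq]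
    · by_cases h : v.2 = a <;> simp [h, sepDiag]
  exact RingHom.congr_fun this p

theorem sepDiag_sub (b : Bool) (a a' : Fin m × Fin n) :
    sepDiag k b a (X (true, a') - X (false, a')) = Polynomial.C (X (true, a') - X (false, a')) := by
  by_cases h : a' = a <;> simp [h, sepDiag]

variable (k) in
/-- Rewrite a polynomial in terms of one of the differences of variables. -/
noncomputable def sepDiff (b : Bool) (a : Fin m × Fin n) :
    MvPolynomial (Bool × Fin m × Fin n) k →ₐ[k]
      Polynomial (MvPolynomial (Bool × Fin m × Fin n) k) :=
  aeval fun v => if v = (b, a) then Polynomial.X + Polynomial.C (X (!b, a)) else Polynomial.C (X v)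

theorem eval_sepDiff (b : Bool) (a : Fin m × Fin n)
    (p : MvPolynomial (Bool × Fin m × Fin n) k) :
    (sepDiff k b a p).eval (X (b, a) - X (!b, a)) = p := by
  have : (Polynomial.evalRingHom (X (b, a) - X (!b, a))).comp (sepDiff k b a).toRingHom =
      RingHom.id (MvPolynomial (Bool × Fin m × Fin n) k) := by
    refine MvPolynomial.ringHom_ext (fun a => ?_) fun v => ?_
    · simp [Polynomial.algebraMap_apply, MvPolynomial.algebraMap_eq]
    · by_cases h : v = (b, a) <;> simp [h, sepDiff]
  exact RingHom.congr_fun this p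

theorem coeff_sepDiff_sub_mem (b : Bool) (a a' : Fin m × Fin n) (l : ℕ) :
    (sepDiff k b a (X (true, a') - X (false, a'))).coeff l ∈ diagonal k m n ^ (1 - 1 * l) := by
  rcases Nat.eq_zero_or_pos l with rfl | hl
  · have h : X (true, a') - X (false, a') ∈ diagonal k m n := Ideal.subset_span ⟨a', rfl⟩
    by_cases ha : a' = a
    · subst ha
      cases b <;> simp [sepDiff]
    · simpa [sepDiff, ha] using h
  · simp [Nat.sub_eq_zero_of_le (show 1 ≤ l from hl)]

variable [NeZero m] {s : Bool → ℕ} {A : Bool → Finset (Fin n)} {b : Bool} {r : ℕ} {j : Fin n}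

/-- The expected bound for projective dimensions, shifted by one. -/
def pdBound (N : ℕ) (s : Bool → ℕ) (A : Bool → Finset (Fin n)) : ℕ :=
  N + (#(A true) + 1 - s true) + (#(A false) + 1 - s false) - 1

theorem pdBound_eq (N : ℕ) (s : Bool → ℕ) (A : Bool → Finset (Fin n)) (b : Bool) :
    pdBound N s A = N + (#(A b) + 1 - s b) + (#(A (!b)) + 1 - s (!b)) - 1 := by
  cases b
  · simp only [pdBound, Bool.not_false]
    omega
  · rfl

/-- The expected range of exponents where the bound for projective dimensions holds. -/
def pdShift (s : Bool → ℕ) (A : Bool → Finset (Fin n)) : ℕ :=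
  #(A true ∩ A false) + 1 - max (s true) (s false)

theorem pdShift_eq (s : Bool → ℕ) (A : Bool → Finset (Fin n)) (b : Bool) :
    pdShift s A = #(A b ∩ A (!b)) + 1 - max (s b) (s (!b)) := by
  cases b
  · rw [pdShift, inter_comm, max_comm]
    rfl
  · rfl

/-- The bounds for the pair of determinantal ideals given by `s` and `A`. -/
def HasBounds {R : Type u} [CommRing R] (χ : R →+* reesAlgebra (diagonal k m n)) (N : ℕ)
    (s : Bool → ℕ) (A : Bool → Finset (Fin n)) : Prop :=
  (∀ i, pairIdeal k m s A ⊓ diagonal k m n ^ i ≤ expectedInf k m s A i) ∧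
    ∀ D ≤ N, D + pdShift s A ≤ N →
      ProjDimLT χ (filtPoly (diagonal k m n) D (pairIdeal k m s A)) (pdBound N s A)

theorem exists_injective_of_card_le {B : Finset (Fin n)} (h : r ≤ #B) :
    ∃ c : Fin r → Fin n, (∀ i, c i ∈ B) ∧ Function.Injective c := by
  refine ⟨fun i => B.equivFin.symm (Fin.castLE h i), fun i => Subtype.prop _, fun i i' hi => ?_⟩
  exact Fin.castLE_injective h (B.equivFin.symm.injective (Subtype.ext hi))

theorem HasBounds.step_zero {R : Type u} [CommRing R] {χ : R →+* reesAlgebra (diagonal k m n)}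
    {N : ℕ} (hN : 1 ≤ N) (h1 : ∀ b, 1 ≤ s b) (hm : ∀ b, s b ≤ m) (hs : s b = r + 1) (hj : j ∈ A b)
    (hr : r + 1 ≤ #(A b)) (hs' : s (!b) ≤ r + 1)
    (hj' : j ∈ A (!b) → s (!b) ≤ r) (hj'' : s (!b) ≤ r → ∀ l ∈ A b, l ∈ A (!b) → j ∈ A (!b))
    (h : HasBounds χ N s (Function.update A b ((A b).erase j)))
    (h' : HasBounds χ N (Function.update s b r) (Function.update A b ((A b).erase j))) :
    HasBounds χ N s A := by
  have hcard := card_erase_add_one hj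
  obtain ⟨c₀, hc₀, hinj⟩ := exists_injective_of_card_le (r := r) (B := (A b).erase j) (by omega)
  have hrm : r < m := by have := hm b; omega
  have hx : ∀ b' i l, i < m → (i ≠ r ∨ l ≠ j) → sepDiag k b (Fin.ofNat m r, j)
      (pairRow k m n b' i l) = Polynomial.C (pairRow k m n b' i l) := by
    intro b' i l hi h
    rw [pairRow, sepDiag, aeval_X, if_neg]
    rw [Prod.mk.injEq, ofNat_inj hi hrm]
    tauto
  have hP : ∀ i, diagonal k m n ^ (i - 0) * colMinors (pairRow k m n b) r ((A b).erase j) ≤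
      relIdeal (pairIdeal k m s (Function.update A b ((A b).erase j)))
        (colDet (pairRow k m n b) c₀)
        (colDet (pairRow k m n b) (Fin.snoc c₀ j : Fin (r + 1) → Fin n))
        (expectedInf k m s A i) := fun i =>
    mul_colMinors_le fun a ha c hc => mul_mem_relIdeal le_sup_left ha
      (mem_relIdeal_pairIdeal h1 hm hs hj hc₀ hc)
  have hother : ∀ i < s (!b), ∀ l ∈ A (!b), i ≠ r ∨ l ≠ j := by
    intro i hi l hl
    by_contra! hcon
    obtain ⟨rfl, rfl⟩ := hcon
    have := hj' hl
    omega
  have hdiff : ∀ (a : Fin m × Fin n) l, (sepDiag k b (Fin.ofNat m r, j)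
      (X (true, a) - X (false, a))).coeff l ∈ diagonal k m n ^ (1 - 0 * l) := by
    intro a l
    rw [sepDiag_sub, zero_mul, Polynomial.coeff_C]
    have h : X (true, a) - X (false, a) ∈ diagonal k m n := Ideal.subset_span ⟨a, rfl⟩
    split_ifs
    · simpa using h
    · exact zero_mem _
  have hrel : ∀ i, expectedInf k m (Function.update s b r) (Function.update A b ((A b).erase j))
      (i - 0) ≤ relIdeal (pairIdeal k m s (Function.update A b ((A b).erase j)))
        (colDet (pairRow k m n b) c₀)
        (colDet (pairRow k m n b) (Fin.snoc c₀ j : Fin (r + 1) → Fin n))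
        (expectedInf k m s A i) := by
    intro i
    refine expectedInf_le_relIdeal hs rfl (hP i) ?_
    rcases Nat.lt_or_ge r (s (!b)) with hlt | hge
    · refine (Ideal.mul_mono_right (diffIdeal_update_le h1 hm hs (by omega))).trans ?_
      rw [Ideal.mul_sup, ← mul_assoc, ← pow_succ]
      refine sup_le (Ideal.mul_le_right.trans (le_relIdeal _)) ((Ideal.mul_mono_left
        (Ideal.pow_le_pow_right ?_)).trans (hP i))
      omega
    · refine Ideal.mul_le.2 fun a ha x hx => mul_mem_relIdeal le_sup_right ha ?_
      have hr0 : 0 < r := (h1 (!b)).trans hge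
      have hrel : ∀ c : Fin r → Fin n, (∀ i b', c i ∈ Function.update A b ((A b).erase j) b') →
          colDet (pairRow k m n b) c ∈
            relIdeal (pairIdeal k m s (Function.update A b ((A b).erase j)))
              (colDet (pairRow k m n b) c₀)
              (colDet (pairRow k m n b) (Fin.snoc c₀ j : Fin (r + 1) → Fin n))
              (diffIdeal k m s A) := fun c hc => by
        have hcb : ∀ i, c i ∈ (A b).erase j := fun i => by simpa using hc i b
        have hcb' : ∀ i, c i ∈ A (!b) := fun i => by simpa using hc i (!b)
        exact exists_mem_diffIdeal_rel h1 hm hs (by omega) hj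
          (hj'' hge _ (mem_of_mem_erase (hcb ⟨0, hr0⟩)) (hcb' _)) hc₀ hcb hcb'
      revert x
      refine diffIdeal_le fun b' hb' S hS c hc => ?_
      rcases eq_or_ne b' b with rfl | hb
      · rw [Function.update_self] at hS
        subst hS
        rw [Function.update_of_ne (by simp)]
        exact sub_mem (hrel c hc) (le_relIdeal _ (colDet_mixRow_mem h1 hm b' le_rfl hge
          fun i => hc i _))
      · obtain rfl := Bool.eq_not.2 hb
        rw [Bool.not_not, Function.update_self] at hb' ⊢
        rw [Function.update_of_ne (by simp)] at hb' hS
        obtain rfl : S = r := by omega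
        rw [colDet_congr (r := mixRow k m n (!b) S) (r' := pairRow k m n b) fun i hi l => by
          rw [mixRow, if_pos hi, Bool.not_not]]
        exact sub_mem (le_relIdeal _ (colDet_mem_pairIdeal h1 hm (!b) (fun _ _ => rfl) hS.le
          fun i => hc i _)) (hrel c hc)
  obtain ⟨h2, h3⟩ := inf_pow_le_and_projDimLT_step (k := k) (w := 0) (β := 0)
    (y := pairRow k m n b r j) h1 hm hs hj hc₀ hinj
    (ψ := sepDiag k b (Fin.ofNat m r, j))
    (fun i hi l => hx b i l (by omega))
    (fun i hi l hl => hx _ i l (hi.trans_le (hm _)) (hother i hi l hl)) (by simp)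
    (by simp [pairRow, sepDiag])
    hdiff (eval_sepDiag b _) (by simp) h.1 fun i => (h'.1 (i - 0)).trans (hrel i)
  refine ⟨h2, fun D hD hDN => ?_⟩
  have hb : (!b) ≠ b := by simp
  have e1 : pdBound N s (Function.update A b ((A b).erase j)) + 1 = pdBound N s A := by
    simp only [pdBound_eq _ _ _ b, Function.update_self, Function.update_of_ne hb]
    omega
  have e2 : pdBound N (Function.update s b r) (Function.update A b ((A b).erase j)) =
      pdBound N s A := by
    simp only [pdBound_eq _ _ _ b, Function.update_self, Function.update_of_ne hb]
    omega
  have hcap : #((A b).erase j ∩ A (!b)) ≤ #(A b ∩ A (!b)) :=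
    card_le_card (inter_subset_inter_right (erase_subset _ _))
  have e3 : pdShift s (Function.update A b ((A b).erase j)) ≤ pdShift s A := by
    simp only [pdShift_eq _ _ b, Function.update_self, Function.update_of_ne hb]
    omega
  have e4 : pdShift (Function.update s b r) (Function.update A b ((A b).erase j)) ≤
      pdShift s A := by
    simp only [pdShift_eq _ _ b, Function.update_self, Function.update_of_ne hb]
    rcases Nat.lt_or_ge r (s (!b)) with hlt | hge
    · omega
    · have h0 := h1 (!b)
      rcases (A b ∩ A (!b)).eq_empty_or_nonempty with he | ⟨l, hl⟩
      · rw [he, card_empty] at hcap ⊢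
        omega
      · rw [mem_inter] at hl
        have hjj := hj'' hge l hl.1 hl.2
        rw [erase_inter]
        have := card_erase_add_one (mem_inter.2 ⟨hj, hjj⟩)
        omega
  have h4 := h.2 D hD (by omega)
  rw [← e1]
  refine h3 h4 h4 ?_
  rw [e1, ← e2]
  exact h'.2 D hD (by omega)

theorem HasBounds.step_one {R : Type u} [CommRing R] {χ : R →+* reesAlgebra (diagonal k m n)}
    {N : ℕ} (hN : 1 ≤ N) (h1 : ∀ b, 1 ≤ s b) (hm : ∀ b, s b ≤ m) (hs : s b = r + 1)
    (hs' : s (!b) = r + 1) (hA : A (!b) = A b) (hj : j ∈ A b) (hr : r + 1 ≤ #(A b))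
    (h : HasBounds χ N s (Function.update A b ((A b).erase j)))
    (h' : HasBounds χ N (Function.update s b r) (Function.update A b ((A b).erase j))) :
    HasBounds χ N s A := by
  have hcard := card_erase_add_one hj
  obtain ⟨c₀, hc₀, hinj⟩ := exists_injective_of_card_le (r := r) (B := (A b).erase j) (by omega)
  have hrm : r < m := by have := hm b; omega
  have hx : ∀ b' i l, i < m → (b' ≠ b ∨ i ≠ r ∨ l ≠ j) → sepDiff k b (Fin.ofNat m r, j)
      (pairRow k m n b' i l) = Polynomial.C (pairRow k m n b' i l) := by
    intro b' i l hi h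
    rw [pairRow, sepDiff, aeval_X, if_neg]
    rw [Prod.mk.injEq, Prod.mk.injEq, ofNat_inj hi hrm]
    tauto
  have hP : ∀ i, diagonal k m n ^ (i - 1) * colMinors (pairRow k m n b) r ((A b).erase j) ≤
      relIdeal (pairIdeal k m s (Function.update A b ((A b).erase j)))
        (colDet (pairRow k m n b) c₀)
        (colDet (pairRow k m n b) (Fin.snoc c₀ j : Fin (r + 1) → Fin n))
        (expectedInf k m s A i) := fun i =>
    mul_colMinors_le fun a ha c hc => mul_mem_relIdeal le_sup_right ha
      (exists_mem_diffIdeal_rel h1 hm hs (by omega) hj (hA ▸ hj) hc₀ hc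
        fun i => hA ▸ mem_of_mem_erase (hc i))
  have hrel : ∀ i, expectedInf k m (Function.update s b r) (Function.update A b ((A b).erase j))
      (i - 1) ≤ relIdeal (pairIdeal k m s (Function.update A b ((A b).erase j)))
        (colDet (pairRow k m n b) c₀)
        (colDet (pairRow k m n b) (Fin.snoc c₀ j : Fin (r + 1) → Fin n))
        (expectedInf k m s A i) := by
    intro i
    refine expectedInf_le_relIdeal hs rfl (hP i) ?_
    refine (Ideal.mul_mono_right (diffIdeal_update_le h1 hm hs hs')).trans ?_
    rw [Ideal.mul_sup, ← mul_assoc, ← pow_succ]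
    refine sup_le (Ideal.mul_le_right.trans (le_relIdeal _)) ((Ideal.mul_mono_left
      (Ideal.pow_le_pow_right ?_)).trans (hP i))
    omega
  have hy : X (b, Fin.ofNat m r, j) - X (!b, Fin.ofNat m r, j) ∈ diagonal k m n := by
    have := neg_mem (pairRow_sub_mem (k := k) (m := m) (!b) r j)
    simpa [pairRow] using this
  obtain ⟨h2, h3⟩ := inf_pow_le_and_projDimLT_step (k := k) (w := 1)
    (y := X (b, Fin.ofNat m r, j) - X (!b, Fin.ofNat m r, j)) (β := X (!b, Fin.ofNat m r, j))
    h1 hm hs hj hc₀ hinj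
    (ψ := sepDiff k b (Fin.ofNat m r, j))
    (fun i hi l hil => hx b i l (by omega) (Or.inr hil))
    (fun i hi l hl => hx _ i l (hi.trans_le (hm _)) (Or.inl (by simp))) (by simp [pairRow])
    (by simp [pairRow, sepDiff])
    (fun a l => coeff_sepDiff_sub_mem b _ a l) (eval_sepDiff b _) (by simpa using hy) h.1
    fun i => (h'.1 (i - 1)).trans (hrel i)
  refine ⟨h2, fun D hD hDN => ?_⟩
  have hb : (!b) ≠ b := by simp
  have e1 : pdBound N s (Function.update A b ((A b).erase j)) + 1 = pdBound N s A := by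
    simp only [pdBound_eq _ _ _ b, Function.update_self, Function.update_of_ne hb]
    omega
  have e2 : pdBound N (Function.update s b r) (Function.update A b ((A b).erase j)) =
      pdBound N s A := by
    simp only [pdBound_eq _ _ _ b, Function.update_self, Function.update_of_ne hb]
    omega
  have e3 : pdShift s (Function.update A b ((A b).erase j)) + 1 = pdShift s A := by
    simp only [pdShift_eq _ _ b, Function.update_self, Function.update_of_ne hb, hA]
    rw [inter_eq_left.2 (erase_subset _ _), inter_self]
    omega
  have e4 : pdShift (Function.update s b r) (Function.update A b ((A b).erase j)) + 1 =
      pdShift s A := by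
    simp only [pdShift_eq _ _ b, Function.update_self, Function.update_of_ne hb, hA]
    rw [inter_eq_left.2 (erase_subset _ _), inter_self]
    omega
  rw [← e1]
  refine h3 (h.2 D hD (by omega)) (h.2 (D + 1) (by omega) (by omega)) ?_
  rw [e1, ← e2]
  exact h'.2 (D + 1) (by omega) (by omega)

end Step

section Bounds

variable {k : Type u} [Field k] {m n : ℕ} [NeZero m] {s : Bool → ℕ} {A : Bool → Finset (Fin n)}
  {b : Bool} {R : Type u} [CommRing R] {χ : R →+* reesAlgebra (diagonal k m n)} {N : ℕ}

theorem HasBounds.of_eq_zero (hχ : ReesPresentation (diagonal k m n) N χ) (hb : s b = 0) :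
    HasBounds χ N s A := by
  have h : pairIdeal k m s A = ⊤ := by
    rw [pairIdeal_eq _ _ b, hb, colMinors_zero, top_sup_eq]
  refine ⟨fun i => ?_, fun D hD _ => ?_⟩
  · rw [expectedInf, h, Ideal.mul_top, top_inf_eq]
    exact le_sup_left
  · have := hχ.projDim D
    rw [if_pos hD] at this
    rw [h]
    refine this.mono ?_
    rw [pdBound_eq _ _ _ b]
    omega

theorem pairIdeal_eq_bot (h : ∀ b, #(A b) < s b) : pairIdeal k m s A = ⊥ := by
  rw [pairIdeal_eq _ _ true, colMinors_of_card_lt _ (h _), colMinors_of_card_lt _ (h _), sup_idem]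

theorem HasBounds.of_card_lt (h : ∀ b, #(A b) < s b) : HasBounds χ N s A := by
  have hbot := pairIdeal_eq_bot (k := k) (m := m) h
  refine ⟨fun i => ?_, fun D _ _ => ?_⟩
  · rw [hbot, bot_inf_eq]
    exact bot_le
  · rw [hbot]
    have : Subsingleton (filtPoly (diagonal k m n) D ⊥) :=
      ⟨fun p q => Subtype.ext <| Polynomial.ext fun i =>
        ((Ideal.mem_bot.1 (p.2 i).2).trans (Ideal.mem_bot.1 (q.2 i).2).symm)⟩
    exact ProjDimLT.of_subsingleton _

theorem HasBounds.of_update (h1 : ∀ b, 1 ≤ s b) (hb : #(A b) < s b)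
    (h : HasBounds χ N (Function.update s b 1) (Function.update A b ∅)) : HasBounds χ N s A := by
  have hb' : (!b) ≠ b := by simp
  have hP : pairIdeal k m (Function.update s b 1) (Function.update A b ∅) = pairIdeal k m s A := by
    rw [pairIdeal_eq _ _ b, pairIdeal_eq _ _ b, colMinors_of_card_lt _ hb,
      colMinors_of_card_lt _ (by simp)]
    simp only [Function.update_of_ne hb']
  have hd : diffIdeal k m (Function.update s b 1) (Function.update A b ∅) = ⊥ := by
    rw [eq_bot_iff]
    refine diffIdeal_le fun b' _ S hS c hc => ?_
    have hS0 : 0 < S := by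
      rcases eq_or_ne b' b with rfl | hne
      · rw [← hS, Function.update_self]
        exact one_pos
      · rw [← hS, Function.update_of_ne hne]
        exact h1 b'
    simpa using hc ⟨0, hS0⟩ b
  have e1 : pdBound N (Function.update s b 1) (Function.update A b ∅) = pdBound N s A := by
    simp only [pdBound_eq _ _ _ b, Function.update_self, Function.update_of_ne hb', card_empty]
    omega
  have e2 : pdShift (Function.update s b 1) (Function.update A b ∅) ≤ pdShift s A := by
    simp only [pdShift_eq _ _ b, Function.update_self, Function.update_of_ne hb', empty_inter,
      card_empty]
    omega
  refine ⟨fun i => ?_, fun D hD hDN => ?_⟩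
  · rw [← hP]
    refine (h.1 i).trans ?_
    rw [expectedInf, hd, Ideal.mul_bot, sup_bot_eq, hP]
    exact le_sup_left
  · rw [← hP, ← e1]
    exact h.2 D hD (by omega)

theorem hasBounds (hN : 1 ≤ N) (hχ : ReesPresentation (diagonal k m n) N χ) (e : ℕ) :
    ∀ (s : Bool → ℕ) (A : Bool → Finset (Fin n)), (∀ b, s b ≤ m) →
      #(A true) + #(A false) + s true + s false = e → HasBounds χ N s A := by
  induction e using Nat.strong_induction_on with
  | _ e ih =>
    intro s A hm he
    have hsum : ∀ b, #(A b) + #(A (!b)) + s b + s (!b) = e := by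
      rintro (_ | _)
      · rw [Bool.not_false]
        omega
      · exact he
    have ih' : ∀ b (s' : ℕ) (A' : Finset (Fin n)), s' ≤ s b → #A' + s' < #(A b) + s b →
        HasBounds χ N (Function.update s b s') (Function.update A b A') := by
      intro b s' A' hs' hlt
      refine ih _ ?_ _ _ (fun b' => ?_) rfl
      · have := hsum b
        cases b <;> simp_all <;> omega
      · rcases eq_or_ne b' b with rfl | hb
        · rw [Function.update_self]
          exact hs'.trans (hm _)
        · rw [Function.update_of_ne hb]
          exact hm _
    by_cases h1 : ∀ b, 1 ≤ s b
    swap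
    · push Not at h1
      obtain ⟨b, hb⟩ := h1
      exact HasBounds.of_eq_zero hχ (b := b) (by omega)
    by_cases h2 : ∀ b, #(A b) < s b
    · exact HasBounds.of_card_lt h2
    by_cases h3 : ∃ b, #(A b) < s b ∧ 2 ≤ s b
    · obtain ⟨b, hb, hb2⟩ := h3
      refine HasBounds.of_update h1 hb (ih' b 1 ∅ (h1 b) ?_)
      rw [card_empty]
      omega
    push Not at h3
    have ihs : ∀ {b r j}, s b = r + 1 → j ∈ A b →
        HasBounds χ N s (Function.update A b ((A b).erase j)) ∧
        HasBounds χ N (Function.update s b r) (Function.update A b ((A b).erase j)) := by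
      intro b r j hs hj
      have := card_erase_add_one hj
      refine ⟨?_, ih' b r _ (by omega) (by omega)⟩
      have := ih' b (s b) ((A b).erase j) le_rfl (by omega)
      rwa [Function.update_eq_self] at this
    by_cases h4 : ∃ b, s (!b) < s b
    · obtain ⟨b, hb⟩ := h4
      have hcard : s b ≤ #(A b) := by
        by_contra! hlt
        have := h3 b hlt
        have := h1 (!b)
        omega
      obtain ⟨r, hr⟩ : ∃ r, s b = r + 1 := ⟨s b - 1, by omega⟩
      obtain ⟨j, hj, hj'⟩ : ∃ j ∈ A b, ∀ l ∈ A b, l ∈ A (!b) → j ∈ A (!b) := by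
        by_cases h : ∃ j ∈ A b, j ∈ A (!b)
        · obtain ⟨j, hj, hj'⟩ := h
          exact ⟨j, hj, fun _ _ _ => hj'⟩
        · push Not at h
          obtain ⟨j, hj⟩ := card_pos.1 (show 0 < #(A b) by omega)
          exact ⟨j, hj, fun l hl hl' => absurd hl' (h l hl)⟩
      exact HasBounds.step_zero hN h1 hm hr hj (by omega) (by omega) (fun _ => by omega)
        (fun _ => hj') (ihs hr hj).1 (ihs hr hj).2
    push Not at h4
    have hs : ∀ b, s (!b) = s b := by
      intro b
      have h5 := h4 b
      have h6 := h4 (!b)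
      rw [Bool.not_not] at h6
      omega
    have hcard : ∀ b j, j ∈ A b → s b ≤ #(A b) := by
      intro b j hj
      by_contra! hlt
      have := h3 b hlt
      have := card_pos.2 ⟨j, hj⟩
      omega
    by_cases h5 : ∃ b, ∃ j ∈ A b, j ∉ A (!b)
    · obtain ⟨b, j, hj, hj'⟩ := h5
      obtain ⟨r, hr⟩ : ∃ r, s b = r + 1 := ⟨s b - 1, by have := h1 b; omega⟩
      have := hs b
      have := hcard b j hj
      exact HasBounds.step_zero hN h1 hm hr hj (by omega) (by omega) (fun h => absurd h hj')
        (fun h => by omega) (ihs hr hj).1 (ihs hr hj).2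
    push Not at h5
    have hA : A (!true) = A true := subset_antisymm (fun j hj => by simpa using h5 _ j hj)
      fun j hj => h5 true j hj
    have hne : (A true).Nonempty := by
      by_contra! h
      refine h2 fun b => ?_
      have : A b = ∅ := by
        cases b
        · exact hA.trans h
        · exact h
      rw [this, card_empty]
      exact h1 b
    obtain ⟨j, hj⟩ := hne
    obtain ⟨r, hr⟩ : ∃ r, s true = r + 1 := ⟨s true - 1, by have := h1 true; omega⟩
    have := hcard true j hj
    exact HasBounds.step_one hN h1 hm hr ((hs true).trans hr) hA hj (by omega)
      (ihs hr hj).1 (ihs hr hj).2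

end Bounds

section Height

variable {k : Type u} [Field k] {m n : ℕ} [NeZero m] {s : Bool → ℕ} {A : Bool → Finset (Fin n)}
  {b : Bool} {R : Type u} [CommRing R] {χ : R →+* reesAlgebra (diagonal k m n)} {N : ℕ}

/-- The ideal of a presentation of the image of the Rees algebra of the diagonal ideal modulo
`pairIdeal`. -/
noncomputable def pairKer (χ : R →+* reesAlgebra (diagonal k m n)) (s : Bool → ℕ)
    (A : Bool → Finset (Fin n)) : Ideal R :=
  ((pairIdeal k m s A).map Polynomial.C).comap ((reesAlgebra (diagonal k m n)).val.toRingHom.comp χ)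

theorem mem_pairKer {x : R} :
    x ∈ pairKer χ s A ↔ ∀ i, (χ x : Polynomial _).coeff i ∈ pairIdeal k m s A :=
  Ideal.mem_map_C_iff

theorem pairKer_isPrime (χ : R →+* reesAlgebra (diagonal k m n)) (h1 : ∀ b, 1 ≤ s b)
    (hm : ∀ b, s b ≤ m) (A : Bool → Finset (Fin n)) : (pairKer χ s A).IsPrime := by
  have := pairIdeal_isPrime (k := k) h1 hm A
  have := Ideal.isPrime_map_C_of_isPrime (P := pairIdeal k m s A)
  exact Ideal.comap_isPrime _ _

theorem le_height_pairKer (hN : 1 ≤ N) (hχ : ReesPresentation (diagonal k m n) N χ)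
    (h1 : ∀ b, 1 ≤ s b) (hm : ∀ b, s b ≤ m) (e : ℕ) : ∀ A : Bool → Finset (Fin n),
      #(A true) + #(A false) = e → (pdBound N s A : ℕ∞) ≤ (pairKer χ s A).height := by
  induction e using Nat.strong_induction_on with
  | _ e ih =>
    intro A he
    by_cases hcard : ∀ b, #(A b) < s b
    · refine le_trans ?_ (hχ.le_height.trans (Ideal.height_mono fun x hx => ?_))
      · rw [Nat.cast_le, pdBound]
        have := hcard true
        have := hcard false
        omega
      · rw [mem_pairKer, RingHom.mem_ker.1 hx]
        simp
    push Not at hcard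
    obtain ⟨b, hb⟩ := hcard
    obtain ⟨r, hr⟩ : ∃ r, s b = r + 1 := ⟨s b - 1, by have := h1 b; omega⟩
    obtain ⟨j, hj⟩ := card_pos.1 (show 0 < #(A b) by omega)
    have hcard := card_erase_add_one hj
    obtain ⟨c₀, hc₀, hinj⟩ := exists_injective_of_card_le (r := r) (B := (A b).erase j) (by omega)
    have hb' : (!b) ≠ b := by simp
    have hbound : pdBound N s (Function.update A b ((A b).erase j)) + 1 = pdBound N s A := by
      simp only [pdBound_eq _ _ _ b, Function.update_self, Function.update_of_ne hb']
      omega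
    have hle := ih _ (by cases b <;> simp_all <;> omega) (Function.update A b ((A b).erase j)) rfl
    have := pairKer_isPrime χ h1 hm A
    have := pairKer_isPrime χ h1 hm (Function.update A b ((A b).erase j))
    rw [← hbound, Nat.cast_add, Nat.cast_one]
    refine (add_le_add_left hle 1).trans
      (Ideal.height_add_one_le_of_lt_of_isPrime (lt_of_le_of_ne (fun x hx => ?_) fun heq => ?_))
    · rw [mem_pairKer] at hx ⊢
      rw [← pairIdeal_update_sup hr hj]
      exact fun i => Ideal.mem_sup_left (hx i)
    · obtain ⟨x, hx⟩ := hχ.surjective (algebraMap _ _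
        (colDet (pairRow k m n b) (Fin.snoc c₀ j : Fin (r + 1) → Fin n)))
      have hx0 : (χ x : Polynomial (MvPolynomial (Bool × Fin m × Fin n) k)) =
          Polynomial.C (colDet (pairRow k m n b) (Fin.snoc c₀ j : Fin (r + 1) → Fin n)) := by
        rw [hx]
        rfl
      have hmem : x ∈ pairKer χ s A := by
        rw [mem_pairKer, hx0, ← pairIdeal_update_sup hr hj]
        intro i
        rw [Polynomial.coeff_C]
        split_ifs
        · exact Ideal.mem_sup_right (Ideal.subset_span ⟨⟨c₀, hc₀⟩, rfl⟩)
        · exact zero_mem _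
      rw [← heq, mem_pairKer, hx0] at hmem
      exact (colDet_notMem h1 hm hr hc₀ hinj).2 (by simpa using hmem 0)

end Height

section Presentation

variable {k : Type u} [Field k] {m n : ℕ}

theorem mem_pow_of_sub_mul_mem (a : Fin m × Fin n) {T : Set (Fin m × Fin n)} (ha : a ∉ T) {e : ℕ}
    {p : MvPolynomial (Bool × Fin m × Fin n) k}
    (h : (X (true, a) - X (false, a)) * p ∈
      Ideal.span ((fun a => X (true, a) - X (false, a)) '' T) ^ e) :
    p ∈ Ideal.span ((fun a => X (true, a) - X (false, a)) '' T) ^ e := by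
  set I : Ideal (MvPolynomial (Bool × Fin m × Fin n) k) :=
    Ideal.span ((fun a => X (true, a) - X (false, a)) '' T) with hI
  have h1 : I ≤ (I.map Polynomial.C).comap (sepDiff k true a) := by
    conv_lhs => rw [hI]
    rw [Ideal.span_le]
    rintro _ ⟨a', ha', rfl⟩
    have hne : a' ≠ a := fun h => ha (h ▸ ha')
    have : sepDiff k true a (X (true, a') - X (false, a')) =
        Polynomial.C (X (true, a') - X (false, a')) := by
      simp [sepDiff, hne]
    change sepDiff k true a (X (true, a') - X (false, a')) ∈ I.map Polynomial.C
    rw [this]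
    exact Ideal.mem_map_of_mem _ (Ideal.subset_span ⟨a', ha', rfl⟩)
  have h2 : I ^ e ≤ ((I ^ e).map Polynomial.C).comap (sepDiff k true a) := by
    refine (Ideal.pow_right_mono h1 e).trans ((Ideal.le_comap_pow _ e).trans ?_)
    rw [Ideal.map_pow]
  have h3 : sepDiff k true a (X (true, a) - X (false, a)) = Polynomial.X := by
    simp [sepDiff]
  have h4 := h2 h
  rw [Ideal.mem_comap, map_mul, h3, Ideal.mem_map_C_iff] at h4
  rw [← eval_sepDiff true a p, Polynomial.eval_eq_sum_range]
  refine sum_mem fun i _ => Ideal.mul_mem_right _ _ ?_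
  simpa [Polynomial.coeff_X_mul] using h4 (i + 1)

theorem exists_reesPresentation_diagonal :
    ∃ (R : Type u) (_ : CommRing R) (_ : IsRegularRing R)
      (χ : R →+* reesAlgebra (diagonal k m n)), ReesPresentation (diagonal k m n) (m * n) χ := by
  have e : Fin (m * n) ≃ Fin m × Fin n := finProdFinEquiv.symm
  have hz : Set.range (fun i : Fin (m * n) => (X (true, e i) - X (false, e i) :
      MvPolynomial (Bool × Fin m × Fin n) k)) = Set.range fun a : Fin m × Fin n =>
        X (true, a) - X (false, a) :=
    e.surjective.range_comp fun a : Fin m × Fin n => X (true, a) - X (false, a)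
  have key := exists_reesPresentation (m * n) (MvPolynomial (Bool × Fin m × Fin n) k)
    (fun i => X (true, e i) - X (false, e i)) fun i l p h => by
      rw [← Function.comp_def (fun a => X (true, a) - X (false, a)) e, Set.image_comp] at h ⊢
      exact mem_pow_of_sub_mul_mem (e i) (by simp) h
  rw [hz] at key
  exact key

end Presentation

section ReesMap

variable {P S : Type u} [CommRing P] [CommRing S]

/-- The map induced on Rees algebras by a ring homomorphism. -/
noncomputable def reesMap (π : P →+* S) (𝔷 : Ideal P) : reesAlgebra 𝔷 →+* reesAlgebra (𝔷.map π) :=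
  ((Polynomial.mapRingHom π).comp (reesAlgebra 𝔷).val.toRingHom).codRestrict
    (reesAlgebra (𝔷.map π)) fun p => (mem_reesAlgebra_iff _ _).2 fun i => by
      rw [← Ideal.map_pow]
      change ((p : Polynomial P).map π).coeff i ∈ _
      rw [Polynomial.coeff_map]
      exact Ideal.mem_map_of_mem _ ((mem_reesAlgebra_iff _ _).1 p.2 i)

theorem coeff_reesMap (π : P →+* S) (𝔷 : Ideal P) (p : reesAlgebra 𝔷) (i : ℕ) :
    (reesMap π 𝔷 p : Polynomial S).coeff i = π ((p : Polynomial P).coeff i) :=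
  Polynomial.coeff_map (p := (p : Polynomial P)) π i

theorem reesMap_surjective {π : P →+* S} (hπ : Function.Surjective π) (𝔷 : Ideal P) :
    Function.Surjective (reesMap π 𝔷) := by
  intro y
  obtain ⟨q, hq⟩ := exists_polynomial_coeff (y : Polynomial S) (fun y x i => x ∈ 𝔷 ^ i ∧ π x = y)
    (fun i => ⟨zero_mem _, map_zero π⟩) fun i => by
      have := (mem_reesAlgebra_iff _ _).1 y.2 i
      rw [← Ideal.map_pow, Ideal.mem_map_iff_of_surjective _ hπ] at this
      exact this
  refine ⟨⟨q, (mem_reesAlgebra_iff _ _).2 fun i => (hq i).1⟩, Subtype.ext <|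
    Polynomial.ext fun i => ?_⟩
  rw [coeff_reesMap]
  exact (hq i).2

theorem projDimLT_reesAlgebra_map {R : Type u} [CommRing R] {π : P →+* S}
    (hπ : Function.Surjective π) {𝔷 : Ideal P} {χ : R →+* reesAlgebra 𝔷} {c : ℕ}
    (h1 : ProjDimLT χ (filtPoly 𝔷 1 (RingHom.ker π)) c)
    (h2 : ProjDimLT χ (filtPoly 𝔷 1 ⊤) (c + 1)) :
    ProjDimLT ((reesMap π 𝔷).comp χ) (reesAlgebra (𝔷.map π)) (c + 1) := by
  have hmem : ∀ p : filtPoly 𝔷 1 ⊤, (p : Polynomial P) ∈ reesAlgebra 𝔷 := fun p =>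
    (mem_reesAlgebra_iff _ _).2 fun i => (p.2 i).1
  refine (ProjDimLT.shortExact_cases (χ₁ := χ) (χ₂ := χ) (χ₃ := (reesMap π 𝔷).comp χ)
    (M₁ := filtPoly 𝔷 1 (RingHom.ker π)) (M₂ := filtPoly 𝔷 1 ⊤) (M₃ := reesAlgebra (𝔷.map π))
    (AddMonoidHom.mk' (fun p => ⟨p.1, fun i => ⟨(p.2 i).1, trivial⟩⟩) fun p q => rfl)
    (AddMonoidHom.mk' (fun p => reesMap π 𝔷 ⟨p.1, hmem p⟩) fun p q =>
      map_add (reesMap π 𝔷) ⟨p.1, hmem p⟩ ⟨q.1, hmem q⟩)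
    ?_ ?_ ?_ ?_ ?_ c).2.1 h1 h2
  · exact fun r m => rfl
  · exact fun r m => map_mul (reesMap π 𝔷) (χ r) ⟨m.1, hmem m⟩
  · exact fun p q h => Subtype.ext (congrArg (fun x => x.1) h)
  · intro y
    obtain ⟨x, rfl⟩ := reesMap_surjective hπ 𝔷 y
    exact ⟨⟨x.1, fun i => ⟨(mem_reesAlgebra_iff _ _).1 x.2 i, trivial⟩⟩, rfl⟩
  · intro p
    constructor
    · intro h
      refine ⟨⟨p.1, fun i => ⟨(p.2 i).1, ?_⟩⟩, rfl⟩
      rw [RingHom.mem_ker, ← coeff_reesMap π 𝔷 ⟨p.1, hmem p⟩ i]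
      exact (congrArg (fun x => x.1.coeff i) h).trans (Polynomial.coeff_zero i)
    · rintro ⟨q, rfl⟩
      refine Subtype.ext (Polynomial.ext fun i => ?_)
      refine (coeff_reesMap π 𝔷 ⟨q.1, _⟩ i).trans ?_
      exact (RingHom.mem_ker.1 (q.2 i).2).trans (Polynomial.coeff_zero i).symm

end ReesMap

theorem isCohenMacaulayRing_reesAlgebra_diagonal_map {k : Type u} [Field k] {m n : ℕ} [NeZero m]
    {s : Bool → ℕ} {A : Bool → Finset (Fin n)} {S : Type u} [CommRing S]
    {π : MvPolynomial (Bool × Fin m × Fin n) k →+* S} (hπ : Function.Surjective π)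
    (hker : RingHom.ker π = pairIdeal k m s A) (h1 : ∀ b, 1 ≤ s b) (hm : ∀ b, s b ≤ m)
    (hmn : 1 + pdShift s A ≤ m * n) :
    IsCohenMacaulayRing (reesAlgebra ((diagonal k m n).map π)) := by
  obtain ⟨R, _, _, χ, hχ⟩ := exists_reesPresentation_diagonal (k := k) (m := m) (n := n)
  have hN : 1 ≤ m * n := by omega
  have hH := hasBounds hN hχ _ s A hm rfl
  refine isCohenMacaulayRing_of_projDimLT ((reesMap π (diagonal k m n)).comp χ)
    ((reesMap_surjective hπ _).comp hχ.surjective) (pdBound (m * n) s A)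
    (projDimLT_reesAlgebra_map hπ ?_ ?_) ?_
  · rw [hker]
    exact hH.2 1 hN hmn
  · have := hχ.projDim 1
    rw [if_pos hN] at this
    refine this.mono ?_
    rw [pdBound]
    omega
  · refine (le_height_pairKer hN hχ h1 hm _ A rfl).trans (Ideal.height_mono fun x hx => ?_)
    rw [mem_pairKer, ← hker] at hx
    refine RingHom.mem_ker.2 (Subtype.ext (Polynomial.ext fun i => ?_))
    exact (coeff_reesMap π _ (χ x) i).trans
      ((RingHom.mem_ker.1 (hx i)).trans (Polynomial.coeff_zero i).symm)

theorem colDet_eq_zero_of_not_injective {P : Type*} [CommRing P] {n : ℕ} (r : ℕ → Fin n → P) {s : ℕ}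
    {c : Fin s → Fin n} (hc : ¬ Function.Injective c) : colDet r c = 0 := by
  rw [Function.not_injective_iff] at hc
  obtain ⟨i, j, hij, hne⟩ := hc
  exact Matrix.det_zero_of_column_eq hne fun l => by simp [hij]

theorem colDet_comp_perm {P : Type*} [CommRing P] {n : ℕ} (r : ℕ → Fin n → P) {s : ℕ}
    (c : Fin s → Fin n) (σ : Equiv.Perm (Fin s)) :
    colDet r (c ∘ σ) = (Equiv.Perm.sign σ : ℤ) * colDet r c :=
  Matrix.det_permute' σ (Matrix.of fun i j => r i (c j))

theorem maxMinors_eq_colMinors {k : Type*} [Field k] {τ : Type*} (v : ℕ → ℕ → τ) {s t n : ℕ}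
    (hs : 1 ≤ s) (ht : t ≤ n) :
    maxMinors k s t v =
      colMinors (fun i (l : Fin n) => (X (v (i + 1) (l + 1)) : MvPolynomial τ k)) s {l | (l : ℕ) < t} := by
  refine le_antisymm ?_ (colMinors_le.2 fun c hc => ?_)
  · rw [maxMinors, Ideal.span_le]
    rintro d ⟨c, hmono, hc1, hcs, rfl⟩
    have h1 : ∀ j : Fin s, 1 ≤ c (j + 1) := fun j =>
      hc1.trans (hmono.monotoneOn ⟨le_rfl, hs⟩ ⟨by omega, by omega⟩ (by omega))
    have h2 : ∀ j : Fin s, c (j + 1) ≤ t := fun j =>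
      (hmono.monotoneOn ⟨by omega, by omega⟩ ⟨hs, le_rfl⟩ (by omega)).trans hcs
    have h3 := colDet_mem (r := fun i (l : Fin n) => (X (v (i + 1) (l + 1)) : MvPolynomial τ k))
      (B := {l : Fin n | (l : ℕ) < t})
      (c := fun j : Fin s => ⟨c (j + 1) - 1, by have := h1 j; have := h2 j; omega⟩) fun j => by
        have := h1 j
        have := h2 j
        simp only [mem_filter, mem_univ, true_and]
        omega
    change Matrix.det _ ∈ colMinors _ _ _
    convert h3 using 1
    rw [colDet]
    congr 1
    ext i j : 2
    simp only [Matrix.of_apply]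
    rw [Nat.sub_add_cancel (h1 j)]
  · by_cases hinj : Function.Injective c
    swap
    · rw [colDet_eq_zero_of_not_injective _ hinj]
      exact zero_mem _
    have hσ := (Tuple.monotone_sort c).strictMono_of_injective
      (hinj.comp (Tuple.sort c).injective)
    set σ := Tuple.sort c
    have h1 : colDet (fun i (l : Fin n) => (X (v (i + 1) (l + 1)) : MvPolynomial τ k)) (c ∘ σ) ∈
        maxMinors k s t v := by
      refine Ideal.subset_span ⟨fun j => if h : j - 1 < s then (c (σ ⟨j - 1, h⟩) : ℕ) + 1 else 0,
        ?_, ?_, ?_, ?_⟩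
      · intro i hi j hj hij
        have hi := Set.mem_Icc.1 hi
        have hj := Set.mem_Icc.1 hj
        dsimp only
        rw [dif_pos (by omega), dif_pos (by omega), Nat.add_lt_add_iff_right]
        exact hσ (Fin.mk_lt_mk.2 (by omega))
      · dsimp only
        rw [dif_pos (by omega)]
        omega
      · dsimp only
        rw [dif_pos (by omega)]
        simpa using hc (σ ⟨s - 1, by omega⟩)
      · rw [colDet]
        congr 1
        ext i j : 2
        simp
    rw [colDet_comp_perm] at h1
    have h2 := Ideal.mul_mem_left _ (((Equiv.Perm.sign σ : ℤ)) : MvPolynomial τ k) h1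
    rw [← mul_assoc, ← Int.cast_mul, Int.units_coe_mul_self, Int.cast_one, one_mul] at h2
    exact h2

theorem map_colMinors {P Q : Type*} [CommRing P] [CommRing Q] (f : P →+* Q) {n : ℕ}
    (r : ℕ → Fin n → P) (s : ℕ) (B : Finset (Fin n)) :
    (colMinors r s B).map f = colMinors (fun i l => f (r i l)) s B := by
  rw [colMinors, colMinors, Ideal.map_span]
  congr 1
  ext d
  constructor
  · rintro ⟨_, ⟨c, hc, rfl⟩, rfl⟩
    exact ⟨c, hc, map_colDet f r c⟩
  · rintro ⟨c, hc, rfl⟩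
    exact ⟨_, ⟨c, hc, rfl⟩, map_colDet f r c⟩

/-- The indices of the entries of a pair of matrices. -/
def pairIndexEquiv (Ω : Type*) : Bool × Ω ≃ Ω ⊕ Ω where
  toFun v := if v.1 then Sum.inl v.2 else Sum.inr v.2
  invFun := Sum.elim (fun a => (true, a)) fun a => (false, a)
  left_inv := by rintro ⟨_ | _, a⟩ <;> rfl
  right_inv := by rintro (a | a) <;> rfl

theorem ent_add_one {m n : ℕ} [NeZero m] (hm : 0 < m) (hn : 0 < n) (i : ℕ) (l : Fin n) :
    ent m n hm hn (i + 1) (l + 1) = (Fin.ofNat m i, l) :=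
  Prod.ext rfl (Fin.ext (Nat.mod_eq_of_lt l.2))

theorem map_pairIndexEquiv_colMinors {k : Type*} [Field k] {m n : ℕ} [NeZero m] (hm : 0 < m)
    (hn : 0 < n) {s t : ℕ} (hs : 1 ≤ s) (ht : t ≤ n) (b : Bool) :
    (colMinors (pairRow k m n b) s {l | (l : ℕ) < t}).map
        (renameEquiv k (pairIndexEquiv (Fin m × Fin n)) : _ →+* MvPolynomial (Vxy m n) k) =
      maxMinors k s t (fun i j => (pairIndexEquiv _ (b, ent m n hm hn i j) : Vxy m n)) := by
  rw [maxMinors_eq_colMinors _ hs ht, map_colMinors]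
  congr 1
  funext i l
  rw [ent_add_one]
  exact rename_X _ _

theorem pairIdeal_map_pairIndexEquiv {k : Type*} [Field k] {m n : ℕ} [NeZero m] (hm : 0 < m)
    (hn : 0 < n) {s₁ s₂ t₁ t₂ : ℕ} (hs₁ : 1 ≤ s₁) (hs₂ : 1 ≤ s₂) (ht₁ : t₁ ≤ n) (ht₂ : t₂ ≤ n) :
    (pairIdeal k m (fun b => bif b then s₁ else s₂)
        fun b => {l : Fin n | (l : ℕ) < bif b then t₁ else t₂}).map
          (renameEquiv k (pairIndexEquiv (Fin m × Fin n)) : _ →+* MvPolynomial (Vxy m n) k) =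
      maxMinors k s₁ t₁ (fun i j => (Sum.inl (ent m n hm hn i j) : Vxy m n)) ⊔
        maxMinors k s₂ t₂ (fun i j => (Sum.inr (ent m n hm hn i j) : Vxy m n)) := by
  rw [pairIdeal_eq _ _ true, Ideal.map_sup]
  exact congrArg₂ _ (map_pairIndexEquiv_colMinors hm hn hs₁ ht₁ true)
    (map_pairIndexEquiv_colMinors hm hn hs₂ ht₂ false)

theorem diagIdeal_eq_map (k : Type*) [Field k] {m n : ℕ} (s₁ s₂ t₁ t₂ : ℕ)
    (hm : 0 < m) (hn : 0 < n) :
    diagIdeal k m n s₁ s₂ t₁ t₂ hm hn = (diagonal k m n).map ((Ideal.Quotient.mk _).comp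
      (renameEquiv k (pairIndexEquiv (Fin m × Fin n)) : _ →+* MvPolynomial (Vxy m n) k)) := by
  have : NeZero m := ⟨hm.ne'⟩
  have hX : ∀ b (a : Fin m × Fin n), renameEquiv k (pairIndexEquiv (Fin m × Fin n)) (X (b, a)) =
      X (pairIndexEquiv _ (b, a)) := fun b a => rename_X _ _
  rw [diagIdeal, diagonal, Ideal.map_span]
  congr 1
  ext d
  constructor
  · rintro ⟨i, j, -, -, -, -, rfl⟩
    refine ⟨_, ⟨ent m n hm hn i j, rfl⟩, congrArg (Ideal.Quotient.mk _) ?_⟩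
    exact (map_sub (renameEquiv k (pairIndexEquiv (Fin m × Fin n))) _ _).trans
      (congrArg₂ _ (hX _ _) (hX _ _))
  · rintro ⟨_, ⟨⟨i, l⟩, rfl⟩, rfl⟩
    refine ⟨i + 1, l + 1, by omega, by omega, by omega, by omega,
      congrArg (Ideal.Quotient.mk _) ?_⟩
    rw [ent_add_one, Fin.ofNat_eq_cast, Fin.cast_val_eq_self]
    exact (map_sub (renameEquiv k (pairIndexEquiv (Fin m × Fin n))) _ _).trans
      (congrArg₂ _ (hX _ _) (hX _ _))

/-- **Theorem 1.1** (Cohen–Macaulayness of Rees algebras of diagonal ideals).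
If `I` and `J` are generated by the maximal minors of submatrices of `X`, then the Rees
algebra `R(𝔻) = ⊕ᵢ 𝔻ⁱtⁱ ⊆ S[t]` of the diagonal ideal `𝔻` is Cohen–Macaulay. -/
theorem reesAlgebra_diagIdeal_isCohenMacaulay
    (k : Type*) [Field k] (m n s₁ s₂ t₁ t₂ : ℕ)
    (hm2 : 2 ≤ m) (hmn : m ≤ n) (hs2 : 2 ≤ s₂) (hs21 : s₂ ≤ s₁) (hs1m : s₁ ≤ m)
    (hs1t1 : s₁ ≤ t₁) (ht1n : t₁ ≤ n) (hs2t2 : s₂ ≤ t₂) (ht2n : t₂ ≤ n) :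
    IsCohenMacaulayRing
      (reesAlgebra (diagIdeal k m n s₁ s₂ t₁ t₂ (by omega) (by omega))) := by
  have : NeZero m := ⟨by omega⟩
  rw [diagIdeal_eq_map]
  refine isCohenMacaulayRing_reesAlgebra_diagonal_map (s := fun b => bif b then s₁ else s₂)
    (A := fun b => {l : Fin n | (l : ℕ) < bif b then t₁ else t₂})
    (Ideal.Quotient.mk_surjective.comp (renameEquiv k _).surjective) ?_ ?_ ?_ ?_
  · rw [← RingHom.comap_ker, Ideal.mk_ker,
      ← pairIdeal_map_pairIndexEquiv (by omega) (by omega) (by omega) (by omega) ht1n ht2n]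
    exact Ideal.comap_map_of_bijective _ (renameEquiv k _).bijective
  · rintro (_ | _) <;> simp <;> omega
  · rintro (_ | _) <;> simp <;> omega
  · have h1 : pdShift (n := n) (fun b => bif b then s₁ else s₂)
        (fun b => {l : Fin n | (l : ℕ) < bif b then t₁ else t₂}) ≤ n - 1 := by
      rw [pdShift]
      have := card_le_univ (({l | (l : ℕ) < t₁} : Finset (Fin n)) ∩
        ({l | (l : ℕ) < t₂} : Finset (Fin n)))
      rw [Fintype.card_fin] at this
      simp only [cond_true, cond_false]
      omega
    have h2 : 2 * n ≤ m * n := Nat.mul_le_mul_right n hm2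
    omega
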